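/- For every 3-graph F, the uniform Turán density of F equals its palette Turán density: π_u(F) = π_pal(F). -/

import Mathlib

/-- A 3-uniform hypergraph on a finite vertex set (encoded inside `ℕ`). -/
structure Hypergraph3 where
  verts : Finset ℕ
  edges : Finset (Finset ℕ)
  edges_sub : ∀ e ∈ edges, e ⊆ verts
  edges_card : ∀ e ∈ edges, e.card = 3

/-- A 3-graph `H` is `(d, ε)`-uniformly dense if every subset `S` of its vertex set
contains at least `d·binom(|S|,3) − ε·|V(H)|³` edges. -/
def Hypergraph3.UniformlyDense (H : Hypergraph3) (d ε : ℝ) : Prop :=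
  ∀ S ⊆ H.verts,
    d * (S.card.choose 3 : ℝ) - ε * (H.verts.card : ℝ) ^ 3 ≤
      ((H.edges.filter fun e => e ⊆ S).card : ℝ)

/-- `H` contains the 3-graph with vertex type `V` and edge set `E` as a subgraph:
there is an injective map of the vertices sending every edge to an edge. -/
def Hypergraph3.Contains {V : Type} [DecidableEq V] (H : Hypergraph3)
    (E : Set (Finset V)) : Prop :=
  ∃ f : V → ℕ, Function.Injective f ∧ (∀ v, f v ∈ H.verts) ∧
    ∀ e ∈ E, e.image f ∈ H.edges

/-- The uniform Turán density of a 3-graph: the infimum of all `d ∈ [0,1]` such that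
for some `ε > 0` and `N`, every `(d, ε)`-uniformly dense 3-graph on at least `N`
vertices contains it. -/
noncomputable def uniformTuranDensity {V : Type} [DecidableEq V]
    (E : Set (Finset V)) : ℝ :=
  sInf {d : ℝ | d ∈ Set.Icc (0 : ℝ) 1 ∧ ∃ ε > (0 : ℝ), ∃ N : ℕ,
    ∀ H : Hypergraph3, N ≤ H.verts.card → H.UniformlyDense d ε → H.Contains E}

/-- A palette: a finite nonempty set of colors together with a set of
admissible ordered triples of colors. -/
structure Palette (α : Type) [DecidableEq α] where
  colors : Finset α
  nonempty : colors.Nonempty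
  triples : Finset (α × α × α)
  triples_sub : triples ⊆ colors ×ˢ colors ×ˢ colors

/-- The density of a palette: `|A| / |C|³`. -/
noncomputable def Palette.density {α : Type} [DecidableEq α] (P : Palette α) : ℝ :=
  (P.triples.card : ℝ) / (P.colors.card : ℝ) ^ 3

/-- A 3-graph, given by its edge set `E` on vertex type `V`, admits the palette `P`
if there are a linear (strict total) order on the vertices and a coloring of the
unordered pairs of vertices such that every edge, listed in increasing order,
receives an admissible triple. -/
def Palette.Admits {α : Type} [DecidableEq α] {V : Type} [DecidableEq V]
    (P : Palette α) (E : Set (Finset V)) : Prop :=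
  ∃ r : V → V → Prop, IsStrictTotalOrder V r ∧
    ∃ φ : Sym2 V → α, (∀ p, φ p ∈ P.colors) ∧
      ∀ u v w : V, r u v → r v w → ({u, v, w} : Finset V) ∈ E →
        (φ s(u, v), φ s(u, w), φ s(v, w)) ∈ P.triples

section FiniteCondExp

variable {X ι κ : Type*} [Fintype X] [DecidableEq ι] [DecidableEq κ]

/-- The `μ`-weighted average of `g` over the fibre `N = i`. -/
noncomputable def fibAvg (μ : X → ℝ) (N : X → ι) (g : X → ℝ) (i : ι) : ℝ :=
  (∑ x with N x = i, μ x * g x) / ∑ x with N x = i, μ x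

/-- The conditional expectation of `g` given `N` on the weighted finite set `(X, μ)`. -/
noncomputable def cexp (μ : X → ℝ) (N : X → ι) (g : X → ℝ) (x : X) : ℝ :=
  fibAvg μ N g (N x)

/-- The squared `L²`-norm of the conditional expectation of `g` given `N`. -/
noncomputable def energy (μ : X → ℝ) (N : X → ι) (g : X → ℝ) : ℝ :=
  ∑ x, μ x * cexp μ N g x ^ 2

variable {μ : X → ℝ} {N : X → ι} {N' : X → κ} {g : X → ℝ}

lemma cexp_factorsThrough : (cexp μ N g).FactorsThrough N := by
  intro x y h
  simp [cexp, h]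

lemma sum_cexp_mul (hμ : ∀ x, 0 ≤ μ x) {u : X → ℝ} (hu : u.FactorsThrough N) :
    ∑ x, μ x * (cexp μ N g x * u x) = ∑ x, μ x * (g x * u x) := by
  classical
  rw [← Finset.sum_fiberwise_of_maps_to (s := Finset.univ) (t := Finset.univ.image N) (g := N)
      (fun x _ => Finset.mem_image_of_mem _ (Finset.mem_univ x)),
    ← Finset.sum_fiberwise_of_maps_to (s := Finset.univ) (t := Finset.univ.image N) (g := N)
      (fun x _ => Finset.mem_image_of_mem _ (Finset.mem_univ x))]
  refine Finset.sum_congr rfl fun i hi => ?_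
  obtain ⟨x₀, -, hx₀⟩ := Finset.mem_image.1 hi
  have hl : ∀ x ∈ Finset.univ.filter (fun x => N x = i),
      μ x * (cexp μ N g x * u x) = μ x * (fibAvg μ N g i * u x₀) := by
    intro x hx
    have hx : N x = i := by simpa using hx
    rw [cexp, hx, hu (hx.trans hx₀.symm)]
  have hr : ∀ x ∈ Finset.univ.filter (fun x => N x = i),
      μ x * (g x * u x) = (μ x * g x) * u x₀ := by
    intro x hx
    have hx : N x = i := by simpa using hx
    rw [hu (hx.trans hx₀.symm), mul_assoc]
  rw [Finset.sum_congr rfl hl, Finset.sum_congr rfl hr, ← Finset.sum_mul, ← Finset.sum_mul,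
    ← mul_assoc]
  congr 1
  by_cases hm : ∑ x with N x = i, μ x = 0
  · have h0 := (Finset.sum_eq_zero_iff_of_nonneg (fun x _ => hμ x)).1 hm
    rw [hm, zero_mul, eq_comm]
    exact Finset.sum_eq_zero fun x hx => by rw [h0 x hx, zero_mul]
  · rw [fibAvg, mul_div_cancel₀ _ hm]

lemma sum_cexp (hμ : ∀ x, 0 ≤ μ x) : ∑ x, μ x * cexp μ N g x = ∑ x, μ x * g x := by
  simpa using sum_cexp_mul (N := N) (g := g) hμ (u := fun _ => 1) (fun _ _ _ => rfl)

lemma cexp_nonneg (hμ : ∀ x, 0 ≤ μ x) (hg : ∀ x, 0 ≤ g x) (x : X) : 0 ≤ cexp μ N g x :=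
  div_nonneg (Finset.sum_nonneg fun y _ => mul_nonneg (hμ y) (hg y))
    (Finset.sum_nonneg fun y _ => hμ y)

lemma cexp_le_one (hμ : ∀ x, 0 ≤ μ x) (hg : ∀ x, g x ≤ 1) (x : X) : cexp μ N g x ≤ 1 :=
  div_le_one_of_le₀ (Finset.sum_le_sum fun y _ => mul_le_of_le_one_right (hμ y) (hg y))
    (Finset.sum_nonneg fun y _ => hμ y)

lemma cexp_sub (f g : X → ℝ) (x : X) :
    cexp μ N (fun y => f y - g y) x = cexp μ N f x - cexp μ N g x := by
  simp [cexp, fibAvg, mul_sub, Finset.sum_sub_distrib, sub_div]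

lemma sq_sum_le_sum_sq (hμ : ∀ x, 0 ≤ μ x) (h1 : ∑ x, μ x = 1) (f : X → ℝ) :
    (∑ x, μ x * f x) ^ 2 ≤ ∑ x, μ x * f x ^ 2 := by
  set m := ∑ x, μ x * f x with hm
  have h : 0 ≤ ∑ x, μ x * (f x - m) ^ 2 :=
    Finset.sum_nonneg fun x _ => mul_nonneg (hμ x) (sq_nonneg _)
  have e : ∑ x, μ x * (f x - m) ^ 2
      = ∑ x, μ x * f x ^ 2 - 2 * m * ∑ x, μ x * f x + m ^ 2 * ∑ x, μ x := by
    have : ∀ x, μ x * (f x - m) ^ 2 = μ x * f x ^ 2 - 2 * m * (μ x * f x) + m ^ 2 * μ x :=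
      fun x => by ring
    simp only [this, Finset.sum_add_distrib, Finset.sum_sub_distrib, ← Finset.mul_sum]
  rw [e, h1, ← hm] at h
  nlinarith

lemma energy_sub (hμ : ∀ x, 0 ≤ μ x) (hN : N.FactorsThrough N') :
    energy μ N' g - energy μ N g = ∑ x, μ x * (cexp μ N' g x - cexp μ N g x) ^ 2 := by
  have hc : (cexp μ N g).FactorsThrough N' := fun x y h => cexp_factorsThrough (hN h)
  have h1 := sum_cexp_mul (g := g) hμ hc
  have h2 := sum_cexp_mul (g := g) (N := N) hμ (cexp_factorsThrough (μ := μ) (g := g))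
  have e : ∑ x, μ x * (cexp μ N' g x - cexp μ N g x) ^ 2
      = energy μ N' g - 2 * ∑ x, μ x * (cexp μ N' g x * cexp μ N g x) + energy μ N g := by
    rw [energy, energy, Finset.mul_sum, ← Finset.sum_sub_distrib, ← Finset.sum_add_distrib]
    exact Finset.sum_congr rfl fun x _ => by ring
  have e2 : energy μ N g = ∑ x, μ x * (cexp μ N g x * cexp μ N g x) :=
    Finset.sum_congr rfl fun x _ => by ring
  rw [e, h1, ← h2, ← e2]
  ring

lemma energy_mono (hμ : ∀ x, 0 ≤ μ x) (hN : N.FactorsThrough N') :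
    energy μ N g ≤ energy μ N' g := by
  have := energy_sub (g := g) hμ hN
  have h : 0 ≤ ∑ x, μ x * (cexp μ N' g x - cexp μ N g x) ^ 2 :=
    Finset.sum_nonneg fun x _ => mul_nonneg (hμ x) (sq_nonneg _)
  linarith

lemma energy_nonneg (hμ : ∀ x, 0 ≤ μ x) : 0 ≤ energy μ N g :=
  Finset.sum_nonneg fun x _ => mul_nonneg (hμ x) (sq_nonneg _)

lemma energy_le_one (hμ : ∀ x, 0 ≤ μ x) (h1 : ∑ x, μ x = 1) (hg : ∀ x, 0 ≤ g x)
    (hg' : ∀ x, g x ≤ 1) : energy μ N g ≤ 1 := by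
  rw [← h1]
  refine Finset.sum_le_sum fun x _ => mul_le_of_le_one_right (hμ x) ?_
  exact pow_le_one₀ (cexp_nonneg hμ hg x) (cexp_le_one hμ hg' x)

/-- If `u` is measurable with respect to a refinement `N'` of `N`, the correlation of `u` with
`g - E[g | N]` is controlled by the energy increment. -/
lemma sq_sum_sub_cexp_mul_le (hμ : ∀ x, 0 ≤ μ x) (h1 : ∑ x, μ x = 1)
    (hN : N.FactorsThrough N') {u : X → ℝ} (hu : u.FactorsThrough N') (hu1 : ∀ x, |u x| ≤ 1) :
    (∑ x, μ x * ((g x - cexp μ N g x) * u x)) ^ 2 ≤ energy μ N' g - energy μ N g := by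
  have e : ∑ x, μ x * ((g x - cexp μ N g x) * u x)
      = ∑ x, μ x * ((cexp μ N' g x - cexp μ N g x) * u x) := by
    have h := sum_cexp_mul (g := g) hμ hu
    simp only [sub_mul, mul_sub, Finset.sum_sub_distrib, h]
  rw [e, energy_sub hμ hN]
  refine (sq_sum_le_sum_sq hμ h1 _).trans (Finset.sum_le_sum fun x _ => ?_)
  refine mul_le_mul_of_nonneg_left ?_ (hμ x)
  rw [mul_pow]
  exact mul_le_of_le_one_right (sq_nonneg _) ((sq_le_one_iff_abs_le_one _).2 (hu1 x))

end FiniteCondExp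

section ProductExpectation

variable {I X : Type*} [Fintype I] [Fintype X] [DecidableEq I]

/-- The expectation of `f` over independent coordinates with weights `μ i`. -/
noncomputable def pexp (μ : I → X → ℝ) (f : (I → X) → ℝ) : ℝ :=
  ∑ ω : I → X, (∏ i, μ i (ω i)) * f ω

/-- A family of probability weights. -/
def IsProb (μ : X → ℝ) : Prop := (∀ x, 0 ≤ μ x) ∧ ∑ x, μ x = 1

lemma weight_nonneg {I X : Type*} [Fintype I] [Fintype X] {μ : I → X → ℝ}
    (hμ : ∀ i, IsProb (μ i)) (ω : I → X) : 0 ≤ ∏ i, μ i (ω i) :=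
  Finset.prod_nonneg fun i _ => (hμ i).1 _

variable {μ : I → X → ℝ}

lemma pexp_update (i : I) (ν : X → ℝ) (h1 : ∑ x, μ i x = 1) (f : (I → X) → ℝ) :
    pexp (Function.update μ i ν) f
      = pexp μ (fun ω => ∑ x, ν x * f (Function.update ω i x)) := by
  have key : ∀ ω : I → X, ∀ x, (∏ j, μ j (ω j)) * ν x
      = (∏ j, Function.update μ i ν j (Function.update ω i x j)) * μ i (ω i) := by
    intro ω x
    rw [← Finset.mul_prod_erase _ (fun j => μ j (ω j)) (Finset.mem_univ i),
      ← Finset.mul_prod_erase _ (fun j => Function.update μ i ν j (Function.update ω i x j))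
        (Finset.mem_univ i)]
    have : ∏ j ∈ Finset.univ.erase i, Function.update μ i ν j (Function.update ω i x j)
        = ∏ j ∈ Finset.univ.erase i, μ j (ω j) := by
      refine Finset.prod_congr rfl fun j hj => ?_
      rw [Function.update_of_ne (Finset.ne_of_mem_erase hj),
        Function.update_of_ne (Finset.ne_of_mem_erase hj)]
    rw [this, Function.update_self, Function.update_self]
    ring
  have swap : ∑ p : (I → X) × X, (∏ j, μ j (p.1 j)) * ν p.2 * f (Function.update p.1 i p.2)
      = ∑ p : (I → X) × X, (∏ j, Function.update μ i ν j (p.1 j)) * μ i p.2 * f p.1 := by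
    refine Fintype.sum_bijective (fun p => (Function.update p.1 i p.2, p.1 i)) ?_ _ _ ?_
    · refine Function.Involutive.bijective fun p => ?_
      simp
    · intro p
      simp only [key p.1 p.2]
  simp only [Fintype.sum_prod_type] at swap
  have hl : pexp μ (fun ω => ∑ x, ν x * f (Function.update ω i x))
      = ∑ ω : I → X, ∑ x, (∏ j, μ j (ω j)) * ν x * f (Function.update ω i x) := by
    simp only [pexp, Finset.mul_sum, mul_assoc]
  rw [hl, swap, pexp]
  refine Finset.sum_congr rfl fun ω _ => ?_
  rw [← Finset.sum_mul, ← Finset.mul_sum, h1, mul_one]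

lemma pexp_avg (i : I) (h1 : ∑ x, μ i x = 1) (f : (I → X) → ℝ) :
    pexp μ (fun ω => ∑ x, μ i x * f (Function.update ω i x)) = pexp μ f := by
  rw [← pexp_update i (μ i) h1, Function.update_eq_self]

lemma pexp_one (hμ : ∀ i, IsProb (μ i)) : pexp μ (fun _ => 1) = 1 := by
  simp only [pexp, mul_one]
  rw [← Fintype.prod_sum]
  simp [(hμ _).2]

lemma pexp_mono (hμ : ∀ i, IsProb (μ i)) {f g : (I → X) → ℝ} (h : ∀ ω, f ω ≤ g ω) :
    pexp μ f ≤ pexp μ g :=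
  Finset.sum_le_sum fun ω _ => mul_le_mul_of_nonneg_left (h ω) (weight_nonneg hμ ω)

lemma pexp_nonneg (hμ : ∀ i, IsProb (μ i)) {f : (I → X) → ℝ} (h : ∀ ω, 0 ≤ f ω) :
    0 ≤ pexp μ f :=
  Finset.sum_nonneg fun ω _ => mul_nonneg (weight_nonneg hμ ω) (h ω)

lemma pexp_const (hμ : ∀ i, IsProb (μ i)) (c : ℝ) : pexp μ (fun _ => c) = c := by
  have h := pexp_one hμ
  simp only [pexp, mul_one] at h
  simp only [pexp]
  rw [← Finset.sum_mul, h, one_mul]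

lemma pexp_add (f g : (I → X) → ℝ) :
    pexp μ (fun ω => f ω + g ω) = pexp μ f + pexp μ g := by
  simp [pexp, mul_add, Finset.sum_add_distrib]

lemma pexp_sub (f g : (I → X) → ℝ) :
    pexp μ (fun ω => f ω - g ω) = pexp μ f - pexp μ g := by
  simp [pexp, mul_sub, Finset.sum_sub_distrib]

lemma pexp_const_mul (c : ℝ) (f : (I → X) → ℝ) :
    pexp μ (fun ω => c * f ω) = c * pexp μ f := by
  simp only [pexp, Finset.mul_sum]
  exact Finset.sum_congr rfl fun ω _ => by ring

lemma pexp_sum {J : Type*} (s : Finset J) (f : J → (I → X) → ℝ) :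
    pexp μ (fun ω => ∑ j ∈ s, f j ω) = ∑ j ∈ s, pexp μ (f j) := by
  simp only [pexp, Finset.mul_sum]
  rw [Finset.sum_comm]

lemma abs_pexp_le (hμ : ∀ i, IsProb (μ i)) (f : (I → X) → ℝ) :
    |pexp μ f| ≤ pexp μ (fun ω => |f ω|) := by
  refine (Finset.abs_sum_le_sum_abs _ _).trans (Finset.sum_le_sum fun ω _ => ?_)
  rw [abs_mul, abs_of_nonneg (weight_nonneg hμ ω)]

lemma abs_pexp_le_of_abs_le (hμ : ∀ i, IsProb (μ i)) {f : (I → X) → ℝ} {c : ℝ}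
    (h : ∀ ω, |f ω| ≤ c) : |pexp μ f| ≤ c :=
  (abs_pexp_le hμ f).trans ((pexp_mono hμ h).trans_eq (pexp_const hμ c))

lemma sq_pexp_le (hμ : ∀ i, IsProb (μ i)) (f : (I → X) → ℝ) :
    pexp μ f ^ 2 ≤ pexp μ (fun ω => f ω ^ 2) := by
  refine sq_sum_le_sum_sq (weight_nonneg hμ) ?_ f
  simpa [pexp] using pexp_one hμ

lemma exists_le_of_pexp_le (hμ : ∀ i, IsProb (μ i)) {f : (I → X) → ℝ} {c : ℝ}
    (h : c ≤ pexp μ f) : ∃ ω, c ≤ f ω := by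
  by_contra! hf
  have hpos : ∃ ω : I → X, 0 < ∏ i, μ i (ω i) := by
    by_contra! h0
    have := pexp_one hμ
    have hz : pexp μ (fun _ => 1) ≤ 0 := by
      refine Finset.sum_nonpos fun ω _ => ?_
      rw [mul_one]
      exact h0 ω
    linarith
  obtain ⟨ω₀, hω₀⟩ := hpos
  have : pexp μ f < pexp μ (fun _ => c) :=
    Finset.sum_lt_sum (fun ω _ => mul_le_mul_of_nonneg_left (hf ω).le (weight_nonneg hμ ω))
      ⟨ω₀, Finset.mem_univ _, mul_lt_mul_of_pos_left (hf ω₀) hω₀⟩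
  rw [pexp_const hμ] at this
  linarith

/-- Changing the weights of coordinates on which `f` does not depend. -/
lemma pexp_congr_weight {μ' : I → X → ℝ} (hμ : ∀ i, IsProb (μ i)) (hμ' : ∀ i, IsProb (μ' i))
    {f : (I → X) → ℝ} (hf : ∀ i, μ i ≠ μ' i → ∀ ω x, f (Function.update ω i x) = f ω) :
    pexp μ f = pexp μ' f := by
  have step : ∀ s : Finset I, pexp (fun i => if i ∈ s then μ' i else μ i) f = pexp μ f := by
    intro s
    induction s using Finset.induction_on with
    | empty => simp
    | insert i s hi ih =>
      rw [← ih]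
      have e : (fun j => if j ∈ insert i s then μ' j else μ j)
          = Function.update (fun j => if j ∈ s then μ' j else μ j) i (μ' i) := by
        funext j
        by_cases hj : j = i
        · subst hj; simp
        · simp [hj]
      rw [e, pexp_update _ _ (by simp [hi, (hμ i).2])]
      by_cases h : μ i = μ' i
      · have := pexp_avg (μ := fun j => if j ∈ s then μ' j else μ j) i
          (by simp [hi, (hμ i).2]) f
        simpa [hi, h] using this
      · congr 1
        funext ω
        simp only [hf i h]
        rw [← Finset.sum_mul, (hμ' i).2, one_mul]
  simpa using (step Finset.univ).symm

lemma abs_pexp_sub_le {μ' : I → X → ℝ} (hμ : ∀ i, IsProb (μ i)) (hμ' : ∀ i, IsProb (μ' i))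
    {f : (I → X) → ℝ} (hf : ∀ ω, |f ω| ≤ 1) :
    |pexp μ' f - pexp μ f| ≤ ∑ i, ∑ x, |μ' i x - μ i x| := by
  have step : ∀ s : Finset I, |pexp (fun i => if i ∈ s then μ' i else μ i) f - pexp μ f|
      ≤ ∑ i ∈ s, ∑ x, |μ' i x - μ i x| := by
    intro s
    induction s using Finset.induction_on with
    | empty => simp
    | insert i s hi ih =>
      have e : (fun j => if j ∈ insert i s then μ' j else μ j)
          = Function.update (fun j => if j ∈ s then μ' j else μ j) i (μ' i) := by
        funext j
        by_cases hj : j = i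
        · subst hj; simp
        · simp [hj]
      set ν := fun j => if j ∈ s then μ' j else μ j with hν
      have hνp : ∀ j, IsProb (ν j) := fun j => by
        simp only [hν]; split_ifs
        exacts [hμ' j, hμ j]
      have h2 : pexp ν f = pexp ν (fun ω => ∑ x, μ i x * f (Function.update ω i x)) := by
        rw [← pexp_avg i (hνp i).2]
        simp [hν, hi]
      have h3 : |pexp (Function.update ν i (μ' i)) f - pexp ν f| ≤ ∑ x, |μ' i x - μ i x| := by
        rw [pexp_update _ _ (hνp i).2, h2, ← pexp_sub]
        refine abs_pexp_le_of_abs_le hνp fun ω => ?_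
        rw [← Finset.sum_sub_distrib]
        refine (Finset.abs_sum_le_sum_abs _ _).trans (Finset.sum_le_sum fun x _ => ?_)
        rw [← sub_mul, abs_mul]
        exact mul_le_of_le_one_right (abs_nonneg _) (hf _)
      rw [e, Finset.sum_insert hi]
      have := abs_add_le (pexp (Function.update ν i (μ' i)) f - pexp ν f) (pexp ν f - pexp μ f)
      rw [sub_add_sub_cancel] at this
      linarith
  simpa using step Finset.univ

/-- The law of a subfamily of the coordinates. -/
lemma pexp_comp_injective {J : Type*} [Fintype J] [DecidableEq J] (hμ : ∀ i, IsProb (μ i))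
    {θ : J → I} (hθ : Function.Injective θ) (g : (J → X) → ℝ) :
    pexp μ (fun ω => g (ω ∘ θ)) = pexp (fun j => μ (θ j)) g := by
  classical
  have e1 : ∀ ω : I → X, ∏ i, μ i (ω i) = (∏ j, μ (θ j) (ω (θ j))) *
      ∏ i ∈ (Finset.univ.image θ)ᶜ, μ i (ω i) := by
    intro ω
    rw [← Finset.prod_mul_prod_compl (Finset.univ.image θ),
      Finset.prod_image (fun a _ b _ h => hθ h)]
  simp only [pexp]
  rw [← Finset.sum_fiberwise (s := Finset.univ) (g := fun ω : I → X => ω ∘ θ)]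
  refine Finset.sum_congr rfl fun t _ => ?_
  have e2 : ∀ ω ∈ Finset.univ.filter (fun ω : I → X => ω ∘ θ = t),
      (∏ i, μ i (ω i)) * g (ω ∘ θ)
        = (∏ j, μ (θ j) (t j)) * g t * ∏ i ∈ (Finset.univ.image θ)ᶜ, μ i (ω i) := by
    intro ω hω
    have hω : ω ∘ θ = t := by simpa using hω
    rw [e1, hω]
    have : ∀ j, ω (θ j) = t j := fun j => congrFun hω j
    simp only [this]
    ring
  rw [Finset.sum_congr rfl e2, ← Finset.mul_sum]
  suffices h : ∑ ω with ω ∘ θ = t, ∏ i ∈ (Finset.univ.image θ)ᶜ, μ i (ω i) = 1 by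
    rw [h, mul_one]
  have hpi : Finset.univ.filter (fun ω : I → X => ω ∘ θ = t)
      = Fintype.piFinset (fun i => if h : ∃ j, θ j = i then {t h.choose} else Finset.univ) := by
    ext ω
    simp only [Finset.mem_filter, Finset.mem_univ, true_and, Fintype.mem_piFinset]
    constructor
    · intro h i
      split_ifs with hi
      · rw [Finset.mem_singleton, ← h, Function.comp_apply, hi.choose_spec]
      · exact Finset.mem_univ _
    · intro h
      funext j
      have hj : ∃ j', θ j' = θ j := ⟨j, rfl⟩
      have := h (θ j)
      rw [dif_pos hj, Finset.mem_singleton] at this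
      rw [Function.comp_apply, this, hθ hj.choose_spec]
  have e3 : ∀ ω : I → X, ∏ i ∈ (Finset.univ.image θ)ᶜ, μ i (ω i)
      = ∏ i, if i ∈ Finset.univ.image θ then 1 else μ i (ω i) := by
    intro ω
    rw [Finset.prod_ite]
    simp only [Finset.prod_const_one, one_mul]
    refine Finset.prod_congr ?_ fun _ _ => rfl
    ext i; simp
  simp only [e3]
  rw [hpi, ← Finset.prod_univ_sum (fun i => if h : ∃ j, θ j = i then {t h.choose}
    else Finset.univ) (fun i x => if i ∈ Finset.univ.image θ then 1 else μ i x)]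
  refine Finset.prod_eq_one fun i _ => ?_
  by_cases hi : ∃ j, θ j = i
  · have : i ∈ Finset.univ.image θ := by simpa using hi
    rw [dif_pos hi]
    simp [this]
  · have : i ∉ Finset.univ.image θ := by simpa using hi
    rw [dif_neg hi]
    simp [this, (hμ i).2]

/-- The law of the images of the coordinates. -/
lemma pexp_map {Y : Type*} [Fintype Y] [DecidableEq Y] (N : I → X → Y)
    (g : (I → Y) → ℝ) :
    pexp μ (fun ω => g (fun i => N i (ω i)))
      = pexp (fun i y => ∑ x with N i x = y, μ i x) g := by
  classical
  simp only [pexp]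
  rw [← Finset.sum_fiberwise (s := Finset.univ) (g := fun (ω : I → X) i => N i (ω i))]
  refine Finset.sum_congr rfl fun t _ => ?_
  have hpi : Finset.univ.filter (fun ω : I → X => (fun i => N i (ω i)) = t)
      = Fintype.piFinset (fun i => Finset.univ.filter fun x => N i x = t i) := by
    ext ω
    simp [funext_iff]
  rw [Finset.prod_univ_sum, Finset.sum_mul, ← hpi]
  refine Finset.sum_congr rfl fun ω hω => ?_
  rw [(by simpa using hω : (fun i => N i (ω i)) = t)]

/-- Replacing the factors of a product one at a time. -/
lemma abs_pexp_prod_sub_le {E : Type*} [DecidableEq E] (s : Finset E)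
    (g g' : E → (I → X) → ℝ) {c : ℝ}
    (h : ∀ e ∈ s, ∀ t ⊆ s.erase e,
      |pexp μ (fun ω => (g e ω - g' e ω) *
        ∏ e' ∈ s.erase e, if e' ∈ t then g e' ω else g' e' ω)| ≤ c) :
    |pexp μ (fun ω => ∏ e ∈ s, g e ω) - pexp μ (fun ω => ∏ e ∈ s, g' e ω)| ≤ s.card * c := by
  have step : ∀ t ⊆ s, |pexp μ (fun ω => ∏ e ∈ s, if e ∈ t then g e ω else g' e ω)
      - pexp μ (fun ω => ∏ e ∈ s, g' e ω)| ≤ t.card * c := by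
    intro t
    induction t using Finset.induction_on with
    | empty => intro _; simp
    | insert e t he ih =>
      intro hts
      have hes : e ∈ s := hts (Finset.mem_insert_self _ _)
      have hts' : t ⊆ s := (Finset.subset_insert _ _).trans hts
      have e1 : pexp μ (fun ω => ∏ e' ∈ s, if e' ∈ insert e t then g e' ω else g' e' ω)
          - pexp μ (fun ω => ∏ e' ∈ s, if e' ∈ t then g e' ω else g' e' ω)
          = pexp μ (fun ω => (g e ω - g' e ω) *
            ∏ e' ∈ s.erase e, if e' ∈ t then g e' ω else g' e' ω) := by
        rw [← pexp_sub]
        congr 1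
        funext ω
        rw [← Finset.mul_prod_erase _ (fun e' =>
            if e' ∈ insert e t then g e' ω else g' e' ω) hes,
          ← Finset.mul_prod_erase _ (fun e' => if e' ∈ t then g e' ω else g' e' ω) hes]
        have : ∏ e' ∈ s.erase e, (if e' ∈ insert e t then g e' ω else g' e' ω)
            = ∏ e' ∈ s.erase e, if e' ∈ t then g e' ω else g' e' ω := by
          refine Finset.prod_congr rfl fun e' he' => ?_
          simp [Finset.ne_of_mem_erase he']
        rw [this]
        simp [he, sub_mul]
      have h1 := h e hes t (fun x hx => Finset.mem_erase.2
        ⟨fun hxe => he (hxe ▸ hx), hts' hx⟩)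
      rw [← e1] at h1
      have h2 := ih hts'
      have := abs_add_le
        (pexp μ (fun ω => ∏ e' ∈ s, if e' ∈ insert e t then g e' ω else g' e' ω)
          - pexp μ (fun ω => ∏ e' ∈ s, if e' ∈ t then g e' ω else g' e' ω))
        (pexp μ (fun ω => ∏ e' ∈ s, if e' ∈ t then g e' ω else g' e' ω)
          - pexp μ (fun ω => ∏ e ∈ s, g' e ω))
      rw [sub_add_sub_cancel] at this
      rw [Finset.card_insert_of_notMem he]
      push_cast
      linarith
  have h0 := step s subset_rfl
  have e : ∀ ω, ∏ e ∈ s, (if e ∈ s then g e ω else g' e ω) = ∏ e ∈ s, g e ω := fun ω =>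
    Finset.prod_congr rfl fun e he => by simp [he]
  simpa only [e] using h0

end ProductExpectation

/-- Finite Ramsey theorem for `t`-element subsets and `c` colours. -/
theorem exists_homogeneous_fin (c : ℕ) (t : ℕ) : ∀ R : ℕ, ∃ M : ℕ, ∀ I : Finset ℕ, M ≤ I.card →
    ∀ χ : Finset ℕ → Fin c, ∃ J ⊆ I, J.card = R ∧ ∃ a, ∀ T ⊆ J, T.card = t → χ T = a := by
  induction t with
  | zero =>
    intro R
    refine ⟨R, fun I hI χ => ?_⟩
    obtain ⟨J, hJ, hc⟩ := Finset.exists_subset_card_eq hI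
    exact ⟨J, hJ, hc, χ ∅, fun T _ hT => by rw [Finset.card_eq_zero.1 hT]⟩
  | succ t ih =>
    have endhom : ∀ m : ℕ, ∃ M : ℕ, ∀ I : Finset ℕ, M ≤ I.card → ∀ χ : Finset ℕ → Fin c,
        ∃ J ⊆ I, J.card = m ∧ ∃ g : ℕ → Fin c, ∀ x ∈ J, ∀ T ⊆ J, (∀ y ∈ T, x < y) →
          T.card = t → χ (insert x T) = g x := by
      intro m
      induction m with
      | zero =>
        refine ⟨0, fun I _ χ => ⟨∅, Finset.empty_subset _, rfl, fun _ => χ ∅, ?_⟩⟩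
        simp
      | succ m ihm =>
        obtain ⟨M₁, hM₁⟩ := ihm
        obtain ⟨M₂, hM₂⟩ := ih M₁
        refine ⟨M₂ + 1, fun I hI χ => ?_⟩
        have hne : I.Nonempty := Finset.card_pos.1 (by omega)
        set x := I.min' hne with hx
        have hxI : x ∈ I := I.min'_mem hne
        obtain ⟨J₁, hJ₁, hc₁, a, ha⟩ := hM₂ (I.erase x)
          (by rw [Finset.card_erase_of_mem hxI]; omega) (fun T => χ (insert x T))
        obtain ⟨J₂, hJ₂, hc₂, g, hg⟩ := hM₁ J₁ hc₁.ge χ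
        have hlt : ∀ y ∈ J₂, x < y := fun y hy => by
          have := hJ₁ (hJ₂ hy)
          rw [Finset.mem_erase] at this
          exact lt_of_le_of_ne (I.min'_le y this.2) (Ne.symm this.1)
        have hxJ : x ∉ J₂ := fun h => lt_irrefl _ (hlt x h)
        refine ⟨insert x J₂, ?_, ?_, Function.update g x a, ?_⟩
        · refine Finset.insert_subset hxI fun y hy => ?_
          exact Finset.mem_of_mem_erase (hJ₁ (hJ₂ hy))
        · rw [Finset.card_insert_of_notMem hxJ, hc₂]
        · intro z hz T hT hzT hcT
          rcases Finset.mem_insert.1 hz with rfl | hz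
          · rw [Function.update_self]
            refine ha T (fun y hy => hJ₂ ?_) hcT
            exact (Finset.mem_insert.1 (hT hy)).resolve_left (hzT y hy).ne'
          · rw [Function.update_of_ne (by rintro rfl; exact hxJ hz)]
            refine hg z hz T (fun y hy => ?_) hzT hcT
            refine (Finset.mem_insert.1 (hT hy)).resolve_left fun h => ?_
            have := hzT y hy
            have := hlt z hz
            omega
    intro R
    obtain ⟨M, hM⟩ := endhom (c * R + 1)
    refine ⟨M, fun I hI χ => ?_⟩
    obtain ⟨J, hJ, hc, g, hg⟩ := hM I hI χ
    obtain ⟨a, -, ha⟩ := Finset.exists_lt_card_fiber_of_mul_lt_card_of_maps_to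
      (s := J) (t := (Finset.univ : Finset (Fin c))) (f := g) (n := R) (by simp) (by simp [hc])
    obtain ⟨J', hJ', hc'⟩ := Finset.exists_subset_card_eq ha.le
    refine ⟨J', (hJ'.trans (Finset.filter_subset _ _)).trans hJ, hc', a, fun T hT hcT => ?_⟩
    have hne : T.Nonempty := Finset.card_pos.1 (by omega)
    have hx := T.min'_mem hne
    have hx' := hJ' (hT hx)
    rw [Finset.mem_filter] at hx'
    have := hg _ hx'.1 (T.erase (T.min' hne))
      (fun y hy => (Finset.mem_filter.1 (hJ' (hT (Finset.mem_of_mem_erase hy)))).1)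
      (fun y hy => lt_of_le_of_ne (T.min'_le y (Finset.mem_of_mem_erase hy))
        (Finset.ne_of_mem_erase hy).symm)
      (by rw [Finset.card_erase_of_mem hx, hcT]; rfl)
    rw [Finset.insert_erase hx] at this
    rw [this, hx'.2]

theorem exists_homogeneous (κ : Type*) [Finite κ] (t R : ℕ) : ∃ M : ℕ, ∀ I : Finset ℕ,
    M ≤ I.card → ∀ χ : Finset ℕ → κ,
      ∃ J ⊆ I, J.card = R ∧ ∃ a, ∀ T ⊆ J, T.card = t → χ T = a := by
  obtain ⟨c, ⟨e⟩⟩ := Finite.exists_equiv_fin κ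
  obtain ⟨M, hM⟩ := exists_homogeneous_fin c t R
  refine ⟨M, fun I hI χ => ?_⟩
  obtain ⟨J, hJ, hc, a, ha⟩ := hM I hI (fun T => e (χ T))
  exact ⟨J, hJ, hc, e.symm a, fun T hT hcT => by rw [← ha T hT hcT, e.symm_apply_apply]⟩

section Averaging

variable {I X κ : Type*} [DecidableEq I]

/-- `r` depends on coordinate `i` only through `N' ω`. -/
def MeasAt {ι : Type*} (i : I) (N' : (I → X) → X → ι) (r : (I → X) → ℝ) : Prop :=
  ∀ ω x y, N' ω x = N' ω y → r (Function.update ω i x) = r (Function.update ω i y)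

lemma MeasAt.prod {ι E : Type*} {i : I} {N' : (I → X) → X → ι} (s : Finset E)
    {r : E → (I → X) → ℝ} (h : ∀ e ∈ s, MeasAt i N' (r e)) :
    MeasAt i N' (fun ω => ∏ e ∈ s, r e ω) :=
  fun ω x y hxy => Finset.prod_congr rfl fun e he => h e he ω x y hxy

variable [Fintype X] [DecidableEq κ]

/-- Average out coordinate `i` over the fibre of the name map `n i`. -/
noncomputable def favg (μ : I → X → ℝ) (n : I → X → κ) (i : I) (f : (I → X) → ℝ) (ω : I → X) : ℝ :=
  cexp (μ i) (n i) (fun x => f (Function.update ω i x)) (ω i)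

variable {μ : I → X → ℝ} {n : I → X → κ}

lemma favg_sub (i : I) (f g : (I → X) → ℝ) (ω : I → X) :
    favg μ n i (fun ω => f ω - g ω) ω = favg μ n i f ω - favg μ n i g ω :=
  cexp_sub _ _ _

lemma favg_nonneg (hμ : ∀ i, IsProb (μ i)) (i : I) {f : (I → X) → ℝ} (hf : ∀ ω, 0 ≤ f ω)
    (ω : I → X) : 0 ≤ favg μ n i f ω :=
  cexp_nonneg (hμ i).1 (fun _ => hf _) _

lemma favg_le_one (hμ : ∀ i, IsProb (μ i)) (i : I) {f : (I → X) → ℝ} (hf : ∀ ω, f ω ≤ 1)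
    (ω : I → X) : favg μ n i f ω ≤ 1 :=
  cexp_le_one (hμ i).1 (fun _ => hf _) _

lemma pexp_favg_mul [Fintype I] (hμ : ∀ i, IsProb (μ i)) (i : I) (f g : (I → X) → ℝ) :
    pexp μ (fun ω => favg μ n i f ω * g ω) = pexp μ (fun ω => f ω * favg μ n i g ω) := by
  rw [← pexp_avg i (hμ i).2, ← pexp_avg i (hμ i).2 (fun ω => f ω * favg μ n i g ω)]
  congr 1
  funext ω
  simp only [favg, Function.update_idem, Function.update_self]
  have h1 := sum_cexp_mul (g := fun x => f (Function.update ω i x)) (N := n i) (hμ i).1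
    (cexp_factorsThrough (μ := μ i) (g := fun x => g (Function.update ω i x)))
  have h2 := sum_cexp_mul (g := fun x => g (Function.update ω i x)) (N := n i) (hμ i).1
    (cexp_factorsThrough (μ := μ i) (g := fun x => f (Function.update ω i x)))
  rw [← h1]
  simp only [mul_comm (cexp (μ i) (n i) (fun x => f (Function.update ω i x)) _)]
  rw [h2]

lemma MeasAt.favg {ι : Type*} {i j : I} (hij : j ≠ i) {N' : (I → X) → X → ι}
    {r : (I → X) → ℝ} (h : MeasAt i N' r) (hN : ∀ ω z, N' (Function.update ω j z) = N' ω) :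
    MeasAt i N' (favg μ n j r) := by
  intro ω x y hxy
  simp only [_root_.favg, Function.update_of_ne hij]
  congr 1
  funext z
  rw [Function.update_comm hij.symm, Function.update_comm hij.symm]
  exact h _ _ _ (by rw [hN]; exact hxy)

lemma measAt_favg_self {ι : Type*} {i : I} {N' : (I → X) → X → ι}
    (r : (I → X) → ℝ) (h : ∀ ω, (n i).FactorsThrough (N' ω)) :
    MeasAt i N' (favg μ n i r) := by
  intro ω x y hxy
  simp only [_root_.favg, Function.update_idem, Function.update_self, cexp, h ω hxy]

lemma abs_pexp_sub_favg_mul_le [Fintype I] {ι : Type*} [DecidableEq ι] (hμ : ∀ i, IsProb (μ i)) (i : I)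
    {N' : (I → X) → X → ι} {f r : (I → X) → ℝ} {γ : ℝ}
    (hnN : ∀ ω, (n i).FactorsThrough (N' ω)) (hr : MeasAt i N' r) (hr1 : ∀ ω, |r ω| ≤ 1)
    (hγ : pexp μ (fun ω => energy (μ i) (N' ω) (fun x => f (Function.update ω i x))
      - energy (μ i) (n i) (fun x => f (Function.update ω i x))) ≤ γ) :
    |pexp μ (fun ω => (f ω - favg μ n i f ω) * r ω)| ≤ √γ := by
  refine Real.abs_le_sqrt (le_trans ?_ hγ)
  rw [← pexp_avg i (hμ i).2]
  refine (sq_pexp_le hμ _).trans (pexp_mono hμ fun ω => ?_)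
  simp only [favg, Function.update_idem, Function.update_self]
  exact sq_sum_sub_cexp_mul_le (hμ i).1 (hμ i).2 (hnN ω) (fun x y h => hr ω x y h)
    (fun x => hr1 _)

/-- Three successive averagings of `f`, tested against `r`. -/
lemma abs_pexp_sub_favg_three_le [Fintype I] {ι : Type*} [DecidableEq ι] (hμ : ∀ i, IsProb (μ i))
    {i₁ i₂ i₃ : I} (h₁₂ : i₁ ≠ i₂) (h₁₃ : i₁ ≠ i₃) (h₂₃ : i₂ ≠ i₃)
    {N₁ N₂ N₃ : (I → X) → X → ι} {f r : (I → X) → ℝ} {γ : ℝ}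
    (hn₁ : ∀ ω, (n i₁).FactorsThrough (N₁ ω)) (hn₂ : ∀ ω, (n i₂).FactorsThrough (N₂ ω))
    (hn₃ : ∀ ω, (n i₃).FactorsThrough (N₃ ω))
    (hr₁ : MeasAt i₁ N₁ r) (hr₂ : MeasAt i₂ N₂ r) (hr₃ : MeasAt i₃ N₃ r)
    (hN₂ : ∀ ω z, N₂ (Function.update ω i₁ z) = N₂ ω)
    (hN₃ : ∀ ω z, N₃ (Function.update ω i₁ z) = N₃ ω)
    (hN₃' : ∀ ω z, N₃ (Function.update ω i₂ z) = N₃ ω)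
    (hr0 : ∀ ω, 0 ≤ r ω) (hr1 : ∀ ω, r ω ≤ 1)
    (hγ₁ : pexp μ (fun ω => energy (μ i₁) (N₁ ω) (fun x => f (Function.update ω i₁ x))
      - energy (μ i₁) (n i₁) (fun x => f (Function.update ω i₁ x))) ≤ γ)
    (hγ₂ : pexp μ (fun ω => energy (μ i₂) (N₂ ω) (fun x => f (Function.update ω i₂ x))
      - energy (μ i₂) (n i₂) (fun x => f (Function.update ω i₂ x))) ≤ γ)
    (hγ₃ : pexp μ (fun ω => energy (μ i₃) (N₃ ω) (fun x => f (Function.update ω i₃ x))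
      - energy (μ i₃) (n i₃) (fun x => f (Function.update ω i₃ x))) ≤ γ) :
    |pexp μ (fun ω => (f ω - favg μ n i₁ (favg μ n i₂ (favg μ n i₃ f)) ω) * r ω)| ≤ 3 * √γ := by
  have e : pexp μ (fun ω => (f ω - favg μ n i₁ (favg μ n i₂ (favg μ n i₃ f)) ω) * r ω)
      = pexp μ (fun ω => (f ω - favg μ n i₁ f ω) * r ω)
        + pexp μ (fun ω => (f ω - favg μ n i₂ f ω) * favg μ n i₁ r ω)
        + pexp μ (fun ω => (f ω - favg μ n i₃ f ω) * favg μ n i₂ (favg μ n i₁ r) ω) := by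
    rw [← pexp_favg_mul hμ i₁, ← pexp_favg_mul hμ i₂, ← pexp_favg_mul hμ i₁, ← pexp_add,
      ← pexp_add]
    congr 1
    funext ω
    have h2 : favg μ n i₂ (fun ω => f ω - favg μ n i₃ f ω)
        = fun ω => favg μ n i₂ f ω - favg μ n i₂ (favg μ n i₃ f) ω := by
      funext ω; exact favg_sub _ _ _ _
    rw [h2, favg_sub, favg_sub]
    ring
  have b : ∀ {s : (I → X) → ℝ}, (∀ ω, 0 ≤ s ω) → (∀ ω, s ω ≤ 1) → ∀ ω, |s ω| ≤ 1 :=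
    fun h0 h1 ω => abs_le.2 ⟨by linarith [h0 ω], h1 ω⟩
  have r0 := favg_nonneg (n := n) hμ i₁ hr0
  have r1 := favg_le_one (n := n) hμ i₁ hr1
  have g1 := abs_pexp_sub_favg_mul_le hμ i₁ hn₁ hr₁ (b hr0 hr1) hγ₁
  have g2 := abs_pexp_sub_favg_mul_le hμ i₂ hn₂ (hr₂.favg (μ := μ) (n := n) h₁₂ hN₂) (b r0 r1) hγ₂
  have g3 := abs_pexp_sub_favg_mul_le hμ i₃ hn₃
    ((hr₃.favg (μ := μ) (n := n) h₁₃ hN₃).favg (μ := μ) (n := n) h₂₃ hN₃')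
    (b (favg_nonneg (n := n) hμ i₂ r0) (favg_le_one (n := n) hμ i₂ r1)) hγ₃
  rw [e]
  refine (abs_add_three _ _ _).trans ?_
  linarith

end Averaging

/-- The real indicator of a Boolean. -/
def bi (b : Bool) : ℝ := cond b 1 0

lemma bi_nonneg (b : Bool) : 0 ≤ bi b := by cases b <;> simp [bi]

lemma bi_le_one (b : Bool) : bi b ≤ 1 := by cases b <;> simp [bi]

section Counting

variable {C κ L : Type*} [LinearOrder L]

/-- The predicate `A` for the triangle `a < b`, `w`, as a function of the colours of the pairs
`ab`, `aw` and `bw`. -/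
def tri (A : C → C → C → Bool) (a b w : L) (α β γ : C) : Bool :=
  if b < w then A α β γ else if a < w then A β α γ else A β γ α

lemma tri_strictMono {L' : Type*} [LinearOrder L'] {F : L → L'} (hF : StrictMono F)
    (A : C → C → C → Bool) (a b w : L) : tri A (F a) (F b) (F w) = tri A a b w := by
  funext α β γ
  simp [tri, hF.lt_iff_lt]

variable {k : ℕ}

/-- The colouring of the pairs makes the triple `e` admissible. -/
def edgeOk (A : C → C → C → Bool) (e : Fin k × Fin k × Fin k) (ω : Sym2 (Fin k) → C) : Bool :=
  A (ω s(e.1, e.2.1)) (ω s(e.1, e.2.2)) (ω s(e.2.1, e.2.2))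

/-- The refinement of the names on the pair `ab` by all triangles on `ab` other than `abc`. -/
def refName (A : C → C → C → Bool) (n : C → κ) (a b c : Fin k) (ω : Sym2 (Fin k) → C) (x : C) :
    κ × (Fin k → Bool) :=
  (n x, fun w => decide (w ≠ a ∧ w ≠ b ∧ w ≠ c) && tri A a b w x (ω s(a, w)) (ω s(b, w)))

/-- The expected energy increment of the triangle `abc` under the refinement `refName`. -/
noncomputable def gap [Fintype C] [DecidableEq κ] (A : C → C → C → Bool) (μ : Sym2 (Fin k) → C → ℝ)
    (n : Sym2 (Fin k) → C → κ) (a b c : Fin k) : ℝ :=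
  pexp μ (fun ω => energy (μ s(a, b)) (refName A (n s(a, b)) a b c ω)
      (fun x => bi (tri A a b c x (ω s(a, c)) (ω s(b, c))))
    - energy (μ s(a, b)) (n s(a, b)) (fun x => bi (tri A a b c x (ω s(a, c)) (ω s(b, c)))))

variable {A : C → C → C → Bool} {μ : Sym2 (Fin k) → C → ℝ} {n : Sym2 (Fin k) → C → κ}

/-- The name-average of the indicator of a triple. -/
noncomputable def edgeAvg [Fintype C] [DecidableEq κ] (A : C → C → C → Bool) (μ : Sym2 (Fin k) → C → ℝ)
    (n : Sym2 (Fin k) → C → κ) (e : Fin k × Fin k × Fin k) : (Sym2 (Fin k) → C) → ℝ :=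
  favg μ n s(e.1, e.2.1) (favg μ n s(e.1, e.2.2) (favg μ n s(e.2.1, e.2.2)
    (fun ω => bi (edgeOk A e ω))))

lemma edgeAvg_nonneg [Fintype C] [DecidableEq κ] (hμ : ∀ p, IsProb (μ p)) (e : Fin k × Fin k × Fin k)
    (ω : Sym2 (Fin k) → C) : 0 ≤ edgeAvg A μ n e ω :=
  favg_nonneg hμ _ (favg_nonneg hμ _ (favg_nonneg hμ _ fun _ => bi_nonneg _)) _

lemma edgeAvg_le_one [Fintype C] [DecidableEq κ] (hμ : ∀ p, IsProb (μ p)) (e : Fin k × Fin k × Fin k)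
    (ω : Sym2 (Fin k) → C) : edgeAvg A μ n e ω ≤ 1 :=
  favg_le_one hμ _ (favg_le_one hμ _ (favg_le_one hμ _ fun _ => bi_le_one _)) _

lemma refName_update {m : C → κ} {a b c : Fin k} {p : Sym2 (Fin k)}
    (hab : p = s(a, c) ∨ p = s(b, c)) (ω : Sym2 (Fin k) → C) (z : C) :
    refName A m a b c (Function.update ω p z) = refName A m a b c ω := by
  funext x
  simp only [refName, Prod.mk.injEq, true_and]
  funext w
  by_cases h : w ≠ a ∧ w ≠ b ∧ w ≠ c
  · have h1 : s(a, w) ≠ p := by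
      rcases hab with rfl | rfl <;> simp only [ne_eq, Sym2.eq_iff] <;> tauto
    have h2 : s(b, w) ≠ p := by
      rcases hab with rfl | rfl <;> simp only [ne_eq, Sym2.eq_iff] <;> tauto
    rw [Function.update_of_ne h1, Function.update_of_ne h2]
  · simp [h]

/-- The indicator of the triple `e` in terms of one of its pairs `ab` and its third vertex `c`. -/
lemma edgeOk_eq_tri {e : Fin k × Fin k × Fin k} (h1 : e.1 < e.2.1) (h2 : e.2.1 < e.2.2)
    {a b c : Fin k} (habc : (a, b, c) = e ∨ (a, c, b) = e ∨ (c, a, b) = e)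
    (ω : Sym2 (Fin k) → C) :
    edgeOk A e ω = tri A a b c (ω s(a, b)) (ω s(a, c)) (ω s(b, c)) := by
  rcases habc with rfl | rfl | rfl <;> simp only at h1 h2
  · simp [edgeOk, tri, h2]
  · simp [edgeOk, tri, h1, h2.not_gt, Sym2.eq_swap (a := c) (b := b)]
  · simp [edgeOk, tri, (h1.trans h2).not_gt, h1.not_gt, Sym2.eq_swap (a := c)]

lemma measAt_edgeOk {e : Fin k × Fin k × Fin k} (h1 : e.1 < e.2.1) (h2 : e.2.1 < e.2.2)
    {a b c : Fin k} (hab : a < b) (hc : c ≠ a ∧ c ≠ b)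
    (he : ¬ ((a, b, c) = e ∨ (a, c, b) = e ∨ (c, a, b) = e)) (m : C → κ) :
    MeasAt s(a, b) (refName A m a b c) (fun ω => bi (edgeOk A e ω)) := by
  intro ω x y hxy
  by_cases hw : ∃ w, (a, b, w) = e ∨ (a, w, b) = e ∨ (w, a, b) = e
  · obtain ⟨w, hw⟩ := hw
    have hwa : w ≠ a ∧ w ≠ b := by
      rcases hw with rfl | rfl | rfl <;> simp only at h1 h2 <;> constructor <;>
        (intro h; subst h; order)
    have hwc : w ≠ c := by rintro rfl; exact he hw
    have n1 : s(a, w) ≠ s(a, b) := by simp only [ne_eq, Sym2.eq_iff]; tauto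
    have n2 : s(b, w) ≠ s(a, b) := by simp only [ne_eq, Sym2.eq_iff]; tauto
    have := congrFun (congrArg Prod.snd hxy) w
    simp only [refName, hwa.1, hwa.2, hwc, ne_eq, not_false_eq_true, and_self, decide_true,
      Bool.true_and] at this
    simp only [edgeOk_eq_tri h1 h2 hw, Function.update_self, Function.update_of_ne n1,
      Function.update_of_ne n2, this]
  · push Not at hw
    obtain ⟨u, v, w⟩ := e
    simp only at h1 h2
    have n1 : s(u, v) ≠ s(a, b) := by
      intro h
      rcases Sym2.eq_iff.1 h with ⟨rfl, rfl⟩ | ⟨rfl, rfl⟩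
      · exact (hw w).1 rfl
      · order
    have n2 : s(u, w) ≠ s(a, b) := by
      intro h
      rcases Sym2.eq_iff.1 h with ⟨rfl, rfl⟩ | ⟨rfl, rfl⟩
      · exact (hw v).2.1 rfl
      · order
    have n3 : s(v, w) ≠ s(a, b) := by
      intro h
      rcases Sym2.eq_iff.1 h with ⟨rfl, rfl⟩ | ⟨rfl, rfl⟩
      · exact (hw u).2.2 rfl
      · order
    simp only [edgeOk, Function.update_of_ne n1, Function.update_of_ne n2,
      Function.update_of_ne n3]

lemma measAt_of_forall {ι : Type*} {i : Sym2 (Fin k)} {N' : (Sym2 (Fin k) → C) → C → ι}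
    {r : (Sym2 (Fin k) → C) → ℝ}
    (h : ∀ ω x y, r (Function.update ω i x) = r (Function.update ω i y)) :
    MeasAt i N' r := fun ω x y _ => h ω x y

lemma favg_of_ne [Fintype C] [DecidableEq κ] {i j : Sym2 (Fin k)} (hij : j ≠ i) {r : (Sym2 (Fin k) → C) → ℝ}
    (h : MeasAt i (fun _ => n i) r) : MeasAt i (fun _ => n i) (favg μ n j r) :=
  h.favg hij fun _ _ => rfl

lemma measAt_favg [Fintype C] [DecidableEq κ] (i j : Sym2 (Fin k)) {r : (Sym2 (Fin k) → C) → ℝ}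
    (h : i = j ∨ MeasAt i (fun _ => n i) r) : MeasAt i (fun _ => n i) (favg μ n j r) := by
  by_cases hij : i = j
  · subst hij
    exact measAt_favg_self _ fun _ _ _ h => h
  · exact favg_of_ne (Ne.symm hij) (h.resolve_left hij)

lemma measAt_edgeAvg [Fintype C] [DecidableEq κ] (i : Sym2 (Fin k)) (e : Fin k × Fin k × Fin k) :
    MeasAt i (fun _ => n i) (edgeAvg A μ n e) := by
  by_cases h1 : i = s(e.1, e.2.1)
  · exact measAt_favg _ _ (Or.inl h1)
  by_cases h2 : i = s(e.1, e.2.2)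
  · exact measAt_favg _ _ (Or.inr (measAt_favg _ _ (Or.inl h2)))
  by_cases h3 : i = s(e.2.1, e.2.2)
  · exact measAt_favg _ _ (Or.inr (measAt_favg _ _ (Or.inr (measAt_favg _ _ (Or.inl h3)))))
  refine measAt_favg _ _ (Or.inr (measAt_favg _ _ (Or.inr (measAt_favg _ _ (Or.inr ?_)))))
  refine measAt_of_forall fun ω x y => ?_
  simp only [edgeOk, Function.update_of_ne (Ne.symm h1), Function.update_of_ne (Ne.symm h2),
    Function.update_of_ne (Ne.symm h3)]

lemma gap_eq [Fintype C] [DecidableEq κ] {e : Fin k × Fin k × Fin k} (h1 : e.1 < e.2.1) (h2 : e.2.1 < e.2.2)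
    {a b c : Fin k} (hc : c ≠ a ∧ c ≠ b)
    (habc : (a, b, c) = e ∨ (a, c, b) = e ∨ (c, a, b) = e) :
    gap A μ n a b c = pexp μ (fun ω => energy (μ s(a, b)) (refName A (n s(a, b)) a b c ω)
      (fun x => bi (edgeOk A e (Function.update ω s(a, b) x)))
    - energy (μ s(a, b)) (n s(a, b)) (fun x => bi (edgeOk A e (Function.update ω s(a, b) x)))) := by
  have n1 : s(a, c) ≠ s(a, b) := by simp only [ne_eq, Sym2.eq_iff]; tauto
  have n2 : s(b, c) ≠ s(a, b) := by simp only [ne_eq, Sym2.eq_iff]; tauto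
  simp only [edgeOk_eq_tri h1 h2 habc, Function.update_self, Function.update_of_ne n1,
      Function.update_of_ne n2, gap]

/-- If all gaps are small, the triangle indicators may be replaced by their name-averages. -/
theorem abs_pexp_prod_edgeOk_sub_le [Fintype C] [DecidableEq κ] (hμ : ∀ p, IsProb (μ p))
    (s : Finset (Fin k × Fin k × Fin k)) (hs : ∀ e ∈ s, e.1 < e.2.1 ∧ e.2.1 < e.2.2) {γ : ℝ}
    (hγ : ∀ a b c : Fin k, a < b → c ≠ a → c ≠ b → gap A μ n a b c ≤ γ) :
    |pexp μ (fun ω => ∏ e ∈ s, bi (edgeOk A e ω)) - pexp μ (fun ω => ∏ e ∈ s, edgeAvg A μ n e ω)|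
      ≤ s.card * (3 * √γ) := by
  refine abs_pexp_prod_sub_le s _ _ fun e he t ht => ?_
  obtain ⟨h1, h2⟩ := hs e he
  have meas : ∀ {a b c : Fin k}, a < b → (c ≠ a ∧ c ≠ b) →
      ((a, b, c) = e ∨ (a, c, b) = e ∨ (c, a, b) = e) →
      MeasAt s(a, b) (refName A (n s(a, b)) a b c) (fun ω => ∏ e' ∈ s.erase e,
        if e' ∈ t then bi (edgeOk A e' ω) else edgeAvg A μ n e' ω) := by
    intro a b c hab hc habc
    refine MeasAt.prod _ fun e' he' => ?_
    obtain ⟨hne, he'⟩ := Finset.mem_erase.1 he'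
    obtain ⟨h1', h2'⟩ := hs e' he'
    split_ifs
    · refine measAt_edgeOk h1' h2' hab hc ?_ _
      rintro h
      apply hne
      rcases h with rfl | rfl | rfl <;> simp only at h1' h2' <;>
        rcases habc with rfl | rfl | rfl <;> simp only at h1 h2 <;>
        first | rfl | (exfalso; order)
    · intro ω x y hxy
      exact measAt_edgeAvg _ _ ω x y (congrArg Prod.fst hxy)
  obtain ⟨u, v, w⟩ := e
  simp only at h1 h2
  have huw := h1.trans h2
  have d1 : s(u, v) ≠ s(u, w) := by simp only [ne_eq, Sym2.eq_iff]; grind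
  have d2 : s(u, v) ≠ s(v, w) := by simp only [ne_eq, Sym2.eq_iff]; grind
  have d3 : s(u, w) ≠ s(v, w) := by simp only [ne_eq, Sym2.eq_iff]; grind
  refine abs_pexp_sub_favg_three_le (f := fun ω => bi (edgeOk A (u, v, w) ω)) (n := n) hμ d1 d2 d3
    (fun ω x y h => congrArg Prod.fst h) (fun ω x y h => congrArg Prod.fst h)
    (fun ω x y h => congrArg Prod.fst h)
    (meas h1 ⟨huw.ne', h2.ne'⟩ (Or.inl rfl))
    (meas huw ⟨h1.ne', h2.ne⟩ (Or.inr (Or.inl rfl)))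
    (meas h2 ⟨h1.ne, huw.ne⟩ (Or.inr (Or.inr rfl)))
    (refName_update (Or.inl rfl))
    (fun ω z => refName_update (Or.inl Sym2.eq_swap) ω z)
    (fun ω z => refName_update (Or.inr Sym2.eq_swap) ω z) ?_ ?_ ?_ ?_ ?_
  · intro ω
    refine Finset.prod_nonneg fun e' _ => ?_
    split_ifs
    exacts [bi_nonneg _, edgeAvg_nonneg hμ _ _]
  · intro ω
    refine Finset.prod_le_one (fun e' _ => ?_) fun e' _ => ?_
    · split_ifs
      exacts [bi_nonneg _, edgeAvg_nonneg hμ _ _]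
    · split_ifs
      exacts [bi_le_one _, edgeAvg_le_one hμ _ _]
  · rw [← gap_eq (e := (u, v, w)) h1 h2 ⟨huw.ne', h2.ne'⟩ (Or.inl rfl)]
    exact hγ _ _ _ h1 huw.ne' h2.ne'
  · rw [← gap_eq (e := (u, v, w)) h1 h2 ⟨h1.ne', h2.ne⟩ (Or.inr (Or.inl rfl))]
    exact hγ _ _ _ huw h1.ne' h2.ne
  · rw [← gap_eq (e := (u, v, w)) h1 h2 ⟨h1.ne, huw.ne⟩ (Or.inr (Or.inr rfl))]
    exact hγ _ _ _ h2 h1.ne huw.ne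

end Counting

section Energy

variable {C κ κ' : Type*} [Fintype C] [DecidableEq κ] [DecidableEq κ']

/-- The average energy of the slices of `r` in the first variable, given the names `n`. -/
noncomputable def triEnergy (m₁ m₂ m₃ : C → ℝ) (r : C → C → C → Bool) (n : C → κ) : ℝ :=
  ∑ z, m₃ z * ∑ y, m₂ y * energy m₁ n (fun x => bi (r x y z))

variable {m₁ m₂ m₃ : C → ℝ} {r : C → C → C → Bool} {n : C → κ} {n' : C → κ'}

lemma triEnergy_mono (h₁ : IsProb m₁) (h₂ : IsProb m₂) (h₃ : IsProb m₃)
    (hn : n.FactorsThrough n') : triEnergy m₁ m₂ m₃ r n ≤ triEnergy m₁ m₂ m₃ r n' :=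
  Finset.sum_le_sum fun z _ => mul_le_mul_of_nonneg_left (Finset.sum_le_sum fun y _ =>
    mul_le_mul_of_nonneg_left (energy_mono h₁.1 hn) (h₂.1 y)) (h₃.1 z)

lemma triEnergy_nonneg (h₁ : IsProb m₁) (h₂ : IsProb m₂) (h₃ : IsProb m₃) :
    0 ≤ triEnergy m₁ m₂ m₃ r n :=
  Finset.sum_nonneg fun z _ => mul_nonneg (h₃.1 z) (Finset.sum_nonneg fun y _ =>
    mul_nonneg (h₂.1 y) (energy_nonneg h₁.1))

lemma triEnergy_le_one (h₁ : IsProb m₁) (h₂ : IsProb m₂) (h₃ : IsProb m₃) :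
    triEnergy m₁ m₂ m₃ r n ≤ 1 := by
  have h : ∀ z, ∑ y, m₂ y * energy m₁ n (fun x => bi (r x y z)) ≤ 1 := fun z => by
    rw [← h₂.2]
    exact Finset.sum_le_sum fun y _ => mul_le_of_le_one_right (h₂.1 y)
      (energy_le_one h₁.1 h₁.2 (fun _ => bi_nonneg _) fun _ => bi_le_one _)
  calc _ ≤ ∑ z, m₃ z := Finset.sum_le_sum fun z _ => mul_le_of_le_one_right (h₃.1 z) (h z)
    _ = 1 := h₃.2

lemma gap_eq_pexp_triEnergy {k : ℕ} {A : C → C → C → Bool} {μ : Sym2 (Fin k) → C → ℝ}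
    {n : Sym2 (Fin k) → C → κ} (hμ : ∀ p, IsProb (μ p)) {a b c : Fin k} (hab : a ≠ b)
    (hca : c ≠ a) :
    gap A μ n a b c = pexp μ (fun ω =>
      triEnergy (μ s(a, b)) (μ s(a, c)) (μ s(b, c)) (tri A a b c) (refName A (n s(a, b)) a b c ω)
      - triEnergy (μ s(a, b)) (μ s(a, c)) (μ s(b, c)) (tri A a b c) (n s(a, b))) := by
  have hne : s(b, c) ≠ s(a, c) := by simp only [ne_eq, Sym2.eq_iff]; tauto
  rw [gap, ← pexp_avg s(a, c) (hμ _).2, ← pexp_avg s(b, c) (hμ _).2]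
  congr 1
  funext ω
  simp only [Function.update_self, Function.update_of_ne hne, refName_update (Or.inl rfl),
    refName_update (Or.inr rfl), triEnergy]
  simp only [mul_sub, Finset.sum_sub_distrib]

end Energy

section Refinement

variable {C κ : Type} [Fintype C] [DecidableEq κ]

/-- The total energy of a triangle. -/
noncomputable def totEnergy (A : C → C → C → Bool) (μ : Sym2 ℕ → C → ℝ) (n : Sym2 ℕ → C → κ)
    (i j l : ℕ) : ℝ :=
  triEnergy (μ s(i, j)) (μ s(i, l)) (μ s(j, l)) (tri A i j l) (n s(i, j))
  + triEnergy (μ s(i, l)) (μ s(i, j)) (μ s(l, j)) (tri A i l j) (n s(i, l))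
  + triEnergy (μ s(j, l)) (μ s(j, i)) (μ s(l, i)) (tri A j l i) (n s(j, l))

/-- All gaps of the configurations in `J` are at most `γ`. -/
def SmallGaps (k : ℕ) (A : C → C → C → Bool) (μ : Sym2 ℕ → C → ℝ) (n : Sym2 ℕ → C → κ)
    (γ : ℝ) (J : Finset ℕ) : Prop :=
  ∀ F : Fin k → ℕ, StrictMono F → (∀ x, F x ∈ J) → ∀ a b c : Fin k, a < b → c ≠ a → c ≠ b →
    gap A (fun p => μ (p.map F)) (fun p => n (p.map F)) a b c ≤ γ

/-- `l` lies in the same position relative to `i < j` as `c` does relative to `a < b`. -/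
def SameRole {k : ℕ} (a b c : Fin k) (i j l : ℕ) : Prop :=
  l ≠ i ∧ l ≠ j ∧ (j < l ↔ b < c) ∧ (i < l ↔ a < c)

/-- The names on `ij` can be refined so as to gain energy for all thirds in `T` in the position
prescribed by `abc`. -/
def Improvable {k : ℕ} (A : C → C → C → Bool) (μ : Sym2 ℕ → C → ℝ) (n : Sym2 ℕ → C → κ)
    (γ : ℝ) (a b c : Fin k) (T : Finset ℕ) (i j : ℕ) : Prop :=
  ∃ n' : C → κ × (Fin k → Bool), (∀ x, (n' x).1 = n s(i, j) x) ∧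
    ∀ l ∈ T, SameRole a b c i j l →
      triEnergy (μ s(i, j)) (μ s(i, l)) (μ s(j, l)) (tri A i j l) (n s(i, j)) + γ
        ≤ triEnergy (μ s(i, j)) (μ s(i, l)) (μ s(j, l)) (tri A i j l) n'

/-- If the gap is large for a family of configurations differing only in the image of `c`, a
single refinement works for many of them. -/
lemma exists_refinement_of_gap {k : ℕ} {A : C → C → C → Bool} {μ : Sym2 ℕ → C → ℝ}
    {n : Sym2 ℕ → C → κ} (hμ : ∀ p, IsProb (μ p)) {γ : ℝ} (hγ : 0 < γ) {a b c : Fin k}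
    (hab : a < b) (hca : c ≠ a) (hcb : c ≠ b) (D : Fin k → ℕ) (Λ : Finset ℕ)
    (hD : ∀ l ∈ Λ, StrictMono (Function.update D c l))
    (hgap : ∀ l ∈ Λ, γ < gap A (fun p => μ (p.map (Function.update D c l)))
      (fun p => n (p.map (Function.update D c l))) a b c) :
    ∃ n' : C → κ × (Fin k → Bool), (∀ x, (n' x).1 = n s(D a, D b) x) ∧
      ∃ Λ' ⊆ Λ, γ / 2 * Λ.card ≤ Λ'.card ∧ ∀ l ∈ Λ',
        triEnergy (μ s(D a, D b)) (μ s(D a, l)) (μ s(D b, l)) (tri A (D a) (D b) l)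
          (n s(D a, D b)) + γ / 2
        ≤ triEnergy (μ s(D a, D b)) (μ s(D a, l)) (μ s(D b, l)) (tri A (D a) (D b) l) n' := by
  classical
  let G : ℕ → (Sym2 (Fin k) → C) → ℝ := fun l ω =>
    triEnergy (μ s(D a, D b)) (μ s(D a, l)) (μ s(D b, l)) (tri A (D a) (D b) l)
        (refName A (n s(D a, D b)) a b c ω)
    - triEnergy (μ s(D a, D b)) (μ s(D a, l)) (μ s(D b, l)) (tri A (D a) (D b) l)
        (n s(D a, D b))
  have hprob : ∀ l p, IsProb (μ (Sym2.map (Function.update D c l) p)) := fun l p => hμ _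
  have hG : ∀ l ∈ Λ, γ ≤ pexp (fun p => μ (p.map D)) (G l) := by
    intro l hl
    refine (hgap l hl).le.trans_eq ?_
    rw [gap_eq_pexp_triEnergy (hprob l) hab.ne hca]
    have e : (fun ω => triEnergy (μ (Sym2.map (Function.update D c l) s(a, b)))
          (μ (Sym2.map (Function.update D c l) s(a, c)))
          (μ (Sym2.map (Function.update D c l) s(b, c))) (tri A a b c)
          (refName A (n (Sym2.map (Function.update D c l) s(a, b))) a b c ω)
        - triEnergy (μ (Sym2.map (Function.update D c l) s(a, b)))
          (μ (Sym2.map (Function.update D c l) s(a, c)))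
          (μ (Sym2.map (Function.update D c l) s(b, c))) (tri A a b c)
          (n (Sym2.map (Function.update D c l) s(a, b)))) = G l := by
      funext ω
      have h3 := tri_strictMono (hD l hl) A a b c
      simp only [Function.update_self, Function.update_of_ne hca.symm,
        Function.update_of_ne hcb.symm] at h3
      simp only [Sym2.map_mk, Function.update_self, Function.update_of_ne hca.symm,
        Function.update_of_ne hcb.symm, G, h3]
    rw [e]
    refine pexp_congr_weight (hprob l) (fun p => hμ _) ?_
    intro p hp ω x
    have hcp : c ∈ p := by
      by_contra hcp
      apply hp
      congr 1
      refine Sym2.map_congr fun y hy => ?_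
      rw [Function.update_of_ne]
      rintro rfl
      exact hcp hy
    obtain ⟨z, rfl⟩ := hcp
    have : refName A (n s(D a, D b)) a b c (Function.update ω s(c, z) x)
        = refName A (n s(D a, D b)) a b c ω := by
      funext y
      simp only [refName, Prod.mk.injEq, true_and]
      funext w
      by_cases h : w ≠ a ∧ w ≠ b ∧ w ≠ c
      · have h1 : s(a, w) ≠ s(c, z) := by
          simp only [ne_eq, Sym2.eq_iff]; tauto
        have h2 : s(b, w) ≠ s(c, z) := by
          simp only [ne_eq, Sym2.eq_iff]; tauto
        rw [Function.update_of_ne h1, Function.update_of_ne h2]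
      · simp [h]
    simp only [G, this]
  have hsum : γ * Λ.card ≤ pexp (fun p => μ (p.map D)) (fun ω => ∑ l ∈ Λ, G l ω) := by
    rw [pexp_sum, mul_comm, ← nsmul_eq_mul]
    exact Finset.card_nsmul_le_sum _ _ _ hG
  obtain ⟨ω, hω⟩ := exists_le_of_pexp_le (fun p => hμ _) hsum
  refine ⟨refName A (n s(D a, D b)) a b c ω, fun x => rfl, Λ.filter (fun l => γ / 2 ≤ G l ω),
    Finset.filter_subset _ _, ?_, ?_⟩
  · have h1 : ∑ l ∈ Λ, G l ω ≤ ∑ l ∈ Λ, (γ / 2 + if γ / 2 ≤ G l ω then 1 else 0) := by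
      refine Finset.sum_le_sum fun l _ => ?_
      split_ifs with h
      · have h1 : G l ω ≤ 1 - 0 := sub_le_sub
          (triEnergy_le_one (hμ _) (hμ _) (hμ _)) (triEnergy_nonneg (hμ _) (hμ _) (hμ _))
        linarith
      · linarith
    rw [Finset.sum_add_distrib, Finset.sum_const, Finset.sum_boole, nsmul_eq_mul] at h1
    linarith
  · intro l hl
    have := (Finset.mem_filter.1 hl).2
    simp only [G] at this
    linarith

end Refinement

lemma exists_strictMono_mem (I : Finset ℕ) :
    ∃ e : ℕ → ℕ, StrictMono e ∧ ∀ t < I.card, e t ∈ I := by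
  refine ⟨fun t => if h : t < I.card then I.orderEmbOfFin rfl ⟨t, h⟩ else I.sup id + 1 + t,
    fun s t hst => ?_, fun t ht => ?_⟩
  · dsimp only
    split_ifs with h1 h2
    · exact (I.orderEmbOfFin rfl).strictMono hst
    · have : I.orderEmbOfFin rfl ⟨s, h1⟩ ≤ I.sup id :=
        Finset.le_sup (f := id) (I.orderEmbOfFin_mem rfl _)
      omega
    · omega
    · omega
  · simp only [ht, dite_true]
    exact I.orderEmbOfFin_mem rfl _

/-- The number of elements of `T` below `i`. -/
def rankIn (T : Finset ℕ) (i : ℕ) : ℕ := (T.filter (· < i)).card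

lemma rankIn_lt_rankIn {T : Finset ℕ} {i j : ℕ} (hi : i ∈ T) (hij : i < j) :
    rankIn T i < rankIn T j := by
  refine Finset.card_lt_card (Finset.ssubset_iff_of_subset ?_ |>.2 ⟨i, ?_, ?_⟩)
  · intro x hx
    simp only [Finset.mem_filter] at hx ⊢
    exact ⟨hx.1, hx.2.trans hij⟩
  · simp [hi, hij]
  · simp

lemma rankIn_injOn {T : Finset ℕ} {i j : ℕ} (hi : i ∈ T) (hj : j ∈ T)
    (h : rankIn T i = rankIn T j) : i = j := by
  rcases lt_trichotomy i j with hij | hij | hij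
  · exact absurd h (rankIn_lt_rankIn hi hij).ne
  · exact hij
  · exact absurd h (rankIn_lt_rankIn hj hij).ne'

lemma rankIn_lt_card {T : Finset ℕ} {i : ℕ} (hi : i ∈ T) : rankIn T i < T.card := by
  refine Finset.card_lt_card (Finset.ssubset_iff_of_subset (Finset.filter_subset _ _) |>.2
    ⟨i, hi, by simp⟩)

/-- A set with prescribed ranks of `p₁ < p₂`, given enough room in the three intervals. -/
lemma exists_subset_rankIn {Y : Finset ℕ} {p₁ p₂ R u v : ℕ} (hp : p₁ < p₂) (huv : u < v)
    (hvR : v < R) (h0 : R ≤ (Y.filter (· < p₁)).card)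
    (h1 : R ≤ (Y.filter fun x => p₁ < x ∧ x < p₂).card) (h2 : R ≤ (Y.filter (p₂ < ·)).card) :
    ∃ T ⊆ insert p₁ (insert p₂ Y), T.card = R ∧ p₁ ∈ T ∧ p₂ ∈ T ∧
      rankIn T p₁ = u ∧ rankIn T p₂ = v := by
  obtain ⟨X0, hX0, c0⟩ := Finset.exists_subset_card_eq (show u ≤ _ from (by omega : u ≤ R).trans h0)
  obtain ⟨X1, hX1, c1⟩ := Finset.exists_subset_card_eq
    (show v - u - 1 ≤ _ from (by omega : v - u - 1 ≤ R).trans h1)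
  obtain ⟨X2, hX2, c2⟩ := Finset.exists_subset_card_eq
    (show R - v - 1 ≤ _ from (by omega : R - v - 1 ≤ R).trans h2)
  have m0 : ∀ x ∈ X0, x ∈ Y ∧ x < p₁ := fun x hx => by simpa using hX0 hx
  have m1 : ∀ x ∈ X1, x ∈ Y ∧ p₁ < x ∧ x < p₂ := fun x hx => by simpa using hX1 hx
  have m2 : ∀ x ∈ X2, x ∈ Y ∧ p₂ < x := fun x hx => by simpa using hX2 hx
  have d01 : Disjoint X0 X1 := Finset.disjoint_left.2 fun x hx hx' => by
    have := m0 x hx; have := m1 x hx'; omega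
  have n1 : p₁ ∉ X0 ∪ X1 := fun h => by
    rcases Finset.mem_union.1 h with h | h
    · have := m0 _ h; omega
    · have := m1 _ h; omega
  have n1' : p₁ ∉ X2 := fun h => by have := m2 _ h; omega
  have n2 : p₂ ∉ insert p₁ (X0 ∪ X1) := fun h => by
    rcases Finset.mem_insert.1 h with h | h
    · omega
    rcases Finset.mem_union.1 h with h | h
    · have := m0 _ h; omega
    · have := m1 _ h; omega
  have d2 : Disjoint (insert p₂ (insert p₁ (X0 ∪ X1))) X2 := Finset.disjoint_left.2
    fun x hx hx' => by
      have := m2 x hx'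
      simp only [Finset.mem_insert, Finset.mem_union] at hx
      rcases hx with h | h | h | h
      · omega
      · omega
      · have := m0 _ h; omega
      · have := m1 _ h; omega
  refine ⟨insert p₂ (insert p₁ (X0 ∪ X1)) ∪ X2, ?_, ?_, ?_, ?_, ?_, ?_⟩
  · intro x hx
    simp only [Finset.mem_insert, Finset.mem_union] at hx ⊢
    rcases hx with (h | h | h | h) | h
    · tauto
    · tauto
    · have := m0 _ h; tauto
    · have := m1 _ h; tauto
    · have := m2 _ h; tauto
  · rw [Finset.card_union_of_disjoint d2, Finset.card_insert_of_notMem n2,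
      Finset.card_insert_of_notMem n1, Finset.card_union_of_disjoint d01, c0, c1, c2]
    omega
  · simp
  · simp
  · have : (insert p₂ (insert p₁ (X0 ∪ X1)) ∪ X2).filter (· < p₁) = X0 := by
      ext x
      simp only [Finset.mem_filter, Finset.mem_insert, Finset.mem_union]
      constructor
      · rintro ⟨(h | h | h | h) | h, hx⟩
        · omega
        · omega
        · exact h
        · have := m1 _ h; omega
        · have := m2 _ h; omega
      · intro h
        have := m0 _ h
        tauto
    rw [rankIn, this, c0]
  · have : (insert p₂ (insert p₁ (X0 ∪ X1)) ∪ X2).filter (· < p₂) = insert p₁ (X0 ∪ X1) := by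
      ext x
      simp only [Finset.mem_filter, Finset.mem_insert, Finset.mem_union]
      constructor
      · rintro ⟨(h | h | h | h) | h, hx⟩
        · omega
        · tauto
        · tauto
        · tauto
        · have := m2 _ h; omega
      · rintro (h | h | h)
        · subst h; tauto
        · have := m0 _ h; exact ⟨by tauto, by omega⟩
        · have := m1 _ h; tauto
    rw [rankIn, this, Finset.card_insert_of_notMem n1, Finset.card_union_of_disjoint d01, c0, c1]
    omega

section Refinement

variable {C κ : Type} [Fintype C] [DecidableEq κ]

lemma exists_improvable {k : ℕ} {A : C → C → C → Bool} {μ : Sym2 ℕ → C → ℝ}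
    {n : Sym2 ℕ → C → κ} (hμ : ∀ p, IsProb (μ p)) {γ : ℝ} (hγ : 0 < γ) {a b c : Fin k}
    (hab : a < b) (hca : c ≠ a) (hcb : c ≠ b) {I : Finset ℕ} {R g : ℕ}
    (hI : I.card = (k + 2) * g) (hg : R + 1 ≤ g) (hg' : (R : ℝ) ≤ γ / 2 * g)
    (hgap : ∀ F : Fin k → ℕ, StrictMono F → (∀ x, F x ∈ I) →
      γ < gap A (fun p => μ (p.map F)) (fun p => n (p.map F)) a b c)
    {u v : ℕ} (huv : u < v) (hv : v < R) :
    ∃ T ⊆ I, T.card = R ∧ ∃ i ∈ T, ∃ j ∈ T, rankIn T i = u ∧ rankIn T j = v ∧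
      Improvable A μ n (γ / 2) a b c T i j := by
  classical
  obtain ⟨e, he, heI⟩ := exists_strictMono_mem I
  rw [hI] at heI
  let D : Fin k → ℕ := fun x => e ((x + 1) * g)
  let blk : ℕ → Finset ℕ := fun m => (Finset.range g).image fun t => e (m * g + t)
  have blk_card : ∀ m, (blk m).card = g := fun m => by
    rw [Finset.card_image_of_injective, Finset.card_range]
    intro s t hst
    have := he.injective hst
    omega
  have blk_sub : ∀ m < k + 2, blk m ⊆ I := by
    intro m hm x hx
    obtain ⟨t, ht, rfl⟩ := Finset.mem_image.1 hx
    refine heI _ ?_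
    have : (m + 1) * g ≤ (k + 2) * g := Nat.mul_le_mul_right _ hm
    have := Finset.mem_range.1 ht
    nlinarith
  have hlt : ∀ {m m' : ℕ}, m < m' → ∀ {t}, t < g → m * g + t < m' * g := by
    intro m m' h t ht
    have : (m + 1) * g ≤ m' * g := Nat.mul_le_mul_right _ h
    nlinarith
  have blk_lt : ∀ {m m' : ℕ}, m < m' → ∀ x ∈ blk m, x < e (m' * g) := by
    intro m m' h x hx
    obtain ⟨t, ht, rfl⟩ := Finset.mem_image.1 hx
    exact he (hlt h (Finset.mem_range.1 ht))
  have lt_blk : ∀ {m m' : ℕ}, m < m' → ∀ x ∈ blk m', e (m * g) < x := by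
    intro m m' h x hx
    obtain ⟨t, ht, rfl⟩ := Finset.mem_image.1 hx
    exact he ((hlt (t := 0) h (by omega)).trans_le (by omega))
  have hDm : ∀ l ∈ blk (c + 1), StrictMono (Function.update D c l) := by
    intro l hl x y hxy
    by_cases hx : x = c
    · subst hx
      rw [Function.update_self, Function.update_of_ne hxy.ne']
      exact blk_lt (by simpa using hxy) l hl
    by_cases hy : y = c
    · subst hy
      rw [Function.update_self, Function.update_of_ne hxy.ne]
      exact lt_blk (by simpa using hxy) l hl
    rw [Function.update_of_ne hx, Function.update_of_ne hy]
    exact he (hlt (t := 0) (by simpa using hxy) (by omega))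
  have hDI : ∀ x, D x ∈ I := fun x => by
    refine heI _ ?_
    exact hlt (t := 0) (by omega) (by omega)
  obtain ⟨n', hn', Λ', hΛ', hcard, himp⟩ := exists_refinement_of_gap hμ hγ hab hca hcb D
    (blk (c + 1)) hDm (fun l hl => hgap _ (hDm l hl) fun x => by
      by_cases hx : x = c
      · subst hx
        rw [Function.update_self]
        exact blk_sub _ (by omega) hl
      · rw [Function.update_of_ne hx]
        exact hDI x)
  have hΛR : R ≤ Λ'.card := by
    rw [blk_card] at hcard
    exact_mod_cast hg'.trans hcard
  have hDab : D a < D b := he (hlt (t := 0) (by simpa using hab) (by omega))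
  let Y := I.filter fun l => SameRole a b c (D a) (D b) l → l ∈ Λ'
  have erase_card : ∀ m x, R ≤ ((blk m).erase x).card := fun m x => by
    have := Finset.pred_card_le_card_erase (s := blk m) (a := x)
    rw [blk_card] at this
    omega
  have hΛI : Λ' ⊆ I := hΛ'.trans (blk_sub _ (by omega))
  have h0 : R ≤ (Y.filter (· < D a)).card := by
    by_cases h : c < a
    · refine hΛR.trans (Finset.card_le_card fun l hl => ?_)
      have := blk_lt (m' := a + 1) (by simpa using h) l (hΛ' hl)
      simp only [Y, Finset.mem_filter]
      exact ⟨⟨hΛI hl, fun _ => hl⟩, this⟩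
    · refine (erase_card 0 0).trans (Finset.card_le_card fun l hl => ?_)
      have hl := Finset.mem_of_mem_erase hl
      have := blk_lt (m' := a + 1) (by omega) l hl
      simp only [Y, Finset.mem_filter]
      refine ⟨⟨blk_sub _ (by omega) hl, fun hr => ?_⟩, this⟩
      have h1 := hr.2.2.2
      have h2 : a < c := lt_of_le_of_ne (not_lt.1 h) hca.symm
      exact absurd (h1.2 h2) (not_lt.2 (le_of_lt this))
  have h1 : R ≤ (Y.filter fun l => D a < l ∧ l < D b).card := by
    by_cases h : a < c ∧ c < b
    · refine hΛR.trans (Finset.card_le_card fun l hl => ?_)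
      have h1 := blk_lt (m' := b + 1) (by simpa using h.2) l (hΛ' hl)
      have h2 := lt_blk (m := a + 1) (by simpa using h.1) l (hΛ' hl)
      simp only [Y, Finset.mem_filter]
      exact ⟨⟨hΛI hl, fun _ => hl⟩, h2, h1⟩
    · refine (erase_card (a + 1) (D a)).trans (Finset.card_le_card fun l hl => ?_)
      obtain ⟨hne, hl⟩ := Finset.mem_erase.1 hl
      have h3 := blk_lt (m' := b + 1) (by simpa using hab) l hl
      have h4 : D a < l := by
        refine lt_of_le_of_ne ?_ hne.symm
        obtain ⟨t, ht, rfl⟩ := Finset.mem_image.1 hl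
        exact he.monotone (by omega)
      simp only [Y, Finset.mem_filter]
      refine ⟨⟨blk_sub _ (by omega) hl, fun hr => ?_⟩, h4, h3⟩
      refine absurd ⟨hr.2.2.2.1 h4, lt_of_le_of_ne (not_lt.1 fun hbc => ?_) hcb⟩ h
      exact absurd (hr.2.2.1.2 hbc) (not_lt.2 (le_of_lt h3))
  have h2 : R ≤ (Y.filter (D b < ·)).card := by
    by_cases h : b < c
    · refine hΛR.trans (Finset.card_le_card fun l hl => ?_)
      have := lt_blk (m := b + 1) (by simpa using h) l (hΛ' hl)
      simp only [Y, Finset.mem_filter]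
      exact ⟨⟨hΛI hl, fun _ => hl⟩, this⟩
    · refine (erase_card (b + 1) (D b)).trans (Finset.card_le_card fun l hl => ?_)
      obtain ⟨hne, hl⟩ := Finset.mem_erase.1 hl
      have h4 : D b < l := by
        refine lt_of_le_of_ne ?_ hne.symm
        obtain ⟨t, ht, rfl⟩ := Finset.mem_image.1 hl
        exact he.monotone (by omega)
      simp only [Y, Finset.mem_filter]
      exact ⟨⟨blk_sub _ (by omega) hl, fun hr => absurd (hr.2.2.1.1 h4) h⟩, h4⟩
  obtain ⟨T, hT, hcT, h1T, h2T, hu, hv⟩ := exists_subset_rankIn hDab huv hv h0 h1 h2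
  refine ⟨T, fun x hx => ?_, hcT, D a, h1T, D b, h2T, hu, hv, n', hn', fun l hl hr => ?_⟩
  · rcases Finset.mem_insert.1 (hT hx) with rfl | h
    · exact hDI a
    rcases Finset.mem_insert.1 h with rfl | h
    · exact hDI b
    exact (Finset.mem_filter.1 h).1
  · refine himp l ?_
    rcases Finset.mem_insert.1 (hT hl) with rfl | h
    · exact absurd rfl hr.1
    rcases Finset.mem_insert.1 h with rfl | h
    · exact absurd rfl hr.2.1
    exact (Finset.mem_filter.1 h).2 hr

end Refinement

section Refinement

lemma totEnergy_le_three {C κ : Type} [Fintype C] [DecidableEq κ] {A : C → C → C → Bool}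
    {μ : Sym2 ℕ → C → ℝ} {n : Sym2 ℕ → C → κ} (hμ : ∀ p, IsProb (μ p)) (i j l : ℕ) :
    totEnergy A μ n i j l ≤ 3 := by
  have h1 := triEnergy_le_one (r := tri A i j l) (n := n s(i, j)) (hμ s(i, j)) (hμ s(i, l))
    (hμ s(j, l))
  have h2 := triEnergy_le_one (r := tri A i l j) (n := n s(i, l)) (hμ s(i, l)) (hμ s(i, j))
    (hμ s(l, j))
  have h3 := triEnergy_le_one (r := tri A j l i) (n := n s(j, l)) (hμ s(j, l)) (hμ s(j, i))
    (hμ s(l, i))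
  unfold totEnergy
  linarith

lemma totEnergy_nonneg {C κ : Type} [Fintype C] [DecidableEq κ] {A : C → C → C → Bool}
    {μ : Sym2 ℕ → C → ℝ} {n : Sym2 ℕ → C → κ} (hμ : ∀ p, IsProb (μ p)) (i j l : ℕ) :
    0 ≤ totEnergy A μ n i j l :=
  add_nonneg (add_nonneg (triEnergy_nonneg (hμ _) (hμ _) (hμ _))
    (triEnergy_nonneg (hμ _) (hμ _) (hμ _))) (triEnergy_nonneg (hμ _) (hμ _) (hμ _))

lemma totEnergy_mono {C κ κ' : Type} [Fintype C] [DecidableEq κ] [DecidableEq κ']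
    {A : C → C → C → Bool} {μ : Sym2 ℕ → C → ℝ} {n : Sym2 ℕ → C → κ} {n' : Sym2 ℕ → C → κ'}
    (hμ : ∀ p, IsProb (μ p)) (hn : ∀ p, (n p).FactorsThrough (n' p)) (i j l : ℕ) :
    totEnergy A μ n i j l ≤ totEnergy A μ n' i j l :=
  add_le_add (add_le_add (triEnergy_mono (hμ _) (hμ _) (hμ _) (hn _))
    (triEnergy_mono (hμ _) (hμ _) (hμ _) (hn _))) (triEnergy_mono (hμ _) (hμ _) (hμ _) (hn _))

/-- One step of the iteration: either all gaps are small on a large index set, or the names can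
be refined so that the total energy of all triangles in a large index set increases. -/
theorem smallGaps_or_exists_refinement (k : ℕ) {γ : ℝ} (hγ : 0 < γ) (R : ℕ) :
    ∃ R' : ℕ, ∀ {C κ : Type} [Fintype C] [DecidableEq κ] (A : C → C → C → Bool)
      (μ : Sym2 ℕ → C → ℝ) (n : Sym2 ℕ → C → κ), (∀ p, IsProb (μ p)) →
      ∀ I : Finset ℕ, R' ≤ I.card → ∃ J ⊆ I, J.card = R ∧
        (SmallGaps k A μ n γ J ∨ ∃ n' : Sym2 ℕ → C → κ × (Fin k → Bool),
          ∀ i ∈ J, ∀ j ∈ J, ∀ l ∈ J, i < j → j < l →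
            totEnergy A μ n i j l + γ / 2 ≤ totEnergy A μ n' i j l) := by
  classical
  obtain ⟨g, hg⟩ := exists_nat_ge (2 * R / γ + R + 1)
  have hgR : R + 1 ≤ g := by
    have : (0 : ℝ) ≤ 2 * R / γ := by positivity
    have : (R : ℝ) + 1 ≤ g := by linarith
    exact_mod_cast this
  have hgγ : (R : ℝ) ≤ γ / 2 * g := by
    have : 2 * R / γ ≤ (g : ℝ) := by linarith [(Nat.cast_nonneg R : (0 : ℝ) ≤ R)]
    rw [div_le_iff₀ hγ] at this
    linarith
  obtain ⟨M₂, hM₂⟩ := exists_homogeneous (Set (Fin R × Fin R)) R ((k + 2) * g)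
  obtain ⟨M₁, hM₁⟩ := exists_homogeneous (Set (Fin k × Fin k × Fin k)) k (max R M₂)
  refine ⟨M₁, fun {C κ} _ _ A μ n hμ I hI => ?_⟩
  obtain ⟨I₁, hI₁, hc₁, lab, hlab⟩ := hM₁ I hI (fun T => {l | l.1 < l.2.1 ∧ l.2.2 ≠ l.1 ∧
    l.2.2 ≠ l.2.1 ∧ ∃ F : Fin k → ℕ, StrictMono F ∧ Finset.univ.image F = T ∧
      γ < gap A (fun p => μ (p.map F)) (fun p => n (p.map F)) l.1 l.2.1 l.2.2})
  have himg : ∀ F : Fin k → ℕ, StrictMono F → (∀ x, F x ∈ I₁) →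
      Finset.univ.image F ⊆ I₁ ∧ (Finset.univ.image F).card = k := by
    intro F hF hFI
    refine ⟨fun x hx => ?_, ?_⟩
    · obtain ⟨y, -, rfl⟩ := Finset.mem_image.1 hx
      exact hFI y
    · rw [Finset.card_image_of_injective _ hF.injective, Finset.card_univ, Fintype.card_fin]
  by_cases hempty : lab = ∅
  · obtain ⟨J, hJ, hcJ⟩ := Finset.exists_subset_card_eq (show R ≤ I₁.card by rw [hc₁]; simp)
    refine ⟨J, hJ.trans hI₁, hcJ, Or.inl ?_⟩
    intro F hF hFJ a b c hab hca hcb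
    by_contra! hgap
    obtain ⟨h1, h2⟩ := himg F hF fun x => hJ (hFJ x)
    have := hlab _ h1 h2
    rw [hempty] at this
    have h3 : (a, b, c) ∈ (∅ : Set (Fin k × Fin k × Fin k)) := by
      rw [← this]
      exact ⟨hab, hca, hcb, F, hF, rfl, hgap⟩
    exact h3
  obtain ⟨⟨a, b, c⟩, habc⟩ := Set.nonempty_iff_ne_empty.2 hempty
  have hbad : ∀ F : Fin k → ℕ, StrictMono F → (∀ x, F x ∈ I₁) → a < b ∧ c ≠ a ∧ c ≠ b ∧
      γ < gap A (fun p => μ (p.map F)) (fun p => n (p.map F)) a b c := by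
    intro F hF hFI
    obtain ⟨h1, h2⟩ := himg F hF hFI
    rw [← hlab _ h1 h2] at habc
    obtain ⟨h3, h4, h5, F', hF', hFF, hgap⟩ := habc
    have : F' = F := by
      refine (StrictMono.range_inj hF' hF).1 ?_
      have := congrArg (fun s : Finset ℕ => (s : Set ℕ)) hFF
      simpa using this
    subst this
    exact ⟨h3, h4, h5, hgap⟩
  obtain ⟨I₃, hI₃, hc₃, col, hcol⟩ := hM₂ I₁ (by rw [hc₁]; simp) (fun T => {q | ∀ i ∈ T, ∀ j ∈ T,
    rankIn T i = q.1 → rankIn T j = q.2 → Improvable A μ n (γ / 2) a b c T i j})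
  have hkg : k ≤ I₃.card := by rw [hc₃]; nlinarith
  obtain ⟨hab, hca, hcb⟩ : a < b ∧ c ≠ a ∧ c ≠ b := by
    obtain ⟨e, he, heI⟩ := exists_strictMono_mem I₃
    have := hbad (fun x => e x) (fun x y hxy => he hxy) (fun x => hI₃ (heI _ (by omega)))
    tauto
  have hmem : ∀ q : Fin R × Fin R, q.1 < q.2 → q ∈ col := by
    rintro ⟨u, v⟩ huv
    obtain ⟨T, hT, hcT, i, hi, j, hj, hu, hv, himp⟩ := exists_improvable hμ hγ hab hca hcb hc₃
      hgR hgγ (fun F hF hFI => (hbad F hF fun x => hI₃ (hFI x)).2.2.2) (u := u) (v := v) huv v.2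
    rw [← hcol T hT hcT]
    intro i' hi' j' hj' hu' hv'
    rw [rankIn_injOn hi' hi (hu'.trans hu.symm), rankIn_injOn hj' hj (hv'.trans hv.symm)]
    exact himp
  obtain ⟨J, hJ, hcJ⟩ := Finset.exists_subset_card_eq
    (show R ≤ I₃.card by rw [hc₃]; nlinarith)
  have himp : ∀ i j, ∃ n' : C → κ × (Fin k → Bool), (∀ x, (n' x).1 = n s(i, j) x) ∧
      (i ∈ J → j ∈ J → i < j → ∀ l ∈ J, SameRole a b c i j l →
        triEnergy (μ s(i, j)) (μ s(i, l)) (μ s(j, l)) (tri A i j l) (n s(i, j)) + γ / 2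
        ≤ triEnergy (μ s(i, j)) (μ s(i, l)) (μ s(j, l)) (tri A i j l) n') := by
    intro i j
    by_cases h : i ∈ J ∧ j ∈ J ∧ i < j
    · obtain ⟨hi, hj, hij⟩ := h
      have h1 := hmem (⟨rankIn J i, hcJ ▸ rankIn_lt_card hi⟩, ⟨rankIn J j, hcJ ▸ rankIn_lt_card hj⟩)
        (rankIn_lt_rankIn hi hij)
      rw [← hcol J hJ hcJ] at h1
      obtain ⟨n', h2, h3⟩ := h1 i hi j hj rfl rfl
      exact ⟨n', h2, fun _ _ _ => h3⟩
    · exact ⟨fun x => (n s(i, j) x, fun _ => false), fun x => rfl,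
        fun h1 h2 h3 => absurd ⟨h1, h2, h3⟩ h⟩
  choose nn hnn1 hnn2 using himp
  refine ⟨J, hJ.trans (hI₃.trans hI₁), hcJ, Or.inr ⟨fun p => nn p.inf p.sup, ?_⟩⟩
  intro i hi j hj l hl hij hjl
  have hil := hij.trans hjl
  have mono : ∀ {x y : ℕ}, x < y → ∀ z, triEnergy (μ s(x, y)) (μ s(x, z)) (μ s(y, z)) (tri A x y z)
      (n s(x, y)) ≤ triEnergy (μ s(x, y)) (μ s(x, z)) (μ s(y, z)) (tri A x y z) (nn x y) :=
    fun {x y} hxy z => triEnergy_mono (hμ _) (hμ _) (hμ _) fun w w' h => by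
      rw [← hnn1, ← hnn1, h]
  have m1 := mono hij l
  have m2 := mono hil j
  have m3 := mono hjl i
  simp only [totEnergy, Sym2.inf_mk, Sym2.sup_mk, inf_eq_left.2 hij.le, inf_eq_left.2 hil.le,
    inf_eq_left.2 hjl.le, sup_eq_right.2 hij.le, sup_eq_right.2 hil.le, sup_eq_right.2 hjl.le]
  by_cases hbc : b < c
  · have := hnn2 i j hi hj hij l hl
      ⟨hil.ne', hjl.ne', iff_of_true hjl hbc, iff_of_true hil (hab.trans hbc)⟩
    linarith
  by_cases hac : a < c
  · have := hnn2 i l hi hl hil j hj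
      ⟨hij.ne', hjl.ne, iff_of_false hjl.not_gt hbc, iff_of_true hij hac⟩
    linarith
  · have := hnn2 j l hj hl hjl i hi
      ⟨hij.ne, hil.ne, iff_of_false hil.not_gt hbc, iff_of_false hij.not_gt hac⟩
    linarith

lemma exists_smallGaps_of_le_totEnergy (k : ℕ) {γ : ℝ} (hγ : 0 < γ) (f : ℕ → ℕ) (m : ℕ) :
    ∀ K : ℕ, ∃ R' : ℕ, ∀ {C : Type} [Fintype C] (A : C → C → C → Bool)
      (μ : Sym2 ℕ → C → ℝ) (n : Sym2 ℕ → C → Fin K), (∀ p, IsProb (μ p)) →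
      ∀ I : Finset ℕ, R' ≤ I.card →
      (∀ i ∈ I, ∀ j ∈ I, ∀ l ∈ I, i < j → j < l → 3 - m * (γ / 2) ≤ totEnergy A μ n i j l) →
      ∃ K' : ℕ, ∃ n' : Sym2 ℕ → C → Fin K', ∃ J ⊆ I, f K' ≤ J.card ∧
        SmallGaps k A μ n' γ J := by
  induction m with
  | zero =>
    intro K
    obtain ⟨R', hR'⟩ := smallGaps_or_exists_refinement k hγ (max 3 (f K))
    refine ⟨R', fun {C} _ A μ n hμ I hI hE => ?_⟩
    obtain ⟨J, hJ, hcJ, h | ⟨n', hn'⟩⟩ := hR' A μ n hμ I hI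
    · exact ⟨K, n, J, hJ, by rw [hcJ]; simp, h⟩
    · exfalso
      obtain ⟨e, he, heJ⟩ := exists_strictMono_mem J
      have h3 : 3 ≤ J.card := by rw [hcJ]; simp
      have h := hn' (e 0) (heJ 0 (by omega)) (e 1) (heJ 1 (by omega)) (e 2) (heJ 2 (by omega))
        (he (by omega)) (he (by omega))
      have h' := hE (e 0) (hJ (heJ 0 (by omega))) (e 1) (hJ (heJ 1 (by omega))) (e 2)
        (hJ (heJ 2 (by omega))) (he (by omega)) (he (by omega))
      have h'' := totEnergy_le_three (A := A) (n := n') hμ (e 0) (e 1) (e 2)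
      simp only [Nat.cast_zero, zero_mul, sub_zero] at h'
      linarith
  | succ m ih =>
    intro K
    obtain ⟨R₁, hR₁⟩ := ih (Fintype.card (Fin K × (Fin k → Bool)))
    obtain ⟨R', hR'⟩ := smallGaps_or_exists_refinement k hγ (max R₁ (f K))
    refine ⟨R', fun {C} _ A μ n hμ I hI hE => ?_⟩
    obtain ⟨J, hJ, hcJ, h | ⟨n', hn'⟩⟩ := hR' A μ n hμ I hI
    · exact ⟨K, n, J, hJ, by rw [hcJ]; simp, h⟩
    · obtain ⟨K', n'', J', hJ', hf, hs⟩ := hR₁ A μ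
        (fun p x => Fintype.equivFin (Fin K × (Fin k → Bool)) (n' p x)) hμ J (by rw [hcJ]; simp)
        (by
          intro i hi j hj l hl hij hjl
          refine le_trans ?_ (totEnergy_mono (n := n') hμ ?_ i j l)
          · have h1 := hn' i hi j hj l hl hij hjl
            have h2 := hE i (hJ hi) j (hJ hj) l (hJ hl) hij hjl
            push_cast at h2
            linarith
          · intro p x y h
            exact (Fintype.equivFin _).injective h)
      exact ⟨K', n'', J', hJ'.trans hJ, hf, hs⟩

/-- A bounded name map with small gaps on a large index set. -/
theorem exists_smallGaps (k : ℕ) {γ : ℝ} (hγ : 0 < γ) (f : ℕ → ℕ) :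
    ∃ M : ℕ, ∀ {C : Type} [Fintype C] (A : C → C → C → Bool)
      (μ : Sym2 ℕ → C → ℝ), (∀ p, IsProb (μ p)) →
      ∀ I : Finset ℕ, M ≤ I.card →
      ∃ K : ℕ, ∃ n : Sym2 ℕ → C → Fin K, ∃ J ⊆ I, f K ≤ J.card ∧ SmallGaps k A μ n γ J := by
  obtain ⟨m, hm⟩ := exists_nat_ge (6 / γ)
  obtain ⟨M, hM⟩ := exists_smallGaps_of_le_totEnergy k hγ f m 1
  refine ⟨M, fun {C} _ A μ hμ I hI => hM A μ (fun _ _ => 0) hμ I hI ?_⟩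
  intro i _ j _ l _ _ _
  rw [div_le_iff₀ hγ] at hm
  linarith [totEnergy_nonneg (A := A) (n := fun _ _ => (0 : Fin 1)) hμ i j l]

end Refinement

section Decoupling

variable {Y W : Type} [Fintype Y] [Fintype W] [DecidableEq W] {k : ℕ}

/-- The three pairs of a triple. -/
def pairsOf (e : Fin k × Fin k × Fin k) : Finset (Sym2 (Fin k)) :=
  {s(e.1, e.2.1), s(e.1, e.2.2), s(e.2.1, e.2.2)}

lemma edgeOk_congr {C : Type*} {A : C → C → C → Bool} {e : Fin k × Fin k × Fin k}
    {ω ω' : Sym2 (Fin k) → C} (h : ∀ p ∈ pairsOf e, ω p = ω' p) :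
    edgeOk A e ω = edgeOk A e ω' := by
  simp only [edgeOk]
  rw [h s(e.1, e.2.1) (by simp [pairsOf]), h s(e.1, e.2.2) (by simp [pairsOf]),
    h s(e.2.1, e.2.2) (by simp [pairsOf])]

/-- Giving one pair its own independent label at most squares the density. -/
lemma sq_pexp_prod_edgeOk_le {ν : W → Y → ℝ} (hν : ∀ w, IsProb (ν w)) (B : Y → Y → Y → Bool)
    (s : Finset (Fin k × Fin k × Fin k)) {ψ : Sym2 (Fin k) → W}
    (hψ : ∀ e ∈ s, Set.InjOn ψ (pairsOf e)) {w : W} (hw : ∀ p, ψ p ≠ w) (q : Sym2 (Fin k))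
    (hq : ν w = ν (ψ q)) :
    pexp ν (fun t => ∏ e ∈ s, bi (edgeOk B e (t ∘ ψ))) ^ 2
      ≤ pexp ν (fun t => ∏ e ∈ s, bi (edgeOk B e (t ∘ Function.update ψ q w))) := by
  classical
  let U : (W → Y) → ℝ := fun t =>
    ∏ e ∈ s with q ∉ pairsOf e, bi (edgeOk B e (t ∘ Function.update ψ q w))
  let V : (W → Y) → ℝ := fun t =>
    ∏ e ∈ s with ¬ q ∉ pairsOf e, bi (edgeOk B e (t ∘ Function.update ψ q w))
  have hU0 : ∀ t, 0 ≤ U t := fun t => Finset.prod_nonneg fun _ _ => bi_nonneg _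
  have hV0 : ∀ t, 0 ≤ V t := fun t => Finset.prod_nonneg fun _ _ => bi_nonneg _
  have hU1 : ∀ t, U t ≤ 1 := fun t =>
    Finset.prod_le_one (fun _ _ => bi_nonneg _) fun _ _ => bi_le_one _
  have hV1 : ∀ t, V t ≤ 1 := fun t =>
    Finset.prod_le_one (fun _ _ => bi_nonneg _) fun _ _ => bi_le_one _
  have hUw : ∀ t y, U (Function.update t w y) = U t := by
    intro t y
    refine Finset.prod_congr rfl fun e he => ?_
    congr 1
    refine edgeOk_congr fun p hp => ?_
    have hpq : p ≠ q := by rintro rfl; exact (Finset.mem_filter.1 he).2 hp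
    simp only [Function.comp_apply, Function.update_of_ne hpq, Function.update_of_ne (hw p)]
  have hVj : ∀ t x, V (Function.update t (ψ q) x) = V t := by
    intro t x
    refine Finset.prod_congr rfl fun e he => ?_
    congr 1
    obtain ⟨he, hqe⟩ := Finset.mem_filter.1 he
    rw [not_not] at hqe
    refine edgeOk_congr fun p hp => ?_
    by_cases hpq : p = q
    · subst hpq
      simp only [Function.comp_apply, Function.update_self, Function.update_of_ne (hw p).symm]
    · have : ψ p ≠ ψ q := fun h => hpq (hψ e he hp hqe h)
      simp only [Function.comp_apply, Function.update_of_ne hpq, Function.update_of_ne this]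
  have hR : pexp ν (fun t => ∏ e ∈ s, bi (edgeOk B e (t ∘ Function.update ψ q w)))
      = pexp ν (fun t => (∑ x, ν (ψ q) x * U (Function.update t (ψ q) x))
        * ∑ y, ν (ψ q) y * V (Function.update t w y)) := by
    have e1 : (fun t : W → Y => ∏ e ∈ s, bi (edgeOk B e (t ∘ Function.update ψ q w)))
        = fun t => U t * V t := by
      funext t
      exact (Finset.prod_filter_mul_prod_filter_not s _ _).symm
    rw [e1, ← pexp_avg (ψ q) (hν _).2, ← pexp_avg w (hν _).2]
    congr 1
    funext t
    rw [Finset.sum_mul_sum, Finset.sum_comm]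
    refine Finset.sum_congr rfl fun y _ => ?_
    rw [Finset.mul_sum]
    refine Finset.sum_congr rfl fun x _ => ?_
    rw [hVj, Function.update_comm (hw q).symm, hUw, hq]
    ring
  have hL : pexp ν (fun t => ∏ e ∈ s, bi (edgeOk B e (t ∘ ψ)))
      = pexp ν (fun t => ∑ x, ν (ψ q) x *
        (U (Function.update t (ψ q) x) * V (Function.update t w x))) := by
    have e1 : (fun t : W → Y => ∏ e ∈ s, bi (edgeOk B e (t ∘ ψ)))
        = fun t => U t * V (Function.update t w (t (ψ q))) := by
      funext t
      rw [← Finset.prod_filter_mul_prod_filter_not s (fun e => q ∉ pairsOf e)]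
      congr 1
      · refine Finset.prod_congr rfl fun e he => ?_
        congr 1
        refine edgeOk_congr fun p hp => ?_
        have hpq : p ≠ q := by rintro rfl; exact (Finset.mem_filter.1 he).2 hp
        simp only [Function.comp_apply, Function.update_of_ne hpq]
      · refine Finset.prod_congr rfl fun e he => ?_
        congr 1
        refine edgeOk_congr fun p hp => ?_
        by_cases hpq : p = q
        · subst hpq; simp
        · simp only [Function.comp_apply, Function.update_of_ne hpq, Function.update_of_ne (hw p)]
    rw [e1, ← pexp_avg (ψ q) (hν _).2]
    congr 1
    funext t
    refine Finset.sum_congr rfl fun x _ => ?_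
    rw [Function.update_self, Function.update_comm (hw q), hVj]
  rw [hL, hR]
  refine (sq_pexp_le hν _).trans (pexp_mono hν fun t => ?_)
  have h0 := (hν (ψ q)).1
  have n0 : 0 ≤ ∑ x, ν (ψ q) x * (U (Function.update t (ψ q) x) * V (Function.update t w x)) :=
    Finset.sum_nonneg fun x _ => mul_nonneg (h0 x) (mul_nonneg (hU0 _) (hV0 _))
  rw [sq]
  refine mul_le_mul ?_ ?_ n0 (n0.trans ?_)
  · exact Finset.sum_le_sum fun x _ => mul_le_mul_of_nonneg_left
      (mul_le_of_le_one_right (hU0 _) (hV1 _)) (h0 x)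
  · exact Finset.sum_le_sum fun x _ => mul_le_mul_of_nonneg_left
      (mul_le_of_le_one_left (hV0 _) (hU1 _)) (h0 x)
  · exact Finset.sum_le_sum fun x _ => mul_le_mul_of_nonneg_left
      (mul_le_of_le_one_right (hU0 _) (hV1 _)) (h0 x)

/-- Passing from a colouring `φ` of the pairs by few labels to independent colours. -/
lemma pow_pexp_prod_edgeOk_le {ν : Y → ℝ} (hν : IsProb ν) (B : Y → Y → Y → Bool)
    (s : Finset (Fin k × Fin k × Fin k)) {φ : Sym2 (Fin k) → W}
    (hφ : ∀ e ∈ s, Set.InjOn φ (pairsOf e)) :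
    pexp (fun _ : W => ν) (fun t => ∏ e ∈ s, bi (edgeOk B e (t ∘ φ)))
        ^ (2 ^ Fintype.card (Sym2 (Fin k)))
      ≤ pexp (fun _ : Sym2 (Fin k) => ν) (fun t => ∏ e ∈ s, bi (edgeOk B e t)) := by
  classical
  let ψ : Finset (Sym2 (Fin k)) → Sym2 (Fin k) → W ⊕ Sym2 (Fin k) := fun S p =>
    if p ∈ S then Sum.inr p else Sum.inl (φ p)
  have hprob : ∀ x : W ⊕ Sym2 (Fin k), IsProb ((fun _ : W ⊕ Sym2 (Fin k) => ν) x) := fun _ => hν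
  let N : Finset (Sym2 (Fin k)) → ℝ := fun S => pexp (fun _ : W ⊕ Sym2 (Fin k) => ν)
    (fun t => ∏ e ∈ s, bi (edgeOk B e (t ∘ ψ S)))
  have hN0 : ∀ S, 0 ≤ N S := fun S =>
    pexp_nonneg hprob fun t => Finset.prod_nonneg fun _ _ => bi_nonneg _
  have step : ∀ S, N ∅ ^ (2 ^ S.card) ≤ N S := by
    intro S
    induction S using Finset.induction_on with
    | empty => simp
    | insert q S hq ih =>
      have h1 : N S ^ 2 ≤ N (insert q S) := by
        have hu : ψ (insert q S) = Function.update (ψ S) q (Sum.inr q) := by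
          funext p
          by_cases hp : p = q
          · subst hp; simp [ψ]
          · simp [ψ, hp]
        simp only [N, hu]
        refine sq_pexp_prod_edgeOk_le hprob B s ?_ ?_ q rfl
        · intro e he p hp p' hp' h
          simp only [ψ] at h
          split_ifs at h with h1 h2
          · exact Sum.inr_injective h
          · exact hφ e he hp hp' (Sum.inl_injective h)
        · intro p h
          simp only [ψ] at h
          split_ifs at h with h1
          exact hq (Sum.inr_injective h ▸ h1)
      rw [Finset.card_insert_of_notMem hq, pow_succ, pow_mul]
      exact (pow_le_pow_left₀ (pow_nonneg (hN0 _) _) ih 2).trans h1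
  have h := step Finset.univ
  have e1 : N ∅ = pexp (fun _ : W => ν) (fun t => ∏ e ∈ s, bi (edgeOk B e (t ∘ φ))) := by
    rw [← pexp_comp_injective hprob Sum.inl_injective
      (fun t => ∏ e ∈ s, bi (edgeOk B e (t ∘ φ)))]
    simp only [N, ψ, Finset.notMem_empty, if_false]
    rfl
  have e2 : N Finset.univ
      = pexp (fun _ : Sym2 (Fin k) => ν) (fun t => ∏ e ∈ s, bi (edgeOk B e t)) := by
    rw [← pexp_comp_injective hprob Sum.inr_injective (fun t => ∏ e ∈ s, bi (edgeOk B e t))]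
    simp only [N, ψ, Finset.mem_univ, if_true]
  rwa [e1, e2, Finset.card_univ] at h

end Decoupling

section Sampling

variable {Y : Type} [Fintype Y]

/-- The density of a ternary relation with respect to three weights. -/
noncomputable def triDensity (m₁ m₂ m₃ : Y → ℝ) (f : Y → Y → Y → ℝ) : ℝ :=
  ∑ x, m₁ x * ∑ y, m₂ y * ∑ z, m₃ z * f x y z

lemma IsProb.sum_mul_le {ν : Y → ℝ} (hν : IsProb ν) {f : Y → ℝ} {c : ℝ} (h : ∀ x, f x ≤ c) :
    ∑ x, ν x * f x ≤ c := by
  calc _ ≤ ∑ x, ν x * c := Finset.sum_le_sum fun x _ => mul_le_mul_of_nonneg_left (h x) (hν.1 x)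
    _ = c := by rw [← Finset.sum_mul, hν.2, one_mul]

lemma triDensity_le_one {m₁ m₂ m₃ : Y → ℝ} (h₁ : IsProb m₁) (h₂ : IsProb m₂) (h₃ : IsProb m₃)
    {f : Y → Y → Y → ℝ} (hf : ∀ x y z, f x y z ≤ 1) : triDensity m₁ m₂ m₃ f ≤ 1 :=
  h₁.sum_mul_le fun x => h₂.sum_mul_le fun y => h₃.sum_mul_le fun z => hf x y z

lemma pexp_triple {W : Type} [Fintype W] [DecidableEq W] {ν : W → Y → ℝ}
    (hν : ∀ w, IsProb (ν w)) {a b c : W} (hab : a ≠ b) (hac : a ≠ c) (hbc : b ≠ c)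
    (f : Y → Y → Y → ℝ) :
    pexp ν (fun t => f (t a) (t b) (t c)) = triDensity (ν a) (ν b) (ν c) f := by
  rw [← pexp_avg c (hν _).2, ← pexp_avg b (hν _).2, ← pexp_avg a (hν _).2]
  simp only [Function.update_self, Function.update_of_ne hab, Function.update_of_ne hac,
    Function.update_of_ne hbc]
  rw [pexp_const hν]
  rfl

lemma card_distinct_triples_ge (m : ℕ) :
    (m : ℝ) ^ 3 - 3 * m ^ 2 ≤ ∑ a : Fin m, ∑ b : Fin m, ∑ c : Fin m,
      if a ≠ b ∧ a ≠ c ∧ b ≠ c then (1 : ℝ) else 0 := by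
  have h : ∀ a b c : Fin m, (1 : ℝ) - (if a = b then 1 else 0) - (if a = c then 1 else 0)
      - (if b = c then 1 else 0) ≤ if a ≠ b ∧ a ≠ c ∧ b ≠ c then (1 : ℝ) else 0 := by
    intro a b c
    by_cases h1 : a = b <;> by_cases h2 : a = c <;> by_cases h3 : b = c <;>
      simp_all
  refine le_trans (le_of_eq ?_) (Finset.sum_le_sum fun a _ => Finset.sum_le_sum fun b _ =>
    Finset.sum_le_sum fun c _ => h a b c)
  simp [Finset.sum_sub_distrib]
  ring

/-- If every dense relation on `m` colours is admissible for a member of `𝓕`, every dense weighted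
relation contains a member of `𝓕` with positive density. -/
theorem exists_pexp_ge_of_admissible {k m : ℕ} (𝓕 : Finset (Finset (Fin k × Fin k × Fin k)))
    {D δ : ℝ} (hδ : 0 < δ) (hD : 2 * δ ≤ D) (hm : 0 < m) (hmδ : 3 / m ≤ δ)
    (hadm : ∀ Q : Fin m → Fin m → Fin m → Bool,
      (D - 2 * δ) * m ^ 3 ≤ ∑ a, ∑ b, ∑ c, bi (Q a b c) →
      ∃ s ∈ 𝓕, ∃ φ : Sym2 (Fin k) → Fin m, ∀ e ∈ s, edgeOk Q e φ = true) :
    ∃ ρ > 0, ∀ {Y : Type} [Fintype Y] (ν : Y → ℝ) (B : Y → Y → Y → Bool), IsProb ν →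
      D ≤ triDensity ν ν ν (fun x y z => bi (B x y z)) →
      ∃ s ∈ 𝓕, ρ ≤ pexp (fun _ : Sym2 (Fin k) => ν) (fun t => ∏ e ∈ s, bi (edgeOk B e t)) := by
  classical
  set T : ℕ := (𝓕 ×ˢ (Finset.univ : Finset (Sym2 (Fin k) → Fin m))).card with hT
  refine ⟨(δ / (T + 1)) ^ (2 ^ Fintype.card (Sym2 (Fin k))), by positivity, ?_⟩
  intro Y _ ν B hν hS
  set S := triDensity ν ν ν (fun x y z => bi (B x y z)) with hSdef
  have hS1 : S ≤ 1 := triDensity_le_one hν hν hν fun _ _ _ => bi_le_one _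
  have hprob : ∀ w : Fin m, IsProb ((fun _ : Fin m => ν) w) := fun _ => hν
  let Q : (Fin m → Y) → Fin m → Fin m → Fin m → Bool := fun t a b c =>
    decide (a ≠ b ∧ a ≠ c ∧ b ≠ c) && B (t a) (t b) (t c)
  let Z : (Fin m → Y) → ℝ := fun t => ∑ a, ∑ b, ∑ c, bi (Q t a b c)
  have hm0 : (0 : ℝ) < m := by exact_mod_cast hm
  have hEZ : (D - δ) * m ^ 3 ≤ pexp (fun _ : Fin m => ν) Z := by
    have e1 : pexp (fun _ : Fin m => ν) Z
        = (∑ a : Fin m, ∑ b : Fin m, ∑ c : Fin m,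
          if a ≠ b ∧ a ≠ c ∧ b ≠ c then (1 : ℝ) else 0) * S := by
      simp only [Z, pexp_sum, Finset.sum_mul]
      refine Finset.sum_congr rfl fun a _ => Finset.sum_congr rfl fun b _ =>
        Finset.sum_congr rfl fun c _ => ?_
      by_cases h : a ≠ b ∧ a ≠ c ∧ b ≠ c
      · simp only [Q, h, and_self, decide_true, Bool.true_and, ne_eq, not_false_eq_true, if_true,
          one_mul]
        exact pexp_triple hprob h.1 h.2.1 h.2.2 (fun x y z => bi (B x y z))
      · simp only [Q, h, decide_false, Bool.false_and, if_false, zero_mul]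
        exact pexp_const hprob 0
    have h2 := card_distinct_triples_ge m
    have hS0 : 0 ≤ S := by linarith
    have h3 : 3 * (m : ℝ) ^ 2 ≤ δ * m ^ 3 := by
      rw [div_le_iff₀ hm0] at hmδ
      nlinarith [sq_nonneg (m : ℝ)]
    rw [e1]
    refine le_trans ?_ (mul_le_mul_of_nonneg_right h2 hS0)
    have h4 : 3 * (m : ℝ) ^ 2 * S ≤ δ * m ^ 3 := by nlinarith [sq_nonneg (m : ℝ)]
    have h5 : D * (m : ℝ) ^ 3 ≤ S * m ^ 3 := mul_le_mul_of_nonneg_right hS (by positivity)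
    linarith
  have hZ1 : ∀ t, Z t ≤ m ^ 3 := by
    intro t
    calc Z t ≤ ∑ a : Fin m, ∑ b : Fin m, ∑ c : Fin m, (1 : ℝ) :=
          Finset.sum_le_sum fun a _ => Finset.sum_le_sum fun b _ =>
            Finset.sum_le_sum fun c _ => bi_le_one _
      _ = m ^ 3 := by simp; ring
  let val : Finset (Fin k × Fin k × Fin k) × (Sym2 (Fin k) → Fin m) → (Fin m → Y) → ℝ :=
    fun q t => if ∀ e ∈ q.1, Set.InjOn q.2 (pairsOf e) then
      ∏ e ∈ q.1, bi (edgeOk B e (t ∘ q.2)) else 0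
  have hval0 : ∀ q t, 0 ≤ val q t := by
    intro q t
    simp only [val]
    split_ifs
    · exact Finset.prod_nonneg fun _ _ => bi_nonneg _
    · exact le_rfl
  have hZle : ∀ t, Z t ≤ (D - 2 * δ) * m ^ 3 + m ^ 3 * ∑ q ∈ 𝓕 ×ˢ Finset.univ, val q t := by
    intro t
    have hm3 : (0 : ℝ) < m ^ 3 := by positivity
    have hD3 : 0 ≤ (D - 2 * δ) * (m : ℝ) ^ 3 := mul_nonneg (by linarith) hm3.le
    by_cases h : (D - 2 * δ) * m ^ 3 ≤ Z t
    · obtain ⟨s, hs, φ, hφ⟩ := hadm (Q t) h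
      have hinj : ∀ e ∈ s, Set.InjOn φ (pairsOf e) := by
        intro e he
        have := hφ e he
        simp only [edgeOk, Q, Bool.and_eq_true, decide_eq_true_eq] at this
        obtain ⟨⟨h1, h2, h3⟩, -⟩ := this
        intro p hp p' hp' hpp
        simp only [pairsOf, Finset.coe_insert, Finset.coe_singleton, Set.mem_insert_iff,
          Set.mem_singleton_iff] at hp hp'
        rcases hp with rfl | rfl | rfl <;> rcases hp' with rfl | rfl | rfl <;>
          first | rfl | exact absurd hpp ‹_› | exact absurd hpp.symm ‹_›
      have h1 : val (s, φ) t = 1 := by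
        simp only [val]
        rw [if_pos hinj]
        refine Finset.prod_eq_one fun e he => ?_
        have := hφ e he
        simp only [edgeOk, Q, Bool.and_eq_true, decide_eq_true_eq] at this
        simp [edgeOk, bi, this.2]
      have h2 : (1 : ℝ) ≤ ∑ q ∈ 𝓕 ×ˢ Finset.univ, val q t := by
        rw [← h1]
        exact Finset.single_le_sum (f := fun q => val q t) (fun q _ => hval0 q t)
          (Finset.mem_product.2 ⟨hs, Finset.mem_univ _⟩)
      nlinarith [hZ1 t]
    · have : 0 ≤ ∑ q ∈ 𝓕 ×ˢ Finset.univ, val q t := Finset.sum_nonneg fun q _ => hval0 q t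
      push Not at h
      nlinarith
  have hsum : δ ≤ ∑ q ∈ 𝓕 ×ˢ Finset.univ, pexp (fun _ : Fin m => ν) (val q) := by
    have h1 := hEZ.trans (pexp_mono hprob hZle)
    rw [pexp_add, pexp_const hprob, pexp_const_mul, pexp_sum] at h1
    have hm3 : (0 : ℝ) < m ^ 3 := by positivity
    by_contra! h
    nlinarith
  obtain ⟨⟨s, φ⟩, hq, hle⟩ : ∃ q ∈ 𝓕 ×ˢ Finset.univ,
      δ / (T + 1) ≤ pexp (fun _ : Fin m => ν) (val q) := by
    by_contra! h
    have h1 : ∑ q ∈ 𝓕 ×ˢ Finset.univ, pexp (fun _ : Fin m => ν) (val q) ≤ T * (δ / (T + 1)) := by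
      rw [hT, ← nsmul_eq_mul]
      exact Finset.sum_le_card_nsmul _ _ _ fun q hq => (h q hq).le
    have h2 : T * (δ / (T + 1)) < δ := by
      rw [mul_div_assoc', div_lt_iff₀ (by positivity)]
      nlinarith
    linarith
  have hinj : ∀ e ∈ s, Set.InjOn φ (pairsOf e) := by
    by_contra hn
    have hv : val (s, φ) = fun _ => 0 := by
      funext t
      simp only [val]
      rw [if_neg hn]
    rw [hv, pexp_const hprob] at hle
    have : 0 < δ / (T + 1) := by positivity
    linarith
  have hv : val (s, φ) = fun t => ∏ e ∈ s, bi (edgeOk B e (t ∘ φ)) := by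
    funext t
    simp only [val]
    rw [if_pos hinj]
  rw [hv] at hle
  refine ⟨s, (Finset.mem_product.1 hq).1, ?_⟩
  exact (pow_le_pow_left₀ (by positivity) hle _).trans (pow_pexp_prod_edgeOk_le hν B s hinj)

end Sampling

section Push

variable {X Y : Type} [Fintype X] [DecidableEq Y]

/-- The distribution of a name function. -/
noncomputable def push (μ : X → ℝ) (N : X → Y) (y : Y) : ℝ := ∑ x with N x = y, μ x

lemma sum_push_mul [Fintype Y] (μ : X → ℝ) (N : X → Y) (g : Y → ℝ) :
    ∑ y, push μ N y * g y = ∑ x, μ x * g (N x) := by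
  classical
  rw [← Finset.sum_fiberwise (s := Finset.univ) (g := N)]
  refine Finset.sum_congr rfl fun y _ => ?_
  rw [push, Finset.sum_mul]
  refine Finset.sum_congr rfl fun x hx => ?_
  rw [(Finset.mem_filter.1 hx).2]

lemma IsProb.push [Fintype Y] {μ : X → ℝ} (hμ : IsProb μ) (N : X → Y) : IsProb (push μ N) := by
  refine ⟨fun y => Finset.sum_nonneg fun x _ => hμ.1 x, ?_⟩
  simpa [hμ.2] using sum_push_mul μ N (fun _ => 1)

lemma sum_push_mul_fibAvg [Fintype Y] {μ : X → ℝ} (hμ : ∀ x, 0 ≤ μ x) (N : X → Y) (g : X → ℝ) :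
    ∑ y, push μ N y * fibAvg μ N g y = ∑ x, μ x * g x := by
  rw [sum_push_mul]
  exact sum_cexp hμ

lemma sum_mul_fibAvg {Z : Type} [Fintype Z] (μ : X → ℝ) (N : X → Y) (c : Z → ℝ) (g : Z → X → ℝ)
    (y : Y) : ∑ z, c z * fibAvg μ N (g z) y = fibAvg μ N (fun x => ∑ z, c z * g z x) y := by
  simp only [fibAvg, Finset.mul_sum, ← mul_div_assoc]
  rw [← Finset.sum_div, Finset.sum_comm]
  congr 1
  exact Finset.sum_congr rfl fun x _ => Finset.sum_congr rfl fun z _ => by ring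

/-- The average of a ternary relation over a cell of names. -/
noncomputable def cellAvg (A : X → X → X → Bool) (m₁ m₂ m₃ : X → ℝ) (n₁ n₂ n₃ : X → Y)
    (y₁ y₂ y₃ : Y) : ℝ :=
  fibAvg m₁ n₁ (fun α => fibAvg m₂ n₂ (fun β => fibAvg m₃ n₃ (fun γ => bi (A α β γ)) y₃) y₂) y₁

lemma triDensity_cellAvg [Fintype Y] {A : X → X → X → Bool} {m₁ m₂ m₃ : X → ℝ}
    (h₁ : IsProb m₁) (h₂ : IsProb m₂) (h₃ : IsProb m₃) (n₁ n₂ n₃ : X → Y) :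
    triDensity (push m₁ n₁) (push m₂ n₂) (push m₃ n₃) (cellAvg A m₁ m₂ m₃ n₁ n₂ n₃)
      = triDensity m₁ m₂ m₃ (fun α β γ => bi (A α β γ)) := by
  simp only [triDensity, cellAvg, sum_mul_fibAvg]
  rw [sum_push_mul_fibAvg h₁.1]
  refine Finset.sum_congr rfl fun x _ => ?_
  rw [sum_push_mul_fibAvg h₂.1]
  congr 1
  refine Finset.sum_congr rfl fun y _ => ?_
  rw [sum_push_mul_fibAvg h₃.1]

end Push

lemma triDensity_mono {Y : Type} [Fintype Y] {m₁ m₂ m₃ : Y → ℝ}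
    (h₁ : IsProb m₁) (h₂ : IsProb m₂) (h₃ : IsProb m₃) {f g : Y → Y → Y → ℝ}
    (h : ∀ x y z, f x y z ≤ g x y z) : triDensity m₁ m₂ m₃ f ≤ triDensity m₁ m₂ m₃ g :=
  Finset.sum_le_sum fun x _ => mul_le_mul_of_nonneg_left (Finset.sum_le_sum fun y _ =>
    mul_le_mul_of_nonneg_left (Finset.sum_le_sum fun z _ =>
      mul_le_mul_of_nonneg_left (h x y z) (h₃.1 z)) (h₂.1 y)) (h₁.1 x)

lemma triDensity_add_const {Y : Type} [Fintype Y] {m₁ m₂ m₃ : Y → ℝ}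
    (h₁ : IsProb m₁) (h₂ : IsProb m₂) (h₃ : IsProb m₃) (f : Y → Y → Y → ℝ) (c : ℝ) :
    triDensity m₁ m₂ m₃ (fun x y z => f x y z + c) = triDensity m₁ m₂ m₃ f + c := by
  simp only [triDensity, mul_add, Finset.sum_add_distrib, ← Finset.sum_mul, h₁.2, h₂.2, h₃.2,
    one_mul]

lemma abs_triDensity_sub_le {Y : Type} [Fintype Y] {m₁ m₂ m₃ ν : Y → ℝ}
    (h₁ : IsProb m₁) (h₂ : IsProb m₂) (h₃ : IsProb m₃) (hν : IsProb ν) {f : Y → Y → Y → ℝ}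
    (hf : ∀ x y z, |f x y z| ≤ 1) {ζ : ℝ} (d₁ : ∑ y, |m₁ y - ν y| ≤ ζ) (d₂ : ∑ y, |m₂ y - ν y| ≤ ζ)
    (d₃ : ∑ y, |m₃ y - ν y| ≤ ζ) :
    |triDensity m₁ m₂ m₃ f - triDensity ν ν ν f| ≤ 3 * ζ := by
  have hm : ∀ i, IsProb ((![m₁, m₂, m₃] : Fin 3 → Y → ℝ) i) := by
    intro i; fin_cases i <;> assumption
  have e1 := pexp_triple (W := Fin 3) hm (a := 0) (b := 1) (c := 2) (by decide) (by decide)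
    (by decide) f
  have e2 := pexp_triple (W := Fin 3) (ν := fun _ => ν) (fun _ => hν) (a := 0) (b := 1) (c := 2)
    (by decide) (by decide) (by decide) f
  have h := abs_pexp_sub_le (I := Fin 3) (μ := fun _ => ν) (μ' := ![m₁, m₂, m₃]) (fun _ => hν) hm
    (f := fun t => f (t 0) (t 1) (t 2)) (fun t => hf _ _ _)
  rw [e1, e2] at h
  refine h.trans ?_
  simp only [Fin.sum_univ_three]
  exact (add_le_add (add_le_add d₁ d₂) d₃).trans_eq (by ring)

lemma edgeAvg_eq_cellAvg {k : ℕ} {C κ : Type} [Fintype C] [DecidableEq κ]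
    (A : C → C → C → Bool) (μ : Sym2 (Fin k) → C → ℝ) (n : Sym2 (Fin k) → C → κ)
    {e : Fin k × Fin k × Fin k} (he : e.1 < e.2.1 ∧ e.2.1 < e.2.2) (ω : Sym2 (Fin k) → C) :
    edgeAvg A μ n e ω = cellAvg A (μ s(e.1, e.2.1)) (μ s(e.1, e.2.2)) (μ s(e.2.1, e.2.2))
      (n s(e.1, e.2.1)) (n s(e.1, e.2.2)) (n s(e.2.1, e.2.2))
      (n s(e.1, e.2.1) (ω s(e.1, e.2.1))) (n s(e.1, e.2.2) (ω s(e.1, e.2.2)))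
      (n s(e.2.1, e.2.2) (ω s(e.2.1, e.2.2))) := by
  obtain ⟨a, b, c⟩ := e
  obtain ⟨h1, h2⟩ := he
  simp only at h1 h2
  have hab : a ≠ b := h1.ne
  have hbc : b ≠ c := h2.ne
  have hac : a ≠ c := (h1.trans h2).ne
  have e1 : s(a, b) ≠ s(a, c) := by simp; tauto
  have e2 : s(a, b) ≠ s(b, c) := by simp; tauto
  have e3 : s(a, c) ≠ s(b, c) := by simp; tauto
  simp [edgeAvg, favg, cexp, cellAvg, edgeOk, Function.update_of_ne, e1, e2, e3, e1.symm, e2.symm,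
    e3.symm]

lemma exists_homogeneous_triple (κ : Type) [Finite κ] (R : ℕ) :
    ∃ M, ∀ I : Finset ℕ, M ≤ I.card → ∀ χ : ℕ → ℕ → ℕ → κ,
      ∃ J ⊆ I, J.card = R ∧ ∃ a, ∀ i ∈ J, ∀ j ∈ J, ∀ l ∈ J, i < j → j < l → χ i j l = a := by
  classical
  obtain ⟨M, hM⟩ := exists_homogeneous κ 3 R
  refine ⟨M, fun I hI χ => ?_⟩
  let good : Finset ℕ → ℕ × ℕ × ℕ → Prop := fun T p =>
    p.1 < p.2.1 ∧ p.2.1 < p.2.2 ∧ T = {p.1, p.2.1, p.2.2}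
  let χ' : Finset ℕ → κ := fun T =>
    if h : ∃ p, good T p then χ h.choose.1 h.choose.2.1 h.choose.2.2 else χ 0 0 0
  obtain ⟨J, hJ, hJR, a, ha⟩ := hM I hI χ'
  refine ⟨J, hJ, hJR, a, fun i hi j hj l hl hij hjl => ?_⟩
  have hT := ha {i, j, l} (by intro x; simp; rintro (rfl | rfl | rfl) <;> assumption)
    (by rw [Finset.card_eq_three]; exact ⟨i, j, l, hij.ne, (hij.trans hjl).ne, hjl.ne, rfl⟩)
  have hex : ∃ p, good {i, j, l} p := ⟨(i, j, l), hij, hjl, rfl⟩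
  simp only [χ', hex, dif_pos] at hT
  obtain ⟨h1, h2, h3⟩ := hex.choose_spec
  generalize hex.choose = p at *
  obtain ⟨i', j', l'⟩ := p
  simp only at h1 h2 h3 hT
  have m1 : i ∈ ({i', j', l'} : Finset ℕ) := h3 ▸ by simp
  have m2 : j ∈ ({i', j', l'} : Finset ℕ) := h3 ▸ by simp
  have m3 : l ∈ ({i', j', l'} : Finset ℕ) := h3 ▸ by simp
  simp only [Finset.mem_insert, Finset.mem_singleton] at m1 m2 m3
  obtain ⟨rfl, rfl, rfl⟩ : i = i' ∧ j = j' ∧ l = l' := by omega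
  exact hT

/-- Rounding of the values of a function to a grid of mesh `1 / L`. -/
noncomputable def gridRound {Y : Type} (L : ℕ) (m : Y → ℝ) (y : Y) : Fin (L + 1) :=
  ⟨min L ⌊m y * L⌋₊, by omega⟩

lemma sum_abs_sub_le_of_gridRound_eq {Y : Type} [Fintype Y] {L : ℕ} (hL : 0 < L) {m m' : Y → ℝ}
    (hm : IsProb m) (hm' : IsProb m') (h : gridRound L m = gridRound L m') :
    ∑ y, |m y - m' y| ≤ Fintype.card Y / L := by
  have hL' : (0 : ℝ) < L := by exact_mod_cast hL
  have hfl : ∀ {ν : Y → ℝ}, IsProb ν → ∀ y, ⌊ν y * L⌋₊ ≤ L := by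
    intro ν hν y
    have h1 : ν y ≤ 1 := by
      rw [← hν.2]; exact Finset.single_le_sum (fun x _ => hν.1 x) (Finset.mem_univ y)
    exact Nat.floor_le_of_le (mul_le_of_le_one_left hL'.le h1)
  have key : ∀ y, |m y - m' y| ≤ 1 / L := by
    intro y
    have h0 := congrArg Fin.val (congrFun h y)
    simp only [gridRound, min_eq_right (hfl hm y), min_eq_right (hfl hm' y)] at h0
    have a1 := Nat.floor_le (mul_nonneg (hm.1 y) hL'.le)
    have a2 := Nat.lt_floor_add_one (m y * L)
    have b1 := Nat.floor_le (mul_nonneg (hm'.1 y) hL'.le)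
    have b2 := Nat.lt_floor_add_one (m' y * L)
    rw [h0] at a1 a2
    rw [le_div_iff₀ hL', ← abs_of_pos hL', ← abs_mul, abs_le]
    constructor <;> nlinarith
  calc _ ≤ ∑ _y : Y, 1 / (L : ℝ) := Finset.sum_le_sum fun y _ => key y
    _ = _ := by simp [div_eq_mul_inv]

lemma fibAvg_le_one {X Y : Type} [Fintype X] [DecidableEq Y] {μ : X → ℝ} (hμ : ∀ x, 0 ≤ μ x)
    {g : X → ℝ} (hg : ∀ x, g x ≤ 1) (N : X → Y) (y : Y) : fibAvg μ N g y ≤ 1 :=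
  div_le_one_of_le₀ (Finset.sum_le_sum fun x _ => mul_le_of_le_one_right (hμ x) (hg x))
    (Finset.sum_nonneg fun x _ => hμ x)

lemma cellAvg_le_one {X Y : Type} [Fintype X] [DecidableEq Y] {A : X → X → X → Bool}
    {m₁ m₂ m₃ : X → ℝ} (h₁ : ∀ x, 0 ≤ m₁ x) (h₂ : ∀ x, 0 ≤ m₂ x) (h₃ : ∀ x, 0 ≤ m₃ x)
    (n₁ n₂ n₃ : X → Y) (y₁ y₂ y₃ : Y) : cellAvg A m₁ m₂ m₃ n₁ n₂ n₃ y₁ y₂ y₃ ≤ 1 :=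
  fibAvg_le_one h₁ (fun _ => fibAvg_le_one h₂ (fun _ => fibAvg_le_one h₃ (fun _ => bi_le_one _)
    _ _) _ _) _ _

/-- A reduced structure on sufficiently many indices all of whose triples are dense contains, with
density bounded below, a member of any family `𝓕` that is admissible for all dense palettes. -/
theorem exists_dense_in_reduced {k m : ℕ} (𝓕 : Finset (Finset (Fin k × Fin k × Fin k)))
    (h𝓕 : ∀ s ∈ 𝓕, ∀ e ∈ s, e.1 < e.2.1 ∧ e.2.1 < e.2.2)
    {D δ : ℝ} (hδ : 0 < δ) (hδ1 : δ ≤ 1) (hD : 2 * δ ≤ D) (hm : 0 < m) (hmδ : 3 / m ≤ δ)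
    (hadm : ∀ Q : Fin m → Fin m → Fin m → Bool,
      (D - 2 * δ) * m ^ 3 ≤ ∑ a, ∑ b, ∑ c, bi (Q a b c) →
      ∃ s ∈ 𝓕, ∃ φ : Sym2 (Fin k) → Fin m, ∀ e ∈ s, edgeOk Q e φ = true) :
    ∃ ρ > 0, ∃ M₀ : ℕ, ∀ {C : Type} [Fintype C] (A : C → C → C → Bool) (μ : Sym2 ℕ → C → ℝ),
      (∀ p, IsProb (μ p)) → ∀ I : Finset ℕ, M₀ ≤ I.card →
      (∀ i ∈ I, ∀ j ∈ I, ∀ l ∈ I, i < j → j < l →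
        D + 2 * δ ≤ triDensity (μ s(i, j)) (μ s(i, l)) (μ s(j, l))
          (fun α β γ => bi (A α β γ))) →
      ∃ F : Fin k → ℕ, StrictMono F ∧ (∀ x, F x ∈ I) ∧ ∃ s ∈ 𝓕,
        ρ ≤ pexp (fun p : Sym2 (Fin k) => μ (p.map F))
          (fun ω => ∏ e ∈ s, bi (edgeOk A e ω)) := by
  classical
  obtain ⟨ρ₁, hρ₁, hρ⟩ := exists_pexp_ge_of_admissible 𝓕 hδ hD hm hmδ hadm
  set E₀ : ℕ := Fintype.card (Fin k × Fin k × Fin k) with hE₀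
  set P₀ : ℕ := Fintype.card (Sym2 (Fin k)) with hP₀
  set θ : ℝ := δ ^ E₀ * ρ₁ with hθ
  have hθ0 : 0 < θ := by positivity
  set γ : ℝ := (θ / (12 * (E₀ + 1))) ^ 2 with hγ
  have hγ0 : 0 < γ := by positivity
  have hsq : √γ = θ / (12 * (E₀ + 1)) := by rw [hγ]; exact Real.sqrt_sq (by positivity)
  set ζ : ℝ := min (δ / 3) (ρ₁ / (2 * (P₀ + 1))) with hζ
  have hζ0 : 0 < ζ := by positivity
  let L : ℕ → ℕ := fun K => ⌈(K : ℝ) / ζ⌉₊ + 1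
  have hL : ∀ K : ℕ, (K : ℝ) / L K ≤ ζ := by
    intro K
    have h1 : (K : ℝ) / ζ ≤ L K := (Nat.le_ceil _).trans (by simp [L])
    have h2 : (0 : ℝ) < L K := by positivity
    rw [div_le_iff₀ h2]
    rw [div_le_iff₀ hζ0] at h1
    linarith
  choose R hR using fun K : ℕ => exists_homogeneous_triple
    ((Fin K → Fin K → Fin K → Bool) × (Fin K → Fin (L K + 1))) (k + 4)
  obtain ⟨M₀, hM₀⟩ := exists_smallGaps k hγ0 R
  refine ⟨θ / 4, by positivity, M₀, ?_⟩
  intro C _ A μ hμ I hI hdense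
  obtain ⟨K, n, J, hJI, hJ, hgap⟩ := hM₀ A μ hμ I hI
  let cell : ℕ → ℕ → ℕ → Fin K → Fin K → Fin K → ℝ := fun i j l =>
    cellAvg A (μ s(i, j)) (μ s(i, l)) (μ s(j, l)) (n s(i, j)) (n s(i, l)) (n s(j, l))
  let mh : Sym2 ℕ → Fin K → ℝ := fun p => push (μ p) (n p)
  have hmh : ∀ p, IsProb (mh p) := fun p => (hμ p).push _
  obtain ⟨J', hJ', hJ'c, ⟨Q, r⟩, hcol⟩ := hR K J hJ fun i j l =>
    (fun y₁ y₂ y₃ => decide (δ ≤ cell i j l y₁ y₂ y₃), gridRound (L K) (mh s(i, j)))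
  obtain ⟨f, hf, hfJ⟩ := exists_strictMono_mem J'
  have hfm : ∀ t < k + 4, f t ∈ J' := fun t ht => hfJ t (by omega)
  have hQ : ∀ i ∈ J', ∀ j ∈ J', ∀ l ∈ J', i < j → j < l → ∀ y₁ y₂ y₃,
      Q y₁ y₂ y₃ = decide (δ ≤ cell i j l y₁ y₂ y₃) := by
    intro i hi j hj l hl hij hjl y₁ y₂ y₃
    have h : _ = Q := (Prod.ext_iff.1 (hcol i hi j hj l hl hij hjl)).1
    rw [← h]
  have hr : ∀ a b, a < b → b < k + 3 → gridRound (L K) (mh s(f a, f b)) = r := by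
    intro a b hab hb
    exact (Prod.ext_iff.1 (hcol _ (hfm a (by omega)) _ (hfm b (by omega)) _
      (hfm (k + 3) (by omega)) (hf hab) (hf hb))).2
  set ν : Fin K → ℝ := mh s(f 0, f 1) with hνdef
  have hν : IsProb ν := hmh _
  have hclose : ∀ a b, a < b → b < k + 3 → ∑ y, |mh s(f a, f b) y - ν y| ≤ ζ := by
    intro a b hab hb
    have h := sum_abs_sub_le_of_gridRound_eq (L := L K) (by simp [L]) (hmh s(f a, f b)) hν
      ((hr a b hab hb).trans (hr 0 1 (by omega) (by omega)).symm)
    rw [Fintype.card_fin] at h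
    exact h.trans (hL K)
  have hdν : D ≤ triDensity ν ν ν (fun x y z => bi (Q x y z)) := by
    have m0 := hfm 0 (by omega)
    have m1 := hfm 1 (by omega)
    have m2 := hfm 2 (by omega)
    have l01 : f 0 < f 1 := hf (by omega)
    have l12 : f 1 < f 2 := hf (by omega)
    have h1 := hdense _ (hJI (hJ' m0)) _ (hJI (hJ' m1)) _ (hJI (hJ' m2)) l01 l12
    rw [← triDensity_cellAvg (hμ _) (hμ _) (hμ _) (n s(f 0, f 1)) (n s(f 0, f 2))
      (n s(f 1, f 2))] at h1
    have h2 : triDensity (mh s(f 0, f 1)) (mh s(f 0, f 2)) (mh s(f 1, f 2)) (cell (f 0) (f 1) (f 2))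
        ≤ triDensity (mh s(f 0, f 1)) (mh s(f 0, f 2)) (mh s(f 1, f 2))
          (fun x y z => bi (Q x y z) + δ) := by
      refine triDensity_mono (hmh _) (hmh _) (hmh _) fun x y z => ?_
      rw [hQ _ m0 _ m1 _ m2 l01 l12]
      by_cases hc : δ ≤ cell (f 0) (f 1) (f 2) x y z
      · have : cell (f 0) (f 1) (f 2) x y z ≤ 1 := by
          exact cellAvg_le_one (hμ _).1 (hμ _).1 (hμ _).1 _ _ _ _ _ _
        simp only [hc, decide_true, bi]
        simp
        linarith
      · simp only [hc, decide_false, bi]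
        simp
        linarith
    rw [triDensity_add_const (hmh _) (hmh _) (hmh _)] at h2
    have h3 := abs_triDensity_sub_le (hmh s(f 0, f 1)) (hmh s(f 0, f 2)) (hmh s(f 1, f 2)) hν
      (f := fun x y z => bi (Q x y z))
      (fun x y z => by rw [abs_of_nonneg (bi_nonneg _)]; exact bi_le_one _)
      (hclose 0 1 (by omega) (by omega)) (hclose 0 2 (by omega) (by omega))
      (hclose 1 2 (by omega) (by omega))
    have h4 := (abs_le.1 h3).2
    have h5 : ζ ≤ δ / 3 := min_le_left _ _
    have h1' : D + 2 * δ ≤ triDensity (mh s(f 0, f 1)) (mh s(f 0, f 2)) (mh s(f 1, f 2))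
      (cell (f 0) (f 1) (f 2)) := h1
    linarith
  obtain ⟨s, hs, hsρ⟩ := hρ ν Q hν hdν
  let F : Fin k → ℕ := fun x => f x
  have hF : StrictMono F := fun x y h => hf h
  have hFJ' : ∀ x, F x ∈ J' := fun x => hfm x (by omega)
  refine ⟨F, hF, fun x => hJI (hJ' (hFJ' x)), s, hs, ?_⟩
  have hsc : s.card ≤ E₀ := Finset.card_le_univ s
  -- transfer from `ν` to the distributions of the names
  have hprod1 : ∀ t : Sym2 (Fin k) → Fin K, |∏ e ∈ s, bi (edgeOk Q e t)| ≤ 1 := by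
    intro t
    rw [abs_of_nonneg (Finset.prod_nonneg fun e _ => bi_nonneg _)]
    exact Finset.prod_le_one (fun e _ => bi_nonneg _) fun e _ => bi_le_one _
  let mh' : Sym2 (Fin k) → Fin K → ℝ := fun p => if p.IsDiag then ν else mh (p.map F)
  have hmh' : ∀ p, IsProb (mh' p) := by
    intro p
    by_cases hp : p.IsDiag
    · simp only [mh', hp, if_true]; exact hν
    · simp only [mh', hp, if_false]; exact hmh _
  have htr1 : ρ₁ / 2 ≤ pexp mh' (fun t => ∏ e ∈ s, bi (edgeOk Q e t)) := by
    have h := abs_pexp_sub_le (μ := fun _ => ν) (μ' := mh') (fun _ => hν) hmh' hprod1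
    have h2 : ∑ p, ∑ y, |mh' p y - ν y| ≤ P₀ * ζ := by
      calc _ ≤ ∑ _p : Sym2 (Fin k), ζ := by
            refine Finset.sum_le_sum fun p _ => ?_
            induction p using Sym2.ind with
            | _ x y =>
              rcases lt_trichotomy x y with hxy | rfl | hxy
              · have := hclose x y hxy (by omega)
                simpa [mh', hxy.ne, F] using this
              · simpa [mh'] using hζ0.le
              · have := hclose y x hxy (by omega)
                rw [Sym2.eq_swap]
                simpa [mh', hxy.ne, F] using this
        _ = _ := by simp [P₀]
    have h3 : P₀ * ζ ≤ ρ₁ / 2 := by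
      have : ζ ≤ ρ₁ / (2 * (P₀ + 1)) := min_le_right _ _
      calc P₀ * ζ ≤ (P₀ + 1) * (ρ₁ / (2 * (P₀ + 1))) := by gcongr; simp
        _ = ρ₁ / 2 := by field_simp
    have := (abs_le.1 (h.trans (h2.trans h3))).1
    linarith
  have htr2 : pexp mh' (fun t => ∏ e ∈ s, bi (edgeOk Q e t))
      = pexp (fun p : Sym2 (Fin k) => mh (p.map F)) (fun t => ∏ e ∈ s, bi (edgeOk Q e t)) := by
    refine pexp_congr_weight hmh' (fun p => hmh _) fun p hp ω x => ?_
    have hd : p.IsDiag := by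
      by_contra hd
      exact hp (by simp [mh', hd])
    refine Finset.prod_congr rfl fun e he => ?_
    have ho := h𝓕 s hs e he
    have hne : ∀ {a b : Fin k}, a < b → s(a, b) ≠ p := by
      rintro a b hab rfl
      exact hab.ne (by simpa using hd)
    simp [edgeOk, Function.update_of_ne (hne ho.1), Function.update_of_ne (hne ho.2),
      Function.update_of_ne (hne (ho.1.trans ho.2))]
  rw [htr2] at htr1
  have htr3 := pexp_map (μ := fun p : Sym2 (Fin k) => μ (p.map F)) (fun p => n (p.map F))
    (fun t => ∏ e ∈ s, bi (edgeOk Q e t))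
  have htr4 : ρ₁ / 2 ≤ pexp (fun p : Sym2 (Fin k) => μ (p.map F))
      (fun ω => ∏ e ∈ s, bi (edgeOk Q e fun p => n (p.map F) (ω p))) := by
    rw [htr3]; exact htr1
  have hlow : δ ^ E₀ * (ρ₁ / 2) ≤ pexp (fun p : Sym2 (Fin k) => μ (p.map F)) (fun ω =>
      ∏ e ∈ s, edgeAvg A (fun p => μ (p.map F)) (fun p => n (p.map F)) e ω) := by
    calc _ ≤ δ ^ E₀ * pexp (fun p : Sym2 (Fin k) => μ (p.map F))
          (fun ω => ∏ e ∈ s, bi (edgeOk Q e fun p => n (p.map F) (ω p))) := by gcongr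
      _ = pexp (fun p : Sym2 (Fin k) => μ (p.map F))
          (fun ω => δ ^ E₀ * ∏ e ∈ s, bi (edgeOk Q e fun p => n (p.map F) (ω p))) := by
        rw [pexp_const_mul]
      _ ≤ _ := by
        refine pexp_mono (fun p => hμ _) fun ω => ?_
        calc _ ≤ δ ^ s.card * ∏ e ∈ s, bi (edgeOk Q e fun p => n (p.map F) (ω p)) := by
              refine mul_le_mul_of_nonneg_right (pow_le_pow_of_le_one hδ.le hδ1 hsc)
                (Finset.prod_nonneg fun e _ => bi_nonneg _)
          _ = ∏ e ∈ s, δ * bi (edgeOk Q e fun p => n (p.map F) (ω p)) := by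
              rw [Finset.prod_mul_distrib, Finset.prod_const]
          _ ≤ _ := by
              refine Finset.prod_le_prod (fun e _ => mul_nonneg hδ.le (bi_nonneg _)) fun e he => ?_
              have ho := h𝓕 s hs e he
              have hn := edgeAvg_nonneg (A := A) (n := fun p => n (p.map F)) (e := e)
                (μ := fun p : Sym2 (Fin k) => μ (p.map F)) (fun p => hμ _) ω
              have hq := hQ _ (hFJ' e.1) _ (hFJ' e.2.1) _ (hFJ' e.2.2) (hF ho.1) (hF ho.2)
              rw [edgeAvg_eq_cellAvg _ _ _ ho] at hn ⊢
              simp only [edgeOk, hq]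
              by_cases hc : δ ≤ cell (F e.1) (F e.2.1) (F e.2.2)
                (n (s(e.1, e.2.1).map F) (ω s(e.1, e.2.1)))
                (n (s(e.1, e.2.2).map F) (ω s(e.1, e.2.2)))
                (n (s(e.2.1, e.2.2).map F) (ω s(e.2.1, e.2.2)))
              · simp only [hc, decide_true, bi]
                simpa using hc
              · simp only [hc, decide_false, bi]
                simpa using hn
  have hcount := abs_pexp_prod_edgeOk_sub_le (A := A) (μ := fun p : Sym2 (Fin k) => μ (p.map F))
    (n := fun p => n (p.map F)) (fun p => hμ _) s (h𝓕 s hs)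
    (hgap F hF fun x => hJ' (hFJ' x))
  have herr : (s.card : ℝ) * (3 * √γ) ≤ θ / 4 := by
    rw [hsq]
    calc (s.card : ℝ) * (3 * (θ / (12 * (E₀ + 1)))) ≤ (E₀ + 1) * (3 * (θ / (12 * (E₀ + 1)))) := by
          gcongr
          have : (s.card : ℝ) ≤ E₀ := by exact_mod_cast hsc
          linarith
      _ = θ / 4 := by field_simp; ring
  have := (abs_le.1 (hcount.trans herr)).1
  have hθ' : δ ^ E₀ * (ρ₁ / 2) = θ / 2 := by rw [hθ]; ring
  linarith

/-- The sign attached to a Boolean. -/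
def sg (b : Bool) : ℝ := if b then 1 else -1

lemma abs_sg (b : Bool) : |sg b| = 1 := by cases b <;> simp [sg]

/-- A bounded test function can be replaced by a sign-valued one. -/
lemma exists_sign_ge {T J : Type} [Fintype T] [DecidableEq T] [Fintype J] (c : J → ℝ) (t : J → T)
    {u : T → ℝ} (hu : ∀ x, |u x| ≤ 1) :
    ∃ σ : T → Bool, |∑ j, c j * u (t j)| ≤ |∑ j, c j * sg (σ (t j))| := by
  have key : ∀ v : T → ℝ, ∑ j, c j * v (t j) = ∑ x, push c t x * v x := fun v =>
    (sum_push_mul c t v).symm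
  refine ⟨fun x => decide (0 ≤ push c t x), ?_⟩
  rw [key u, key fun x => sg (decide (0 ≤ push c t x))]
  calc _ ≤ ∑ x, |push c t x * u x| := Finset.abs_sum_le_sum_abs _ _
    _ ≤ ∑ x, push c t x * sg (decide (0 ≤ push c t x)) := by
        refine Finset.sum_le_sum fun x _ => ?_
        rw [abs_mul]
        refine (mul_le_of_le_one_right (abs_nonneg _) (hu x)).trans ?_
        by_cases h : 0 ≤ push c t x
        · simp [sg, h, abs_of_nonneg h]
        · simp [sg, h, abs_of_neg (not_le.1 h)]
    _ ≤ _ := le_abs_self _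

section PairRegularity

variable {U : Type}

/-- The pair of names of a pair of points. -/
def name2 {κ : Type} (q : U → κ) (z : U × U) : κ × κ := (q z.1, q z.2)

/-- The indicator of a colour class of a coloured pair. -/
def ind {κ : Type} [DecidableEq κ] (P : U → U → κ) (c : κ) (z : U × U) : ℝ :=
  if P z.1 z.2 = c then 1 else 0

lemma ind_nonneg {κ : Type} [DecidableEq κ] (P : U → U → κ) (c : κ) (z : U × U) :
    0 ≤ ind P c z := by
  unfold ind; split_ifs <;> norm_num

lemma ind_le_one {κ : Type} [DecidableEq κ] (P : U → U → κ) (c : κ) (z : U × U) :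
    ind P c z ≤ 1 := by
  unfold ind; split_ifs <;> norm_num

variable [Fintype U]

/-- The product weight on pairs. -/
def wt2 (ν : U → ℝ) (z : U × U) : ℝ := ν z.1 * ν z.2

lemma IsProb.wt2 {ν : U → ℝ} (hν : IsProb ν) : IsProb (wt2 ν) := by
  refine ⟨fun z => mul_nonneg (hν.1 _) (hν.1 _), ?_⟩
  simp only [_root_.wt2]
  rw [Fintype.sum_prod_type]
  simp [← Finset.mul_sum, hν.2]

/-- The vertex partition `q` is regular for the colouring `P` of pairs. -/
def PairRegular {κ ι : Type} [DecidableEq κ] [DecidableEq ι] (ν : U → ℝ) (P : U → U → κ)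
    (q : U → ι) (η : ℝ) : Prop :=
  ∀ c, ∀ u v : U → ι → ℝ, (∀ x a, |u x a| ≤ 1) → (∀ x a, |v x a| ≤ 1) →
    |∑ z : U × U, wt2 ν z * ((ind P c z - cexp (wt2 ν) (name2 q) (ind P c) z) *
      (u z.1 (q z.2) * v z.2 (q z.1)))| ≤ η

lemma exists_energy_increment_pair {κ ι : Type} [DecidableEq κ] [Fintype κ] [DecidableEq ι]
    [Fintype ι] {ν : U → ℝ} (hν : IsProb ν) (P : U → U → κ) (q : U → ι) {η : ℝ} (hη : 0 ≤ η)
    (h : ¬ PairRegular ν P q η) :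
    ∃ q' : U → ι × (ι → Bool) × (ι → Bool),
      ∑ c, energy (wt2 ν) (name2 q) (ind P c) + η ^ 2
        ≤ ∑ c, energy (wt2 ν) (name2 q') (ind P c) := by
  classical
  simp only [PairRegular, not_forall, not_le] at h
  obtain ⟨c, u, v, hu, hv, hlt⟩ := h
  set G : U × U → ℝ := fun z =>
    wt2 ν z * (ind P c z - cexp (wt2 ν) (name2 q) (ind P c) z) with hG
  obtain ⟨σ, hσ⟩ := exists_sign_ge (T := U × ι) (fun z : U × U => G z * v z.2 (q z.1))
    (fun z => (z.1, q z.2)) (u := fun t => u t.1 t.2) (fun t => hu _ _)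
  obtain ⟨τ, hτ⟩ := exists_sign_ge (T := U × ι) (fun z : U × U => G z * sg (σ (z.1, q z.2)))
    (fun z => (z.2, q z.1)) (u := fun t => v t.1 t.2) (fun t => hv _ _)
  have e1 : ∑ z : U × U, wt2 ν z * ((ind P c z - cexp (wt2 ν) (name2 q) (ind P c) z) *
      (u z.1 (q z.2) * v z.2 (q z.1))) = ∑ z : U × U, G z * v z.2 (q z.1) * u z.1 (q z.2) :=
    Finset.sum_congr rfl fun z _ => by simp only [hG]; ring
  have e2 : ∑ z : U × U, G z * v z.2 (q z.1) * sg (σ (z.1, q z.2))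
      = ∑ z : U × U, G z * sg (σ (z.1, q z.2)) * v z.2 (q z.1) :=
    Finset.sum_congr rfl fun z _ => by ring
  rw [e1] at hlt
  rw [e2] at hσ
  have hlt' := hlt.trans_le (hσ.trans hτ)
  let q' : U → ι × (ι → Bool) × (ι → Bool) := fun x =>
    (q x, fun a => σ (x, a), fun a => τ (x, a))
  have hfac : (name2 q).FactorsThrough (name2 q') := by
    intro z w hzw
    simp only [name2, q', Prod.mk.injEq] at hzw ⊢
    exact ⟨hzw.1.1, hzw.2.1⟩
  have hmeas : (fun z : U × U => sg (σ (z.1, q z.2)) * sg (τ (z.2, q z.1))).FactorsThrough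
      (name2 q') := by
    intro z w hzw
    simp only [name2, q', Prod.mk.injEq] at hzw
    obtain ⟨⟨h1, h2, h3⟩, h4, h5, h6⟩ := hzw
    simp only [h1, h4, congrFun h2 (q w.2), congrFun h6 (q w.1)]
  have hinc := sq_sum_sub_cexp_mul_le (g := ind P c) hν.wt2.1 hν.wt2.2 hfac hmeas
    (fun z => by rw [abs_mul, abs_sg, abs_sg, one_mul])
  refine ⟨q', ?_⟩
  have e3 : ∑ z : U × U, wt2 ν z * ((ind P c z - cexp (wt2 ν) (name2 q) (ind P c) z) *
      (sg (σ (z.1, q z.2)) * sg (τ (z.2, q z.1))))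
      = ∑ z : U × U, G z * sg (σ (z.1, q z.2)) * sg (τ (z.2, q z.1)) :=
    Finset.sum_congr rfl fun z _ => by simp only [hG]; ring
  rw [e3] at hinc
  have hsq : η ^ 2 ≤ (∑ z : U × U, G z * sg (σ (z.1, q z.2)) * sg (τ (z.2, q z.1))) ^ 2 := by
    rw [← sq_abs (∑ z : U × U, G z * sg (σ (z.1, q z.2)) * sg (τ (z.2, q z.1)))]
    exact pow_le_pow_left₀ hη hlt'.le 2
  have hmono : ∀ c', energy (wt2 ν) (name2 q) (ind P c')
      + (if c' = c then η ^ 2 else 0) ≤ energy (wt2 ν) (name2 q') (ind P c') := by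
    intro c'
    by_cases hc : c' = c
    · subst hc; simp only [if_true]; linarith
    · simp only [hc, if_false, add_zero]
      exact energy_mono hν.wt2.1 hfac
  calc _ = ∑ c', (energy (wt2 ν) (name2 q) (ind P c') + if c' = c then η ^ 2 else 0) := by
        simp [Finset.sum_add_distrib]
    _ ≤ _ := Finset.sum_le_sum fun c' _ => hmono c'

end PairRegularity

lemma cexp_comp_injective {X ι κ : Type} [Fintype X] [DecidableEq ι] [DecidableEq κ] (μ : X → ℝ)
    (N : X → ι) (g : X → ℝ) {f : ι → κ} (hf : Function.Injective f) :
    cexp μ (fun x => f (N x)) g = cexp μ N g := by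
  funext x
  simp [cexp, fibAvg, hf.eq_iff]

/-- Pair regularity lemma: a colouring of pairs by boundedly many colours admits a regular vertex
partition into boundedly many parts. -/
theorem exists_pairRegular (K : ℕ) {η : ℝ} (hη : 0 < η) :
    ∃ B : ℕ, ∀ {U : Type} [Fintype U] (ν : U → ℝ), IsProb ν → ∀ P : U → U → Fin K,
      ∃ L ≤ B, ∃ q : U → Fin L, PairRegular ν P q η := by
  classical
  have step : ∀ t : ℕ, ∃ B : ℕ, ∀ {U : Type} [Fintype U] (ν : U → ℝ), IsProb ν →
      ∀ P : U → U → Fin K, (∃ L ≤ B, ∃ q : U → Fin L, PairRegular ν P q η) ∨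
        ∃ L ≤ B, ∃ q : U → Fin L, t * η ^ 2 ≤ ∑ c, energy (wt2 ν) (name2 q) (ind P c) := by
    intro t
    induction t with
    | zero =>
      refine ⟨1, fun ν hν P => Or.inr ⟨1, le_rfl, fun _ => 0, ?_⟩⟩
      simpa using Finset.sum_nonneg fun c _ => energy_nonneg hν.wt2.1
    | succ t ih =>
      obtain ⟨B, hB⟩ := ih
      refine ⟨B * (2 ^ B * 2 ^ B) + B, fun ν hν P => ?_⟩
      rcases hB ν hν P with ⟨L, hL, q, hq⟩ | ⟨L, hL, q, hq⟩
      · exact Or.inl ⟨L, hL.trans (by omega), q, hq⟩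
      · by_cases hreg : PairRegular ν P q η
        · exact Or.inl ⟨L, hL.trans (by omega), q, hreg⟩
        · obtain ⟨q', hq'⟩ := exists_energy_increment_pair hν P q hη.le hreg
          let ee := Fintype.equivFin (Fin L × (Fin L → Bool) × (Fin L → Bool))
          refine Or.inr ⟨_, ?_, fun x => ee (q' x), ?_⟩
          · simp only [Fintype.card_prod, Fintype.card_fun, Fintype.card_fin, Fintype.card_bool]
            have : 2 ^ L ≤ 2 ^ B := Nat.pow_le_pow_right (by norm_num) hL
            calc L * (2 ^ L * 2 ^ L) ≤ B * (2 ^ B * 2 ^ B) := by gcongr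
              _ ≤ _ := by omega
          · have e : ∀ c, energy (wt2 ν) (name2 fun x => ee (q' x)) (ind P c)
                = energy (wt2 ν) (name2 q') (ind P c) := by
              intro c
              have := cexp_comp_injective (wt2 ν) (name2 q') (ind P c)
                (f := Prod.map ee ee) (ee.injective.prodMap ee.injective)
              simp only [energy]
              rw [← this]
              rfl
            simp only [e]
            push_cast
            linarith
  obtain ⟨t, ht⟩ := exists_nat_gt ((K : ℝ) / η ^ 2)
  obtain ⟨B, hB⟩ := step t
  refine ⟨B, fun ν hν P => ?_⟩
  rcases hB ν hν P with h | ⟨L, hL, q, hq⟩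
  · exact h
  · exfalso
    have h1 : ∑ c, energy (wt2 ν) (name2 q) (ind P c) ≤ K := by
      calc _ ≤ ∑ _c : Fin K, (1 : ℝ) := Finset.sum_le_sum fun c _ =>
            energy_le_one hν.wt2.1 hν.wt2.2 (ind_nonneg P c) (ind_le_one P c)
        _ = K := by simp
    rw [div_lt_iff₀ (by positivity)] at ht
    linarith

section TripleRegularity

variable {U : Type}

/-- The triple of names of the pairs in a triple of points. -/
def name3 {κ : Type} (P : U → U → κ) (z : U × U × U) : κ × κ × κ :=
  (P z.1 z.2.1, P z.1 z.2.2, P z.2.1 z.2.2)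

variable [Fintype U]

/-- The product weight on triples. -/
def wt3 (ν : U → ℝ) (z : U × U × U) : ℝ := ν z.1 * (ν z.2.1 * ν z.2.2)

lemma IsProb.wt3 {ν : U → ℝ} (hν : IsProb ν) : IsProb (wt3 ν) := by
  refine ⟨fun z => mul_nonneg (hν.1 _) (mul_nonneg (hν.1 _) (hν.1 _)), ?_⟩
  simp only [_root_.wt3]
  rw [Fintype.sum_prod_type]
  simp_rw [Fintype.sum_prod_type, ← Finset.mul_sum, ← Finset.sum_mul, hν.2, mul_one]

/-- The difference between `h` and its average over cells is uncorrelated with products of functions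
of two variables. -/
def TripleRegular {κ : Type} [DecidableEq κ] (ν : U → ℝ) (h : U × U × U → ℝ) (P : U → U → κ)
    (η : ℝ) : Prop :=
  ∀ a b c : U → U → ℝ, (∀ x y, |a x y| ≤ 1) → (∀ x y, |b x y| ≤ 1) → (∀ x y, |c x y| ≤ 1) →
    |∑ z : U × U × U, wt3 ν z * ((h z - cexp (wt3 ν) (name3 P) h z) *
      (a z.1 z.2.1 * b z.1 z.2.2 * c z.2.1 z.2.2))| ≤ η

/-- The difference between `h` and its average over cells is uncorrelated with functions of the
names of the vertices. -/
def VertexRegular {κ ι : Type} [DecidableEq κ] (ν : U → ℝ) (h : U × U × U → ℝ) (P : U → U → κ)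
    (q : U → ι) (η : ℝ) : Prop :=
  ∀ s : ι → ι → ι → ℝ, (∀ a b c, |s a b c| ≤ 1) →
    |∑ z : U × U × U, wt3 ν z * ((h z - cexp (wt3 ν) (name3 P) h z) *
      s (q z.1) (q z.2.1) (q z.2.2))| ≤ η

set_option synthInstance.maxSize 1024 in
lemma exists_energy_increment_triple {κ ι : Type} [DecidableEq κ] [DecidableEq ι]
    {ν : U → ℝ} (hν : IsProb ν) (h : U × U × U → ℝ)
    (P : U → U → κ) (q : U → ι) {η : ℝ} (hη : 0 ≤ η)
    (hnot : ¬ (TripleRegular ν h P η ∧ VertexRegular ν h P q η)) :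
    ∃ P' : U → U → κ × (ι × ι) × (Bool × Bool × Bool),
      energy (wt3 ν) (name3 P) h + η ^ 2 ≤ energy (wt3 ν) (name3 P') h := by
  classical
  suffices H : ∃ P' : U → U → κ × (ι × ι) × (Bool × Bool × Bool),
      (name3 P).FactorsThrough (name3 P') ∧ ∃ u : U × U × U → ℝ, u.FactorsThrough (name3 P') ∧
        (∀ z, |u z| ≤ 1) ∧
        η ≤ |∑ z : U × U × U, wt3 ν z * ((h z - cexp (wt3 ν) (name3 P) h z) * u z)| by
    obtain ⟨P', hP', u, hu, hu1, hle⟩ := H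
    refine ⟨P', ?_⟩
    have h1 := sq_sum_sub_cexp_mul_le (g := h) hν.wt3.1 hν.wt3.2 hP' hu hu1
    have h2 := pow_le_pow_left₀ hη hle 2
    rw [sq_abs] at h2
    linarith
  rw [not_and_or] at hnot
  rcases hnot with hnot | hnot
  · simp only [TripleRegular, not_forall, not_le] at hnot
    obtain ⟨a, b, c, ha, hb, hc, hlt⟩ := hnot
    set G : U × U × U → ℝ := fun z => wt3 ν z * (h z - cexp (wt3 ν) (name3 P) h z) with hG
    obtain ⟨σ, hσ⟩ := exists_sign_ge (T := U × U)
      (fun z : U × U × U => G z * b z.1 z.2.2 * c z.2.1 z.2.2)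
      (fun z => (z.1, z.2.1)) (u := fun t => a t.1 t.2) (fun t => ha _ _)
    obtain ⟨τ, hτ⟩ := exists_sign_ge (T := U × U)
      (fun z : U × U × U => G z * sg (σ (z.1, z.2.1)) * c z.2.1 z.2.2)
      (fun z => (z.1, z.2.2)) (u := fun t => b t.1 t.2) (fun t => hb _ _)
    obtain ⟨υ, hυ⟩ := exists_sign_ge (T := U × U)
      (fun z : U × U × U => G z * sg (σ (z.1, z.2.1)) * sg (τ (z.1, z.2.2)))
      (fun z => (z.2.1, z.2.2)) (u := fun t => c t.1 t.2) (fun t => hc _ _)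
    refine ⟨fun x y => (P x y, (q x, q y), σ (x, y), τ (x, y), υ (x, y)), ?_,
      fun z => sg (σ (z.1, z.2.1)) * sg (τ (z.1, z.2.2)) * sg (υ (z.2.1, z.2.2)), ?_, ?_, ?_⟩
    · intro z w hzw
      simp only [name3, Prod.mk.injEq] at hzw ⊢
      exact ⟨hzw.1.1, hzw.2.1.1, hzw.2.2.1⟩
    · intro z w hzw
      simp only [name3, Prod.mk.injEq] at hzw
      simp only [hzw.1.2.2.1, hzw.2.1.2.2.2.1, hzw.2.2.2.2.2.2]
    · intro z
      simp [abs_mul, abs_sg]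
    · have e1 : ∑ z : U × U × U, wt3 ν z * ((h z - cexp (wt3 ν) (name3 P) h z) *
          (a z.1 z.2.1 * b z.1 z.2.2 * c z.2.1 z.2.2))
          = ∑ z : U × U × U, G z * b z.1 z.2.2 * c z.2.1 z.2.2 * a z.1 z.2.1 :=
        Finset.sum_congr rfl fun z _ => by simp only [hG]; ring
      have e2 : ∑ z : U × U × U, G z * b z.1 z.2.2 * c z.2.1 z.2.2 * sg (σ (z.1, z.2.1))
          = ∑ z : U × U × U, G z * sg (σ (z.1, z.2.1)) * c z.2.1 z.2.2 * b z.1 z.2.2 :=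
        Finset.sum_congr rfl fun z _ => by ring
      have e3 : ∑ z : U × U × U, G z * sg (σ (z.1, z.2.1)) * c z.2.1 z.2.2 * sg (τ (z.1, z.2.2))
          = ∑ z : U × U × U, G z * sg (σ (z.1, z.2.1)) * sg (τ (z.1, z.2.2)) * c z.2.1 z.2.2 :=
        Finset.sum_congr rfl fun z _ => by ring
      have e4 : ∑ z : U × U × U, wt3 ν z * ((h z - cexp (wt3 ν) (name3 P) h z) *
          (sg (σ (z.1, z.2.1)) * sg (τ (z.1, z.2.2)) * sg (υ (z.2.1, z.2.2))))
          = ∑ z : U × U × U,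
            G z * sg (σ (z.1, z.2.1)) * sg (τ (z.1, z.2.2)) * sg (υ (z.2.1, z.2.2)) :=
        Finset.sum_congr rfl fun z _ => by simp only [hG]; ring
      rw [e1] at hlt
      rw [e2] at hσ
      rw [e3] at hτ
      rw [e4]
      exact hlt.le.trans (hσ.trans (hτ.trans hυ))
  · simp only [VertexRegular, not_forall, not_le] at hnot
    obtain ⟨s, hs, hlt⟩ := hnot
    refine ⟨fun x y => (P x y, (q x, q y), true, true, true), ?_,
      fun z => s (q z.1) (q z.2.1) (q z.2.2), ?_, fun z => hs _ _ _, hlt.le⟩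
    · intro z w hzw
      simp only [name3, Prod.mk.injEq] at hzw ⊢
      exact ⟨hzw.1.1, hzw.2.1.1, hzw.2.2.1⟩
    · intro z w hzw
      simp only [name3, Prod.mk.injEq] at hzw
      simp only [hzw.1.2.1.1, hzw.1.2.1.2, hzw.2.1.2.1.2]

end TripleRegularity

set_option synthInstance.maxSize 1024 in
/-- Regularity lemma for ternary functions: there is a bounded colouring of pairs together with a
bounded vertex partition regularising it. -/
theorem exists_tripleRegular {η₁ : ℝ} (hη₁ : 0 < η₁) (η₂ : ℕ → ℝ) (hη₂ : ∀ K, 0 < η₂ K) :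
    ∃ B : ℕ, ∀ {U : Type} [Fintype U] (ν : U → ℝ), IsProb ν → ∀ h : U × U × U → ℝ,
      (∀ z, 0 ≤ h z) → (∀ z, h z ≤ 1) →
      ∃ K ≤ B, ∃ P : U → U → Fin K, ∃ L ≤ B, ∃ q : U → Fin L,
        TripleRegular ν h P η₁ ∧ VertexRegular ν h P q η₁ ∧ PairRegular ν P q (η₂ K) := by
  classical
  choose Λ hΛ using fun K : ℕ => exists_pairRegular K (hη₂ K)
  have step : ∀ t : ℕ, ∃ B : ℕ, ∀ {U : Type} [Fintype U] (ν : U → ℝ), IsProb ν →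
      ∀ h : U × U × U → ℝ,
      (∃ K ≤ B, ∃ P : U → U → Fin K, ∃ L ≤ B, ∃ q : U → Fin L,
        TripleRegular ν h P η₁ ∧ VertexRegular ν h P q η₁ ∧ PairRegular ν P q (η₂ K)) ∨
      ∃ K ≤ B, ∃ P : U → U → Fin K, t * η₁ ^ 2 ≤ energy (wt3 ν) (name3 P) h := by
    intro t
    induction t with
    | zero =>
      refine ⟨1, fun ν hν h => Or.inr ⟨1, le_rfl, fun _ _ => 0, ?_⟩⟩
      simpa using energy_nonneg hν.wt3.1
    | succ t ih =>
      obtain ⟨B, hB⟩ := ih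
      set S : ℕ := ∑ K ∈ Finset.range (B + 1), Λ K with hS
      refine ⟨B * (S * S * 8) + B + S, fun {U} _ ν hν h => ?_⟩
      rcases hB ν hν h with ⟨K, hK, P, L, hL, q, hq⟩ | ⟨K, hK, P, hP⟩
      · exact Or.inl ⟨K, hK.trans (by omega), P, L, hL.trans (by omega), q, hq⟩
      · obtain ⟨L, hL, q, hq⟩ := hΛ K ν hν P
        have hLS : L ≤ S := hL.trans
          (Finset.single_le_sum (f := Λ) (fun _ _ => Nat.zero_le _)
            (Finset.mem_range.2 (Nat.lt_succ_of_le hK)))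
        by_cases hreg : TripleRegular ν h P η₁ ∧ VertexRegular ν h P q η₁
        · exact Or.inl ⟨K, hK.trans (by omega), P, L, hLS.trans (by omega), q, hreg.1, hreg.2, hq⟩
        · obtain ⟨P', hP'⟩ := exists_energy_increment_triple hν h P q hη₁.le hreg
          let ee := Fintype.equivFin (Fin K × (Fin L × Fin L) × (Bool × Bool × Bool))
          refine Or.inr ⟨_, ?_, fun x y => ee (P' x y), ?_⟩
          · simp only [Fintype.card_prod, Fintype.card_fin, Fintype.card_bool]
            calc K * (L * L * (2 * (2 * 2))) ≤ B * (S * S * 8) := by gcongr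
              _ ≤ _ := by omega
          · have e : energy (wt3 ν) (name3 fun x y => ee (P' x y)) h
                = energy (wt3 ν) (name3 P') h := by
              have := cexp_comp_injective (wt3 ν) (name3 P') h
                (f := Prod.map ee (Prod.map ee ee))
                (ee.injective.prodMap (ee.injective.prodMap ee.injective))
              simp only [energy]
              rw [← this]
              rfl
            rw [e]
            push_cast
            linarith
  obtain ⟨t, ht⟩ := exists_nat_gt (1 / η₁ ^ 2)
  obtain ⟨B, hB⟩ := step t
  refine ⟨B, fun ν hν h h0 h1 => ?_⟩
  rcases hB ν hν h with h | ⟨K, hK, P, hP⟩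
  · exact h
  · exfalso
    have h2 := energy_le_one (N := name3 P) hν.wt3.1 hν.wt3.2 h0 h1
    rw [div_lt_iff₀ (by positivity)] at ht
    linarith

section Counting

variable {U : Type} [Fintype U] {ν : U → ℝ}

lemma abs_pexp_triple_le {V : Type} [Fintype V] [DecidableEq V] (hν : IsProb ν)
    {G : U × U × U → ℝ} {η : ℝ}
    (hG : ∀ a b c : U → U → ℝ, (∀ x y, |a x y| ≤ 1) → (∀ x y, |b x y| ≤ 1) →
      (∀ x y, |c x y| ≤ 1) → |∑ z : U × U × U, wt3 ν z * (G z *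
        (a z.1 z.2.1 * b z.1 z.2.2 * c z.2.1 z.2.2))| ≤ η)
    {i j l : V} (hij : i ≠ j) (hil : i ≠ l) (hjl : j ≠ l) {R₁ R₂ R₃ : (V → U) → ℝ}
    (h₁ : ∀ x, |R₁ x| ≤ 1) (h₂ : ∀ x, |R₂ x| ≤ 1) (h₃ : ∀ x, |R₃ x| ≤ 1)
    (i₁ : ∀ x t, R₁ (Function.update x l t) = R₁ x) (i₂ : ∀ x t, R₂ (Function.update x j t) = R₂ x)
    (i₃ : ∀ x t, R₃ (Function.update x i t) = R₃ x) :
    |pexp (fun _ : V => ν) (fun x => G (x i, x j, x l) * (R₁ x * R₂ x * R₃ x))| ≤ η := by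
  rw [← pexp_avg l hν.2, ← pexp_avg j hν.2, ← pexp_avg i hν.2]
  refine abs_pexp_le_of_abs_le (fun _ => hν) fun x => ?_
  refine le_of_eq_of_le ?_ (hG (fun r t => R₁ (Function.update (Function.update x i r) j t))
    (fun r t => R₂ (Function.update (Function.update x i r) l t))
    (fun r t => R₃ (Function.update (Function.update x j r) l t)) (fun _ _ => h₁ _)
    (fun _ _ => h₂ _) (fun _ _ => h₃ _))
  congr 1
  rw [Fintype.sum_prod_type]
  simp_rw [Fintype.sum_prod_type, Finset.mul_sum, wt3]
  refine Finset.sum_congr rfl fun r _ => Finset.sum_congr rfl fun t _ =>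
    Finset.sum_congr rfl fun w _ => ?_
  have e2 : R₂ (Function.update (Function.update (Function.update x i r) j t) l w)
      = R₂ (Function.update (Function.update x i r) l w) := by
    rw [Function.update_comm hjl, i₂]
  have e3 : R₃ (Function.update (Function.update (Function.update x i r) j t) l w)
      = R₃ (Function.update (Function.update x j t) l w) := by
    rw [Function.update_comm hij, Function.update_comm hil, i₃]
  rw [i₁, e2, e3]
  simp only [Function.update_self, Function.update_of_ne hij, Function.update_of_ne hil,
    Function.update_of_ne hjl]
  ring

/-- The value of a ternary function at the image of an edge. -/
def edgeVal {k : ℕ} (h : U × U × U → ℝ) (e : Fin k × Fin k × Fin k) (x : Fin k → U) : ℝ :=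
  h (x e.1, x e.2.1, x e.2.2)

/-- Counting lemma: a regular function may be replaced by its cell averages. -/
theorem abs_pexp_prod_edgeVal_sub_le {k : ℕ} (hν : IsProb ν) {h p : U × U × U → ℝ} {η : ℝ}
    (hh : ∀ z, |h z| ≤ 1) (hp : ∀ z, |p z| ≤ 1)
    (hG : ∀ a b c : U → U → ℝ, (∀ x y, |a x y| ≤ 1) → (∀ x y, |b x y| ≤ 1) →
      (∀ x y, |c x y| ≤ 1) → |∑ z : U × U × U, wt3 ν z * ((h z - p z) *
        (a z.1 z.2.1 * b z.1 z.2.2 * c z.2.1 z.2.2))| ≤ η)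
    (s : Finset (Fin k × Fin k × Fin k)) (hs : ∀ e ∈ s, e.1 < e.2.1 ∧ e.2.1 < e.2.2) :
    |pexp (fun _ : Fin k => ν) (fun x => ∏ e ∈ s, edgeVal h e x)
      - pexp (fun _ : Fin k => ν) (fun x => ∏ e ∈ s, edgeVal p e x)| ≤ s.card * η := by
  classical
  refine abs_pexp_prod_sub_le s _ _ fun e he t ht => ?_
  obtain ⟨i, j, l⟩ := e
  obtain ⟨hij, hjl⟩ := hs _ he
  simp only at hij hjl
  let R : Fin k × Fin k × Fin k → (Fin k → U) → ℝ := fun e' x =>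
    if e' ∈ t then edgeVal h e' x else edgeVal p e' x
  have hR : ∀ e' x, |R e' x| ≤ 1 := by
    intro e' x
    simp only [R, edgeVal]
    split_ifs
    exacts [hh _, hp _]
  have hRi : ∀ (e' : Fin k × Fin k × Fin k) (v : Fin k), ¬ (e'.1 = v ∨ e'.2.1 = v ∨ e'.2.2 = v) →
      ∀ x r, R e' (Function.update x v r) = R e' x := by
    intro e' v hv x r
    push Not at hv
    simp only [R, edgeVal, Function.update_of_ne hv.1, Function.update_of_ne hv.2.1,
      Function.update_of_ne hv.2.2]
  let inc : Fin k → Fin k × Fin k × Fin k → Prop := fun v e' => e'.1 = v ∨ e'.2.1 = v ∨ e'.2.2 = v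
  set s' := s.erase (i, j, l) with hs'
  have hprod : ∀ (S : Finset (Fin k × Fin k × Fin k)) x, |∏ e' ∈ S, R e' x| ≤ 1 := by
    intro S x
    rw [Finset.abs_prod]
    exact Finset.prod_le_one (fun _ _ => abs_nonneg _) fun e' _ => hR e' x
  have key := abs_pexp_triple_le (V := Fin k) (ν := ν) hν (G := fun z => h z - p z) (η := η) hG
    hij.ne (hij.trans hjl).ne hjl.ne
    (R₁ := fun x => ∏ e' ∈ s' with ¬ inc l e', R e' x)
    (R₂ := fun x => ∏ e' ∈ (s'.filter (inc l)) with ¬ inc j e', R e' x)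
    (R₃ := fun x => ∏ e' ∈ (s'.filter (inc l)) with inc j e', R e' x)
    (hprod _) (hprod _) (hprod _)
    (fun x r => Finset.prod_congr rfl fun e' he' => hRi _ _ (Finset.mem_filter.1 he').2 _ _)
    (fun x r => Finset.prod_congr rfl fun e' he' => hRi _ _ (Finset.mem_filter.1 he').2 _ _)
    (fun x r => Finset.prod_congr rfl fun e' he' => by
      simp only [Finset.mem_filter] at he'
      obtain ⟨⟨h1, h2⟩, h3⟩ := he'
      refine hRi _ _ ?_ _ _
      intro h4
      obtain ⟨h5, h6⟩ := Finset.mem_erase.1 h1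
      obtain ⟨h7, h8⟩ := hs _ h6
      obtain ⟨i', j', l'⟩ := e'
      simp only [inc] at h2 h3 h4 h7 h8
      refine h5 ?_
      simp only [Prod.mk.injEq]
      omega)
  refine le_of_eq_of_le ?_ key
  congr 2
  funext x
  rw [← Finset.prod_filter_mul_prod_filter_not s' (inc l),
    ← Finset.prod_filter_mul_prod_filter_not (s'.filter (inc l)) (inc j)]
  simp only [edgeVal, R]
  ring

lemma abs_pexp_pair_le {V ι : Type} [Fintype V] [DecidableEq V] (hν : IsProb ν)
    {G : U × U → ℝ} {q : U → ι} {η : ℝ}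
    (hG : ∀ u v : U → ι → ℝ, (∀ x a, |u x a| ≤ 1) → (∀ x a, |v x a| ≤ 1) →
      |∑ z : U × U, wt2 ν z * (G z * (u z.1 (q z.2) * v z.2 (q z.1)))| ≤ η)
    {i j : V} (hij : i ≠ j) {R₁ R₂ : (V → U) → ℝ}
    (h₁ : ∀ x, |R₁ x| ≤ 1) (h₂ : ∀ x, |R₂ x| ≤ 1)
    (i₁ : ∀ x t t', q t = q t' → R₁ (Function.update x j t) = R₁ (Function.update x j t'))
    (i₂ : ∀ x t, R₂ (Function.update x i t) = R₂ x) :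
    |pexp (fun _ : V => ν) (fun x => G (x i, x j) * (R₁ x * R₂ x))| ≤ η := by
  classical
  rw [← pexp_avg j hν.2, ← pexp_avg i hν.2]
  refine abs_pexp_le_of_abs_le (fun _ => hν) fun x => ?_
  let u : U → ι → ℝ := fun r a =>
    if h : ∃ t, q t = a then R₁ (Function.update (Function.update x i r) j h.choose) else 0
  have hu : ∀ r t, u r (q t) = R₁ (Function.update (Function.update x i r) j t) := by
    intro r t
    have hex : ∃ t', q t' = q t := ⟨t, rfl⟩
    simp only [u, hex, dif_pos]
    exact i₁ _ _ _ hex.choose_spec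
  have hu1 : ∀ r a, |u r a| ≤ 1 := by
    intro r a
    simp only [u]
    split_ifs
    · exact h₁ _
    · simp
  refine le_of_eq_of_le ?_ (hG u (fun r _ => R₂ (Function.update x j r)) hu1 (fun _ _ => h₂ _))
  congr 1
  rw [Fintype.sum_prod_type]
  simp_rw [Finset.mul_sum, wt2]
  refine Finset.sum_congr rfl fun r _ => Finset.sum_congr rfl fun t _ => ?_
  have e2 : R₂ (Function.update (Function.update x i r) j t) = R₂ (Function.update x j t) := by
    rw [Function.update_comm hij, i₂]
  rw [e2, hu]
  simp only [Function.update_self, Function.update_of_ne hij]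
  ring

lemma pexp_indicator {I X : Type} [Fintype I] [DecidableEq I] [Fintype X] [DecidableEq X]
    (a : I → X) (g : (I → X) → ℝ) : pexp (fun i x => if a i = x then 1 else 0) g = g a := by
  rw [pexp, Finset.sum_eq_single a]
  · simp
  · intro b _ hb
    obtain ⟨i, hi⟩ := Function.ne_iff.1 hb
    rw [Finset.prod_eq_zero (Finset.mem_univ i) (by simp [hi.symm]), zero_mul]
  · simp

lemma IsProb.indicator {X : Type} [Fintype X] [DecidableEq X] (a : X) :
    IsProb (fun x => if a = x then (1 : ℝ) else 0) :=
  ⟨fun x => by dsimp only; split_ifs <;> norm_num, by simp⟩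

/-- The density of colour `c` between the parts of two points. -/
noncomputable def partDensity {κ ι : Type} [DecidableEq κ] [DecidableEq ι] (ν : U → ℝ)
    (P : U → U → κ) (q : U → ι) (x y : U) (c : κ) : ℝ :=
  cexp (wt2 ν) (name2 q) (ind P c) (x, y)

lemma isProb_partDensity {κ ι : Type} [Fintype κ] [DecidableEq κ] [DecidableEq ι]
    (hpos : ∀ x, 0 < ν x) (P : U → U → κ) (q : U → ι) (x y : U) :
    IsProb (partDensity ν P q x y) := by
  have hw : ∀ z, 0 < wt2 ν z := fun z => mul_pos (hpos _) (hpos _)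
  refine ⟨fun c => cexp_nonneg (fun z => (hw z).le) (ind_nonneg P c) _, ?_⟩
  simp only [partDensity, cexp, fibAvg]
  rw [← Finset.sum_div, Finset.sum_comm]
  simp_rw [← Finset.mul_sum]
  have : ∀ z : U × U, ∑ c, ind P c z = 1 := fun z => by simp [ind]
  simp_rw [this, mul_one]
  refine div_self (ne_of_gt ?_)
  exact Finset.sum_pos (fun z _ => hw z) ⟨(x, y), by simp⟩

/-- Counting lemma for pairs: colours of pairs may be replaced by independent colours distributed
according to the densities between parts. -/
theorem abs_pexp_colour_sub_le {k : ℕ} {κ ι : Type} [Fintype κ] [DecidableEq κ] [DecidableEq ι]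
    (hν : IsProb ν) (hpos : ∀ x, 0 < ν x) {P : U → U → κ} {q : U → ι} {η : ℝ}
    (hη : 0 ≤ η)
    (hreg : PairRegular ν P q η) {g : (Sym2 (Fin k) → κ) → ℝ} (hg : ∀ ω, |g ω| ≤ 1)
    (hgd : ∀ p : Sym2 (Fin k), p.IsDiag → ∀ ω c, g (Function.update ω p c) = g ω)
    {S : (Fin k → U) → ℝ} (hS : ∀ x, |S x| ≤ 1)
    (hSq : ∀ x x' : Fin k → U, (∀ i, q (x i) = q (x' i)) → S x = S x') :
    |pexp (fun _ : Fin k => ν) (fun x => S x * g (fun p => P (x p.inf) (x p.sup)))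
      - pexp (fun _ : Fin k => ν)
        (fun x => S x * pexp (fun p => partDensity ν P q (x p.inf) (x p.sup)) g)|
      ≤ Fintype.card (Sym2 (Fin k)) * (Fintype.card (Sym2 (Fin k) → κ) * η) := by
  classical
  set Nω : ℝ := (Fintype.card (Sym2 (Fin k) → κ) : ℝ) * η with hNω
  have hN0 : 0 ≤ Nω := by positivity
  let w : Finset (Sym2 (Fin k)) → (Fin k → U) → Sym2 (Fin k) → κ → ℝ := fun T x p =>
    if p ∈ T then partDensity ν P q (x p.inf) (x p.sup)
    else fun c => if P (x p.inf) (x p.sup) = c then 1 else 0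
  have hw : ∀ T x p, IsProb (w T x p) := by
    intro T x p
    simp only [w]
    split_ifs
    · exact isProb_partDensity hpos P q _ _
    · exact IsProb.indicator _
  have hw1 : ∀ T x p c, |w T x p c| ≤ 1 := by
    intro T x p c
    rw [abs_of_nonneg ((hw T x p).1 c), ← (hw T x p).2]
    exact Finset.single_le_sum (fun c _ => (hw T x p).1 c) (Finset.mem_univ c)
  have hwi : ∀ T (p : Sym2 (Fin k)) (v : Fin k), v ∉ p → ∀ x t,
      w T (Function.update x v t) p = w T x p := by
    intro T p v hv x t
    have h1 : p.inf ≠ v := fun h => hv (h ▸ by induction p using Sym2.ind with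
      | _ a b => rcases le_total a b with hab | hab <;> simp [hab])
    have h2 : p.sup ≠ v := fun h => hv (h ▸ by induction p using Sym2.ind with
      | _ a b => rcases le_total a b with hab | hab <;> simp [hab])
    simp only [w, Function.update_of_ne h1, Function.update_of_ne h2]
  have step : ∀ T : Finset (Sym2 (Fin k)), (∀ p ∈ T, ¬ p.IsDiag) →
      |pexp (fun _ : Fin k => ν) (fun x => S x * pexp (w ∅ x) g)
        - pexp (fun _ : Fin k => ν) (fun x => S x * pexp (w T x) g)| ≤ T.card * Nω := by
    intro T
    induction T using Finset.induction_on with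
    | empty => intro _; simp
    | insert p₀ T hp₀ ih =>
      intro hd
      have ih' := ih fun p hp => hd p (Finset.mem_insert_of_mem hp)
      have hnd := hd p₀ (Finset.mem_insert_self _ _)
      have hone : |pexp (fun _ : Fin k => ν) (fun x => S x * pexp (w T x) g)
          - pexp (fun _ : Fin k => ν) (fun x => S x * pexp (w (insert p₀ T) x) g)| ≤ Nω := by
        obtain ⟨i, j, hij, rfl⟩ : ∃ i j : Fin k, i < j ∧ p₀ = s(i, j) := by
          induction p₀ using Sym2.ind with
          | _ a b =>
            rcases lt_trichotomy a b with hab | hab | hab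
            · exact ⟨a, b, hab, rfl⟩
            · exact absurd (by simpa using hab) hnd
            · exact ⟨b, a, hab, Sym2.eq_swap⟩
        have hinf : (s(i, j) : Sym2 (Fin k)).inf = i := by simp [hij.le]
        have hsup : (s(i, j) : Sym2 (Fin k)).sup = j := by simp [hij.le]
        let R : (Fin k → U) → (Sym2 (Fin k) → κ) → ℝ := fun x ω =>
          ∏ p ∈ Finset.univ.erase s(i, j), w T x p (ω p)
        have expand : ∀ x, S x * pexp (w T x) g - S x * pexp (w (insert s(i, j) T) x) g
            = ∑ ω : Sym2 (Fin k) → κ, g ω * ((ind P (ω s(i, j)) (x i, x j) -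
              cexp (wt2 ν) (name2 q) (ind P (ω s(i, j))) (x i, x j)) * (S x * R x ω)) := by
          intro x
          rw [← mul_sub, pexp, pexp, ← Finset.sum_sub_distrib, Finset.mul_sum]
          refine Finset.sum_congr rfl fun ω _ => ?_
          rw [← Finset.mul_prod_erase _ (fun p => w T x p (ω p)) (Finset.mem_univ s(i, j)),
            ← Finset.mul_prod_erase _ (fun p => w (insert s(i, j) T) x p (ω p))
              (Finset.mem_univ s(i, j))]
          have e1 : ∏ p ∈ Finset.univ.erase s(i, j), w (insert s(i, j) T) x p (ω p) = R x ω := by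
            refine Finset.prod_congr rfl fun p hp => ?_
            have : p ≠ s(i, j) := (Finset.mem_erase.1 hp).1
            simp only [w, Finset.mem_insert, this, false_or]
          have e2 : w T x s(i, j) (ω s(i, j)) = ind P (ω s(i, j)) (x i, x j) := by
            simp only [w, hp₀, if_false, hinf, hsup, ind]
          have e3 : w (insert s(i, j) T) x s(i, j) (ω s(i, j))
              = cexp (wt2 ν) (name2 q) (ind P (ω s(i, j))) (x i, x j) := by
            simp only [w, Finset.mem_insert_self, if_true, hinf, hsup, partDensity]
          rw [e1, e2, e3]
          ring
        rw [← pexp_sub]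
        simp_rw [expand]
        rw [pexp_sum]
        have hterm : ∀ ω : Sym2 (Fin k) → κ, |pexp (fun _ : Fin k => ν) (fun x =>
            g ω * ((ind P (ω s(i, j)) (x i, x j) -
              cexp (wt2 ν) (name2 q) (ind P (ω s(i, j))) (x i, x j)) * (S x * R x ω)))| ≤ η := by
          intro ω
          rw [pexp_const_mul, abs_mul]
          refine le_trans (mul_le_of_le_one_left (abs_nonneg _) (hg ω)) ?_
          have hprod : ∀ (Q : Finset (Sym2 (Fin k))) x, |∏ p ∈ Q, w T x p (ω p)| ≤ 1 := by
            intro Q x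
            rw [Finset.abs_prod]
            exact Finset.prod_le_one (fun _ _ => abs_nonneg _) fun p _ => hw1 _ _ _ _
          have key := abs_pexp_pair_le (V := Fin k) hν (q := q) (η := η)
            (G := fun z => ind P (ω s(i, j)) z - cexp (wt2 ν) (name2 q) (ind P (ω s(i, j))) z)
            (hreg (ω s(i, j))) hij.ne
            (R₁ := fun x => S x * ∏ p ∈ Finset.univ.erase s(i, j) with j ∉ p, w T x p (ω p))
            (R₂ := fun x => ∏ p ∈ Finset.univ.erase s(i, j) with ¬ j ∉ p, w T x p (ω p))
            (fun x => by
              rw [abs_mul]; exact mul_le_one₀ (hS x) (abs_nonneg _) (hprod _ x))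
            (hprod _)
            (fun x t t' htt => by
              refine congrArg₂ _ (hSq _ _ fun v => ?_) (Finset.prod_congr rfl fun p hp => ?_)
              · by_cases hv : v = j
                · subst hv; simpa using htt
                · simp [hv]
              · have := (Finset.mem_filter.1 hp).2
                rw [hwi T p j this, hwi T p j this])
            (fun x t => by
              refine Finset.prod_congr rfl fun p hp => ?_
              obtain ⟨hp1, hp2⟩ := Finset.mem_filter.1 hp
              have hp3 := (Finset.mem_erase.1 hp1).1
              rw [hwi T p i]
              intro hi
              exact hp3 ((Sym2.mem_and_mem_iff hij.ne).1 ⟨hi, not_not.1 hp2⟩))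
          refine le_of_eq_of_le ?_ key
          congr 2
          funext x
          simp only [R]
          rw [← Finset.prod_filter_mul_prod_filter_not (Finset.univ.erase s(i, j)) (fun p => j ∉ p)]
          ring
        calc _ ≤ ∑ ω : Sym2 (Fin k) → κ, η := (Finset.abs_sum_le_sum_abs _ _).trans
              (Finset.sum_le_sum fun ω _ => hterm ω)
          _ = Nω := by simp [hNω]
      rw [Finset.card_insert_of_notMem hp₀]
      push_cast
      calc _ ≤ _ := abs_sub_le _ (pexp (fun _ : Fin k => ν) (fun x => S x * pexp (w T x) g)) _
        _ ≤ T.card * Nω + Nω := add_le_add ih' hone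
        _ = _ := by ring
  have hfin := step (Finset.univ.filter fun p => ¬ p.IsDiag) (by simp)
  have e0 : ∀ x, pexp (w ∅ x) g = g (fun p => P (x p.inf) (x p.sup)) := by
    intro x
    rw [← pexp_indicator (fun p : Sym2 (Fin k) => P (x p.inf) (x p.sup)) g]
    congr 1
  have e1 : ∀ x, pexp (w (Finset.univ.filter fun p => ¬ p.IsDiag) x) g
      = pexp (fun p => partDensity ν P q (x p.inf) (x p.sup)) g := by
    intro x
    refine pexp_congr_weight (hw _ x) (fun p => isProb_partDensity hpos P q _ _) ?_
    intro p hp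
    refine hgd p ?_
    by_contra hd
    exact hp (by simp [w, hd])
  simp_rw [e0, e1] at hfin
  refine hfin.trans (mul_le_mul_of_nonneg_right ?_ hN0)
  exact_mod_cast Finset.card_le_univ _

end Counting

section ReducedDensity

variable {U : Type} [Fintype U] {ν : U → ℝ}

lemma sum_wt3 (ν : U → ℝ) (f : U × U × U → ℝ) :
    ∑ z, wt3 ν z * f z = triDensity ν ν ν (fun x y z => f (x, y, z)) := by
  rw [Fintype.sum_prod_type]
  simp_rw [Fintype.sum_prod_type, triDensity, Finset.mul_sum, wt3]
  refine Finset.sum_congr rfl fun r _ => Finset.sum_congr rfl fun t _ =>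
    Finset.sum_congr rfl fun w _ => by ring

lemma pexp_three {V : Type} [Fintype V] [DecidableEq V] (hν : IsProb ν) {a b c : V} (hab : a ≠ b)
    (hac : a ≠ c) (hbc : b ≠ c) (f : U × U × U → ℝ) :
    pexp (fun _ : V => ν) (fun x => f (x a, x b, x c)) = ∑ z, wt3 ν z * f z := by
  rw [sum_wt3, ← pexp_triple (W := V) (ν := fun _ => ν) (fun _ => hν) hab hac hbc]

/-- The names of the vertices of a triple. -/
def name1 {ι : Type} (q : U → ι) (z : U × U × U) : ι × ι × ι := (q z.1, q z.2.1, q z.2.2)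

/-- The average of a ternary function over a triple of colours. -/
noncomputable def colourAvg {κ : Type} [DecidableEq κ] (ν : U → ℝ) (h : U × U × U → ℝ)
    (P : U → U → κ) (a b c : κ) : ℝ :=
  fibAvg (wt3 ν) (name3 P) h (a, b, c)

lemma colourAvg_nonneg {κ : Type} [DecidableEq κ] (hν : IsProb ν) {h : U × U × U → ℝ}
    (h0 : ∀ z, 0 ≤ h z) (P : U → U → κ) (a b c : κ) : 0 ≤ colourAvg ν h P a b c :=
  div_nonneg (Finset.sum_nonneg fun z _ => mul_nonneg (hν.wt3.1 z) (h0 z))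
    (Finset.sum_nonneg fun z _ => hν.wt3.1 z)

lemma colourAvg_le_one {κ : Type} [DecidableEq κ] (hν : IsProb ν) {h : U × U × U → ℝ}
    (h1 : ∀ z, h z ≤ 1) (P : U → U → κ) (a b c : κ) : colourAvg ν h P a b c ≤ 1 :=
  fibAvg_le_one hν.wt3.1 h1 _ _

lemma abs_colourAvg_le_one {κ : Type} [DecidableEq κ] (hν : IsProb ν) {h : U × U × U → ℝ}
    (h0 : ∀ z, 0 ≤ h z) (h1 : ∀ z, h z ≤ 1) (P : U → U → κ) (a b c : κ) :
    |colourAvg ν h P a b c| ≤ 1 := by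
  rw [abs_of_nonneg (colourAvg_nonneg hν h0 P a b c)]
  exact colourAvg_le_one hν h1 P a b c

/-- The density of a ternary function predicted by the densities between parts. -/
noncomputable def reducedDensity {κ ι : Type} [Fintype κ] [DecidableEq κ] [DecidableEq ι]
    (ν : U → ℝ) (h : U × U × U → ℝ) (P : U → U → κ) (q : U → ι) (z : U × U × U) : ℝ :=
  triDensity (partDensity ν P q z.1 z.2.1) (partDensity ν P q z.1 z.2.2)
    (partDensity ν P q z.2.1 z.2.2) (colourAvg ν h P)

lemma reducedDensity_factorsThrough {κ ι : Type} [Fintype κ] [DecidableEq κ] [DecidableEq ι]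
    (ν : U → ℝ) (h : U × U × U → ℝ) (P : U → U → κ) (q : U → ι) :
    (reducedDensity ν h P q).FactorsThrough (name1 q) := by
  intro z w hzw
  simp only [name1, Prod.mk.injEq] at hzw
  have e : ∀ {x y x' y' : U}, q x = q x' → q y = q y' →
      partDensity ν P q x y = partDensity ν P q x' y' := by
    intro x y x' y' h1 h2
    funext c
    exact cexp_factorsThrough (by simp [name2, h1, h2])
  simp only [reducedDensity, e hzw.1 hzw.2.1, e hzw.1 hzw.2.2, e hzw.2.1 hzw.2.2]

/-- The densities between parts predict the average of `h` over most triples of parts. -/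
theorem sum_abs_cexp_sub_reducedDensity_le {κ ι : Type} [Fintype κ] [DecidableEq κ] [DecidableEq ι]
    (hν : IsProb ν) (hpos : ∀ x, 0 < ν x) {h : U × U × U → ℝ} (h0 : ∀ z, 0 ≤ h z)
    (h1 : ∀ z, h z ≤ 1) {P : U → U → κ} {q : U → ι} {η₁ η₂ : ℝ} (hη₂ : 0 ≤ η₂)
    (hv : VertexRegular ν h P q η₁) (hp : PairRegular ν P q η₂) :
    ∑ z, wt3 ν z * |cexp (wt3 ν) (name1 q) h z - reducedDensity ν h P q z|
      ≤ η₁ + Fintype.card (Sym2 (Fin 3)) * (Fintype.card (Sym2 (Fin 3) → κ) * η₂) := by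
  classical
  set r := reducedDensity ν h P q with hr
  set c := cexp (wt3 ν) (name1 q) h with hc
  have hfac : (fun z => c z - r z).FactorsThrough (name1 q) := fun z w hzw => by
    simp only [hc, hr, cexp_factorsThrough hzw, reducedDensity_factorsThrough ν h P q hzw]
  let s : ι → ι → ι → ℝ := fun a b d =>
    if ∃ z, name1 q z = (a, b, d) ∧ 0 ≤ c z - r z then 1 else -1
  have hs1 : ∀ a b d, |s a b d| ≤ 1 := by
    intro a b d
    simp only [s]
    split_ifs <;> simp
  have hs : ∀ z, |c z - r z| = (c z - r z) * s (q z.1) (q z.2.1) (q z.2.2) := by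
    intro z
    have : (∃ w, name1 q w = (q z.1, q z.2.1, q z.2.2) ∧ 0 ≤ c w - r w) ↔ 0 ≤ c z - r z := by
      constructor
      · rintro ⟨w, hw, hw0⟩
        have := hfac (a := w) (b := z) hw
        simp only at this
        rwa [← this]
      · exact fun h => ⟨z, rfl, h⟩
    simp only [s, this]
    split_ifs with hz
    · rw [abs_of_nonneg hz, mul_one]
    · rw [abs_of_neg (not_le.1 hz)]; ring
  have hsf : (fun z : U × U × U => s (q z.1) (q z.2.1) (q z.2.2)).FactorsThrough (name1 q) := by
    intro z w hzw
    simp only [name1, Prod.mk.injEq] at hzw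
    simp only [hzw.1, hzw.2.1, hzw.2.2]
  have e1 : ∑ z, wt3 ν z * |c z - r z|
      = ∑ z, wt3 ν z * ((h z - cexp (wt3 ν) (name3 P) h z) * s (q z.1) (q z.2.1) (q z.2.2))
        + (∑ z, wt3 ν z * (s (q z.1) (q z.2.1) (q z.2.2) * cexp (wt3 ν) (name3 P) h z)
          - ∑ z, wt3 ν z * (s (q z.1) (q z.2.1) (q z.2.2) * r z)) := by
    have e2 := sum_cexp_mul (g := h) hν.wt3.1 hsf
    calc _ = ∑ z, wt3 ν z * (c z * s (q z.1) (q z.2.1) (q z.2.2))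
          - ∑ z, wt3 ν z * (s (q z.1) (q z.2.1) (q z.2.2) * r z) := by
          rw [← Finset.sum_sub_distrib]
          exact Finset.sum_congr rfl fun z _ => by rw [hs]; ring
      _ = _ := by
          rw [hc, e2, ← add_sub_assoc, ← Finset.sum_add_distrib]
          congr 1
          exact Finset.sum_congr rfl fun z _ => by ring
  have hd01 : (s((0 : Fin 3), 1)).inf = 0 ∧ (s((0 : Fin 3), 1)).sup = 1 := by decide
  have hd02 : (s((0 : Fin 3), 2)).inf = 0 ∧ (s((0 : Fin 3), 2)).sup = 2 := by decide
  have hd12 : (s((1 : Fin 3), 2)).inf = 1 ∧ (s((1 : Fin 3), 2)).sup = 2 := by decide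
  have key := abs_pexp_colour_sub_le (k := 3) hν hpos hη₂ hp
    (g := fun ω => colourAvg ν h P (ω s(0, 1)) (ω s(0, 2)) (ω s(1, 2)))
    (fun ω => abs_colourAvg_le_one hν h0 h1 P _ _ _)
    (fun p hd ω x => by
      have n1 : s((0 : Fin 3), 1) ≠ p := fun h => by rw [← h] at hd; simp at hd
      have n2 : s((0 : Fin 3), 2) ≠ p := fun h => by rw [← h] at hd; simp at hd
      have n3 : s((1 : Fin 3), 2) ≠ p := fun h => by rw [← h] at hd; simp at hd
      simp only [Function.update_of_ne n1, Function.update_of_ne n2, Function.update_of_ne n3])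
    (S := fun x => s (q (x 0)) (q (x 1)) (q (x 2))) (fun x => hs1 _ _ _)
    (fun x x' hx => by simp only [hx])
  have hk1 : pexp (fun _ : Fin 3 => ν) (fun x => s (q (x 0)) (q (x 1)) (q (x 2)) *
      colourAvg ν h P (P (x (s(0, 1) : Sym2 (Fin 3)).inf) (x (s(0, 1) : Sym2 (Fin 3)).sup))
        (P (x (s(0, 2) : Sym2 (Fin 3)).inf) (x (s(0, 2) : Sym2 (Fin 3)).sup))
        (P (x (s(1, 2) : Sym2 (Fin 3)).inf) (x (s(1, 2) : Sym2 (Fin 3)).sup)))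
      = ∑ z, wt3 ν z * (s (q z.1) (q z.2.1) (q z.2.2) * cexp (wt3 ν) (name3 P) h z) := by
    simp only [hd01, hd02, hd12]
    exact pexp_three (V := Fin 3) hν (a := 0) (b := 1) (c := 2) (by decide) (by decide)
      (by decide) (fun z => s (q z.1) (q z.2.1) (q z.2.2) * cexp (wt3 ν) (name3 P) h z)
  have hk2 : pexp (fun _ : Fin 3 => ν) (fun x => s (q (x 0)) (q (x 1)) (q (x 2)) *
      pexp (fun p : Sym2 (Fin 3) => partDensity ν P q (x p.inf) (x p.sup))
        (fun ω => colourAvg ν h P (ω s(0, 1)) (ω s(0, 2)) (ω s(1, 2))))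
      = ∑ z, wt3 ν z * (s (q z.1) (q z.2.1) (q z.2.2) * r z) := by
    have : ∀ x : Fin 3 → U,
        pexp (fun p : Sym2 (Fin 3) => partDensity ν P q (x p.inf) (x p.sup))
        (fun ω => colourAvg ν h P (ω s(0, 1)) (ω s(0, 2)) (ω s(1, 2))) = r (x 0, x 1, x 2) := by
      intro x
      rw [pexp_triple (fun p => isProb_partDensity hpos P q _ _) (by decide) (by decide)
        (by decide) (colourAvg ν h P)]
      simp only [hd01, hd02, hd12]
      rfl
    simp_rw [this]
    exact pexp_three (V := Fin 3) hν (a := 0) (b := 1) (c := 2) (by decide) (by decide)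
      (by decide) (fun z => s (q z.1) (q z.2.1) (q z.2.2) * r z)
  rw [hk1, hk2] at key
  rw [e1]
  exact add_le_add ((le_abs_self _).trans (hv s hs1)) ((le_abs_self _).trans key)

/-- The value of a ternary function of colours at an edge. -/
def colVal {k : ℕ} {κ : Type} (p : κ → κ → κ → ℝ) (e : Fin k × Fin k × Fin k)
    (ω : Sym2 (Fin k) → κ) : ℝ :=
  p (ω s(e.1, e.2.1)) (ω s(e.1, e.2.2)) (ω s(e.2.1, e.2.2))

/-- The count of a hypergraph in the reduced structure is controlled by its count in `h`. -/
theorem pexp_reduced_count_le {k : ℕ} {κ ι : Type} [Fintype κ] [DecidableEq κ] [DecidableEq ι]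
    (hν : IsProb ν) (hpos : ∀ x, 0 < ν x) {h : U × U × U → ℝ} (h0 : ∀ z, 0 ≤ h z)
    (h1 : ∀ z, h z ≤ 1) {P : U → U → κ} {q : U → ι} {η₁ η₂ : ℝ} (hη₂ : 0 ≤ η₂)
    (ht : TripleRegular ν h P η₁) (hp : PairRegular ν P q η₂)
    (s : Finset (Fin k × Fin k × Fin k)) (hs : ∀ e ∈ s, e.1 < e.2.1 ∧ e.2.1 < e.2.2) :
    pexp (fun _ : Fin k => ν) (fun x =>
        pexp (fun p : Sym2 (Fin k) => partDensity ν P q (x p.inf) (x p.sup))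
          (fun ω => ∏ e ∈ s, colVal (colourAvg ν h P) e ω))
      ≤ pexp (fun _ : Fin k => ν) (fun x => ∏ e ∈ s, edgeVal h e x) + s.card * η₁
        + Fintype.card (Sym2 (Fin k)) * (Fintype.card (Sym2 (Fin k) → κ) * η₂) := by
  classical
  have hc1 := abs_pexp_prod_edgeVal_sub_le (k := k) hν (h := h)
    (p := cexp (wt3 ν) (name3 P) h) (fun z => by rw [abs_of_nonneg (h0 z)]; exact h1 z)
    (fun z => abs_colourAvg_le_one hν h0 h1 P _ _ _) ht s hs
  have hc2 := abs_pexp_colour_sub_le (k := k) hν hpos hη₂ hp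
    (g := fun ω => ∏ e ∈ s, colVal (colourAvg ν h P) e ω)
    (fun ω => by
      rw [Finset.abs_prod]
      exact Finset.prod_le_one (fun _ _ => abs_nonneg _)
        fun e _ => abs_colourAvg_le_one hν h0 h1 P _ _ _)
    (fun p hd ω x => Finset.prod_congr rfl fun e he => by
      have hne : ∀ {a b : Fin k}, a < b → s(a, b) ≠ p := by
        rintro a b hab rfl
        exact hab.ne (by simpa using hd)
      have ho := hs e he
      simp only [colVal, Function.update_of_ne (hne ho.1), Function.update_of_ne (hne ho.2),
        Function.update_of_ne (hne (ho.1.trans ho.2))])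
    (S := fun _ => 1) (by simp) (fun _ _ _ => rfl)
  simp only [one_mul] at hc2
  have e : ∀ x : Fin k → U, ∏ e ∈ s, colVal (colourAvg ν h P) e
      (fun p : Sym2 (Fin k) => P (x p.inf) (x p.sup))
      = ∏ e ∈ s, edgeVal (cexp (wt3 ν) (name3 P) h) e x := by
    intro x
    refine Finset.prod_congr rfl fun e he => ?_
    have ho := hs e he
    have hi : ∀ {a b : Fin k}, a < b → (s(a, b) : Sym2 (Fin k)).inf = a ∧
        (s(a, b) : Sym2 (Fin k)).sup = b := fun hab => by simp [hab.le]
    simp only [colVal, (hi ho.1).1, (hi ho.1).2, (hi ho.2).1, (hi ho.2).2,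
      (hi (ho.1.trans ho.2)).1, (hi (ho.1.trans ho.2)).2]
    rfl
  simp_rw [e] at hc2
  have a1 := (abs_le.1 hc1).1
  have a2 := (abs_le.1 hc2).1
  linarith

/-- The normalised indicator of the part of `x`. -/
noncomputable def partWeight {ι : Type} [DecidableEq ι] (ν : U → ℝ) (q : U → ι) (x y : U) : ℝ :=
  if q y = q x then (push ν q (q x))⁻¹ else 0

lemma sum_mul_partWeight {ι : Type} [DecidableEq ι] (hpos : ∀ x, 0 < ν x) (q : U → ι) (x : U) :
    ∑ y, ν y * partWeight ν q x y = 1 := by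
  have h0 : 0 < push ν q (q x) := Finset.sum_pos (fun y _ => hpos y) ⟨x, by simp⟩
  simp only [partWeight, mul_ite, mul_zero]
  rw [← Finset.sum_filter, ← Finset.sum_mul]
  exact mul_inv_cancel₀ h0.ne'

lemma cexp_name1_eq {ι : Type} [DecidableEq ι] (q : U → ι) (h : U × U × U → ℝ) (x y z : U) :
    cexp (wt3 ν) (name1 q) h (x, y, z) = ∑ t, wt3 ν t *
      (h t * (partWeight ν q x t.1 * partWeight ν q y t.2.1 * partWeight ν q z t.2.2)) := by
  have hden : ∑ t with name1 q t = name1 q (x, y, z), wt3 ν t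
      = push ν q (q x) * (push ν q (q y) * push ν q (q z)) := by
    have : (Finset.univ.filter fun t => name1 q t = name1 q (x, y, z))
        = (Finset.univ.filter fun t => q t = q x) ×ˢ ((Finset.univ.filter fun t => q t = q y) ×ˢ
          (Finset.univ.filter fun t => q t = q z)) := by
      ext t; simp [name1]
    rw [this, Finset.sum_product]
    simp_rw [Finset.sum_product, wt3, push, Finset.sum_mul_sum, Finset.mul_sum]
  rw [cexp, fibAvg, hden, Finset.sum_filter, div_eq_mul_inv, Finset.sum_mul]
  refine Finset.sum_congr rfl fun t _ => ?_
  simp only [name1, partWeight, Prod.mk.injEq]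
  by_cases a1 : q t.1 = q x <;> by_cases a2 : q t.2.1 = q y <;> by_cases a3 : q t.2.2 = q z <;>
    simp [a1, a2, a3]
  ring

end ReducedDensity

lemma exists_forall_lt_one_of_pexp_le {I X T : Type} [Fintype I] [DecidableEq I] [Fintype X]
    [Fintype T] {μ : I → X → ℝ} (hμ : ∀ i, IsProb (μ i)) {f : T → (I → X) → ℝ}
    (hf : ∀ t ω, 0 ≤ f t ω) {c : ℝ} (hc : ∀ t, pexp μ (f t) ≤ c) (hcard : Fintype.card T * c < 1) :
    ∃ ω, ∀ t, f t ω < 1 := by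
  have h1 : -(Fintype.card T * c) ≤ pexp μ (fun ω => (-1) * ∑ t, f t ω) := by
    rw [pexp_const_mul, pexp_sum]
    have : ∑ t, pexp μ (f t) ≤ ∑ _t : T, c := Finset.sum_le_sum fun t _ => hc t
    simp only [Finset.sum_const, Finset.card_univ, nsmul_eq_mul] at this
    linarith
  obtain ⟨ω, hω⟩ := exists_le_of_pexp_le hμ h1
  refine ⟨ω, fun t => ?_⟩
  have : f t ω ≤ ∑ t, f t ω :=
    Finset.single_le_sum (f := fun t => f t ω) (fun t _ => hf t ω) (Finset.mem_univ t)
  linarith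

lemma IsProb.nonempty {X : Type} [Fintype X] {μ : X → ℝ} (hμ : IsProb μ) : Nonempty X := by
  by_contra h
  rw [not_nonempty_iff] at h
  have := hμ.2
  simp at this

lemma sum_mul_small_part_le {U ι : Type} [Fintype U] [Fintype ι] [DecidableEq ι] {ν : U → ℝ}
    (q : U → ι) {τ : ℝ} (hτ : 0 ≤ τ) :
    ∑ x, ν x * (if push ν q (q x) < τ then (1 : ℝ) else 0) ≤ Fintype.card ι * τ := by
  rw [← sum_push_mul ν q (fun y => if push ν q y < τ then (1 : ℝ) else 0)]
  calc _ ≤ ∑ _y : ι, τ := Finset.sum_le_sum fun y _ => by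
        split_ifs with h
        · rw [mul_one]; exact h.le
        · rw [mul_zero]; exact hτ
    _ = _ := by simp

lemma pexp_single {U V : Type} [Fintype U] [Fintype V] [DecidableEq V] {μ : V → U → ℝ}
    (hμ : ∀ i, IsProb (μ i)) (i : V) (f : U → ℝ) :
    pexp μ (fun x => f (x i)) = ∑ x, μ i x * f x := by
  have := pexp_comp_injective hμ (θ := fun _ : Unit => i) (fun _ _ _ => rfl) (fun x => f (x ()))
  refine this.trans ?_
  rw [pexp, ← (Equiv.funUnique Unit U).symm.sum_comp]
  simp

lemma Sym2.inf_map_of_strictMono {α β : Type} [LinearOrder α] [LinearOrder β] {F : α → β}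
    (hF : StrictMono F) (p : Sym2 α) : (p.map F).inf = F p.inf := by
  induction p with
  | _ a b => simpa using (hF.monotone.map_min (a := a) (b := b)).symm

lemma Sym2.sup_map_of_strictMono {α β : Type} [LinearOrder α] [LinearOrder β] {F : α → β}
    (hF : StrictMono F) (p : Sym2 α) : (p.map F).sup = F p.sup := by
  induction p with
  | _ a b => simpa using (hF.monotone.map_max (a := a) (b := b)).symm

/-- A ternary function with few copies of the members of `𝓕` has a reduced structure on `M`
parts with few copies of the members of `𝓕`. -/
theorem exists_reduced {k : ℕ} (𝓕 : Finset (Finset (Fin k × Fin k × Fin k)))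
    (h𝓕 : ∀ s ∈ 𝓕, ∀ e ∈ s, e.1 < e.2.1 ∧ e.2.1 < e.2.2) (M : ℕ) {η δ : ℝ} (hη : 0 < η)
    (hδ : 0 < δ) :
    ∃ η₀ > 0, ∃ τ > 0, ∀ {U : Type} [Fintype U] (ν : U → ℝ), IsProb ν → (∀ x, 0 < ν x) →
      ∀ h : U × U × U → ℝ, (∀ z, 0 ≤ h z) → (∀ z, h z ≤ 1) →
      (∀ s ∈ 𝓕, pexp (fun _ : Fin k => ν) (fun x => ∏ e ∈ s, edgeVal h e x) ≤ η₀) →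
      ∃ K, ∃ μ : Sym2 ℕ → Fin K → ℝ, ∃ p : Fin K → Fin K → Fin K → ℝ, ∃ w : ℕ → U → ℝ,
        (∀ a, IsProb (μ a)) ∧ (∀ a b c, 0 ≤ p a b c) ∧ (∀ a b c, p a b c ≤ 1) ∧
        (∀ i x, 0 ≤ w i x) ∧ (∀ i, ∑ x, ν x * w i x = 1) ∧ (∀ i < M, ∀ x, τ * w i x ≤ 1) ∧
        (∀ i j l, i < j → j < l → l < M →
          |∑ z, wt3 ν z * (h z * (w i z.1 * w j z.2.1 * w l z.2.2))
            - triDensity (μ s(i, j)) (μ s(i, l)) (μ s(j, l)) p| ≤ δ) ∧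
        ∀ F : Fin k → ℕ, StrictMono F → (∀ x, F x < M) → ∀ s ∈ 𝓕,
          pexp (fun a : Sym2 (Fin k) => μ (a.map F)) (fun ω => ∏ e ∈ s, colVal p e ω) ≤ η := by
  classical
  let T₁ := {t : Fin M × Fin M × Fin M // t.1 < t.2.1 ∧ t.2.1 < t.2.2}
  let T₂ := {F : Fin k → Fin M // StrictMono F} × 𝓕
  let T := T₁ ⊕ T₂ ⊕ Fin M
  set c : ℝ := 1 / (Fintype.card T + 1) with hc
  have hc0 : 0 < c := by positivity
  have hcard : Fintype.card T * c < 1 := by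
    rw [hc, mul_one_div, div_lt_one (by positivity)]
    linarith
  set S : ℝ := (Fintype.card (Fin k × Fin k × Fin k) : ℝ) with hS
  have hS0 : 0 ≤ S := by positivity
  let N₃ : ℕ → ℝ := fun K =>
    Fintype.card (Sym2 (Fin 3)) * Fintype.card (Sym2 (Fin 3) → Fin K)
  let N : ℕ → ℝ := fun K =>
    Fintype.card (Sym2 (Fin k)) * Fintype.card (Sym2 (Fin k) → Fin K)
  have hN₃ : ∀ K, 0 ≤ N₃ K := fun K => by positivity
  have hN : ∀ K, 0 ≤ N K := fun K => by positivity
  have hdiv : ∀ {a b y : ℝ}, 0 ≤ a → 0 ≤ b → y ≤ b / (a + 1) → a * y ≤ b := by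
    intro a b y ha hb hy
    calc a * y ≤ a * (b / (a + 1)) := mul_le_mul_of_nonneg_left hy ha
      _ = a / (a + 1) * b := by ring
      _ ≤ 1 * b := mul_le_mul_of_nonneg_right ((div_le_one (by positivity)).2 (by linarith)) hb
      _ = b := one_mul b
  let η₁ : ℝ := min (δ * c / 2) (η * c / 3 / (S + 1))
  let η₂ : ℕ → ℝ := fun K => min (δ * c / 2 / (N₃ K + 1)) (η * c / 3 / (N K + 1))
  have hη₁ : 0 < η₁ := lt_min (by positivity) (by positivity)
  have hη₂ : ∀ K, 0 < η₂ K := fun K => by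
    have := hN₃ K
    have := hN K
    exact lt_min (by positivity) (by positivity)
  obtain ⟨B, hB⟩ := exists_tripleRegular hη₁ η₂ hη₂
  refine ⟨η * c / 3, by positivity, c / (B + 1), by positivity, ?_⟩
  intro U _ ν hν hpos h h0 h1 hcount
  obtain ⟨K, hK, P, L, hL, q, ht, hv, hp⟩ := hB ν hν h h0 h1
  have hη₂' := (hη₂ K).le
  let f : T → (Fin M → U) → ℝ := fun t x => match t with
    | .inl t => |cexp (wt3 ν) (name1 q) h (x t.1.1, x t.1.2.1, x t.1.2.2)
        - reducedDensity ν h P q (x t.1.1, x t.1.2.1, x t.1.2.2)| / δ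
    | .inr (.inl t) => pexp (fun p : Sym2 (Fin k) =>
        partDensity ν P q (x (t.1.1 p.inf)) (x (t.1.1 p.sup)))
          (fun ω => ∏ e ∈ t.2.1, colVal (colourAvg ν h P) e ω) / η
    | .inr (.inr i) => if push ν q (q (x i)) < c / (B + 1) then 1 else 0
  have hf0 : ∀ t x, 0 ≤ f t x := by
    rintro (t | t | i) x
    · exact div_nonneg (abs_nonneg _) hδ.le
    · exact div_nonneg (pexp_nonneg (fun p => isProb_partDensity hpos P q _ _)
        fun ω => Finset.prod_nonneg fun e _ => colourAvg_nonneg hν h0 P _ _ _) hη.le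
    · simp only [f]; split_ifs <;> simp
  have hfc : ∀ t, pexp (fun _ => ν) (f t) ≤ c := by
    rintro (t | t | i)
    · have h3 := pexp_three (V := Fin M) hν (t.2.1.ne) ((t.2.1.trans t.2.2).ne) (t.2.2.ne)
        (fun z => |cexp (wt3 ν) (name1 q) h z - reducedDensity ν h P q z|)
      have h4 := sum_abs_cexp_sub_reducedDensity_le hν hpos h0 h1 hη₂' hv hp
      have h5 : f (.inl t) = fun x => δ⁻¹ * |cexp (wt3 ν) (name1 q) h
          (x t.1.1, x t.1.2.1, x t.1.2.2)
          - reducedDensity ν h P q (x t.1.1, x t.1.2.1, x t.1.2.2)| := by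
        funext x; simp only [f]; rw [div_eq_inv_mul]
      rw [h5, pexp_const_mul, h3, ← div_eq_inv_mul, div_le_iff₀ hδ]
      have h6 : η₁ ≤ δ * c / 2 := min_le_left _ _
      have h7 : N₃ K * η₂ K ≤ δ * c / 2 := hdiv (hN₃ K) (by positivity) (min_le_left _ _)
      simp only [N₃, mul_assoc] at h7
      linarith
    · have h3 := pexp_comp_injective (μ := fun _ : Fin M => ν) (fun _ => hν)
        (θ := t.1.1) t.1.2.injective (fun y => pexp (fun p : Sym2 (Fin k) =>
          partDensity ν P q (y p.inf) (y p.sup))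
          (fun ω => ∏ e ∈ t.2.1, colVal (colourAvg ν h P) e ω))
      have h4 := pexp_reduced_count_le hν hpos h0 h1 hη₂' ht hp t.2.1 (h𝓕 _ t.2.2)
      have h5 : f (.inr (.inl t)) = fun x => η⁻¹ * pexp (fun p : Sym2 (Fin k) =>
          partDensity ν P q ((x ∘ t.1.1) p.inf) ((x ∘ t.1.1) p.sup))
          (fun ω => ∏ e ∈ t.2.1, colVal (colourAvg ν h P) e ω) := by
        funext x; simp only [f, Function.comp]; rw [div_eq_inv_mul]
      rw [h5, pexp_const_mul, h3, ← div_eq_inv_mul, div_le_iff₀ hη]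
      have h6 : S * η₁ ≤ η * c / 3 := hdiv hS0 (by positivity) (min_le_right _ _)
      have h7 : N K * η₂ K ≤ η * c / 3 := hdiv (hN K) (by positivity) (min_le_right _ _)
      have h8 : (t.2.1.card : ℝ) * η₁ ≤ S * η₁ :=
        mul_le_mul_of_nonneg_right (by rw [hS]; exact_mod_cast Finset.card_le_univ _) hη₁.le
      have h9 := hcount _ t.2.2
      simp only [N, mul_assoc] at h7
      linarith
    · have h3 := pexp_single (V := Fin M) (μ := fun _ => ν) (fun _ => hν) i
        (fun y => if push ν q (q y) < c / (B + 1) then (1 : ℝ) else 0)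
      refine h3.le.trans ((sum_mul_small_part_le q (by positivity)).trans ?_)
      rw [Fintype.card_fin, mul_div_assoc', div_le_iff₀ (by positivity), mul_comm]
      have : (L : ℝ) ≤ B + 1 := by exact_mod_cast hL.trans (Nat.le_succ B)
      exact mul_le_mul_of_nonneg_left this hc0.le
  obtain ⟨x, hx⟩ := exists_forall_lt_one_of_pexp_le (fun _ => hν) hf0 hfc hcard
  obtain ⟨u₀⟩ := hν.nonempty
  let x' : ℕ → U := fun i => if hi : i < M then x ⟨i, hi⟩ else u₀
  have hx' : ∀ i (hi : i < M), x' i = x ⟨i, hi⟩ := fun i hi => by simp [x', hi]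
  have hpush : ∀ y, 0 < push ν q (q y) := fun y =>
    Finset.sum_pos (fun z _ => hpos z) ⟨y, by simp⟩
  refine ⟨K, fun a => partDensity ν P q (x' a.inf) (x' a.sup), colourAvg ν h P,
    fun i => partWeight ν q (x' i), fun a => isProb_partDensity hpos P q _ _,
    colourAvg_nonneg hν h0 P, colourAvg_le_one hν h1 P, ?_, ?_, ?_, ?_, ?_⟩
  · intro i y
    simp only [partWeight]
    split_ifs
    · exact inv_nonneg.2 (hpush _).le
    · exact le_rfl
  · exact fun i => sum_mul_partWeight hpos q _
  · intro i hi y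
    have h3 := hx (.inr (.inr ⟨i, hi⟩))
    simp only [f, ← hx' i hi] at h3
    simp only [partWeight]
    split_ifs with h4
    · rw [← div_eq_mul_inv, div_le_one (hpush _)]
      by_contra! h5
      rw [if_pos h5] at h3
      exact lt_irrefl _ h3
    · simp
  · intro i j l hij hjl hl
    have h3 := hx (.inl ⟨(⟨i, (hij.trans hjl).trans hl⟩, ⟨j, hjl.trans hl⟩, ⟨l, hl⟩), hij, hjl⟩)
    simp only [f] at h3
    rw [div_lt_one hδ, ← hx', ← hx', ← hx', cexp_name1_eq] at h3
    simp only [reducedDensity] at h3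
    have e : ∀ {a b : ℕ}, a < b → (s(a, b)).inf = a ∧ (s(a, b)).sup = b := fun hab => by
      simp [hab.le]
    simp only [(e hij).1, (e hij).2, (e hjl).1, (e hjl).2, (e (hij.trans hjl)).1,
      (e (hij.trans hjl)).2]
    exact h3.le
  · intro F hF hFM s hs
    have h3 := hx (.inr (.inl (⟨fun y => ⟨F y, hFM y⟩, fun a b hab => hF hab⟩, ⟨s, hs⟩)))
    simp only [f] at h3
    rw [div_lt_one hη] at h3
    simp only [Sym2.inf_map_of_strictMono hF, Sym2.sup_map_of_strictMono hF]
    simp only [← hx'] at h3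
    exact h3.le

section WeightedDensity

variable {U : Type} [Fintype U] {ν : U → ℝ}

/-- Density on vertex subsets implies density on weightings of the vertices. -/
lemma weighted_density [DecidableEq U] (hν : ∀ x, 0 ≤ ν x) {h : U × U × U → ℝ}
    (hdist : ∀ z, h z ≠ 0 → z.1 ≠ z.2.1 ∧ z.1 ≠ z.2.2 ∧ z.2.1 ≠ z.2.2) {d ε : ℝ} (hd : 0 ≤ d)
    (hS : ∀ g : U → Bool, d * (∑ x, ν x * bi (g x)) ^ 3 - ε
      ≤ ∑ z, wt3 ν z * (h z * (bi (g z.1) * bi (g z.2.1) * bi (g z.2.2))))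
    {f : U → ℝ} (hf0 : ∀ x, 0 ≤ f x) (hf1 : ∀ x, f x ≤ 1) :
    d * (∑ x, ν x * f x) ^ 3 - ε ≤ ∑ z, wt3 ν z * (h z * (f z.1 * f z.2.1 * f z.2.2)) := by
  let μ : U → Bool → ℝ := fun u b => if b then f u else 1 - f u
  have hμ : ∀ u, IsProb (μ u) := fun u =>
    ⟨fun b => by cases b <;> simp [μ, hf0, hf1], by simp [μ]⟩
  have hbi : ∀ u, ∑ b, μ u b * bi b = f u := fun u => by simp [μ, bi]
  have hE3 : pexp μ (fun g => ∑ z, wt3 ν z * (h z * (bi (g z.1) * bi (g z.2.1) * bi (g z.2.2))))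
      = ∑ z, wt3 ν z * (h z * (f z.1 * f z.2.1 * f z.2.2)) := by
    rw [pexp_sum]
    refine Finset.sum_congr rfl fun z _ => ?_
    rw [pexp_const_mul, pexp_const_mul]
    by_cases hz : h z = 0
    · simp [hz]
    obtain ⟨h1, h2, h3⟩ := hdist z hz
    rw [pexp_triple hμ h1 h2 h3 (fun a b c => bi a * bi b * bi c)]
    have : triDensity (μ z.1) (μ z.2.1) (μ z.2.2) (fun a b c => bi a * bi b * bi c)
        = (∑ b, μ z.1 b * bi b) * (∑ b, μ z.2.1 b * bi b) * (∑ b, μ z.2.2 b * bi b) := by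
      simp only [triDensity, Fintype.sum_bool]; ring
    rw [this, hbi, hbi, hbi]
  set a := ∑ x, ν x * f x with ha
  have ha0 : 0 ≤ a := Finset.sum_nonneg fun x _ => mul_nonneg (hν x) (hf0 x)
  have hE1 : pexp μ (fun g => ∑ x, ν x * bi (g x)) = a := by
    rw [pexp_sum]
    refine Finset.sum_congr rfl fun x _ => ?_
    rw [pexp_const_mul, pexp_single hμ x bi, hbi]
  have hlow : d * a ^ 3 - ε ≤ pexp μ (fun g => d * (∑ x, ν x * bi (g x)) ^ 3 - ε) := by
    calc d * a ^ 3 - ε = pexp μ (fun g =>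
          (3 * d * a ^ 2) * (∑ x, ν x * bi (g x)) + (-(2 * d * a ^ 3) - ε)) := by
          rw [pexp_add, pexp_const_mul, hE1, pexp_const hμ]; ring
      _ ≤ _ := pexp_mono hμ fun g => by
          set t := ∑ x, ν x * bi (g x)
          have ht : 0 ≤ t := Finset.sum_nonneg fun x _ => mul_nonneg (hν x) (bi_nonneg _)
          have : 0 ≤ d * ((t - a) ^ 2 * (t + 2 * a)) := by positivity
          nlinarith [this]
  rw [← hE3]
  exact hlow.trans (pexp_mono hμ hS)

/-- The density of `h` on a triple of weightings. -/
noncomputable def weightDensity (ν : U → ℝ) (h : U × U × U → ℝ) (a b c : U → ℝ) : ℝ :=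
  ∑ z, wt3 ν z * (h z * (a z.1 * b z.2.1 * c z.2.2))

lemma weightDensity_swap_left {h : U × U × U → ℝ} (hsym : ∀ x y z, h (x, y, z) = h (y, x, z))
    (a b c : U → ℝ) : weightDensity ν h a b c = weightDensity ν h b a c := by
  let σ : U × U × U ≃ U × U × U :=
    ⟨fun z => (z.2.1, z.1, z.2.2), fun z => (z.2.1, z.1, z.2.2), fun _ => rfl, fun _ => rfl⟩
  rw [weightDensity, weightDensity, ← σ.sum_comp]
  refine Finset.sum_congr rfl fun z _ => ?_
  have : h (σ z) = h z := hsym _ _ _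
  rw [this]
  simp only [wt3, σ, Equiv.coe_fn_mk]
  ring

lemma weightDensity_swap_right {h : U × U × U → ℝ} (hsym : ∀ x y z, h (x, y, z) = h (x, z, y))
    (a b c : U → ℝ) : weightDensity ν h a b c = weightDensity ν h a c b := by
  let σ : U × U × U ≃ U × U × U :=
    ⟨fun z => (z.1, z.2.2, z.2.1), fun z => (z.1, z.2.2, z.2.1), fun _ => rfl, fun _ => rfl⟩
  rw [weightDensity, weightDensity, ← σ.sum_comp]
  refine Finset.sum_congr rfl fun z _ => ?_
  have : h (σ z) = h z := hsym _ _ _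
  rw [this]
  simp only [wt3, σ, Equiv.coe_fn_mk]
  ring

lemma weightDensity_le_one (hν : ∀ x, 0 ≤ ν x) {h : U × U × U → ℝ} (h1 : ∀ z, h z ≤ 1)
    {a b c : U → ℝ} (ha : ∀ x, 0 ≤ a x) (hb : ∀ x, 0 ≤ b x) (hc : ∀ x, 0 ≤ c x)
    (ha1 : ∑ x, ν x * a x = 1) (hb1 : ∑ x, ν x * b x = 1) (hc1 : ∑ x, ν x * c x = 1) :
    weightDensity ν h a b c ≤ 1 := by
  calc weightDensity ν h a b c ≤ ∑ z, wt3 ν z * (1 * (a z.1 * b z.2.1 * c z.2.2)) := by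
        refine Finset.sum_le_sum fun z _ => mul_le_mul_of_nonneg_left
          (mul_le_mul_of_nonneg_right (h1 z) ?_) ?_
        · exact mul_nonneg (mul_nonneg (ha _) (hb _)) (hc _)
        · exact mul_nonneg (hν _) (mul_nonneg (hν _) (hν _))
    _ = (∑ x, ν x * a x) * ((∑ x, ν x * b x) * (∑ x, ν x * c x)) := by
        simp_rw [Fintype.sum_prod_type, wt3, Finset.sum_mul_sum, Finset.mul_sum]
        refine Finset.sum_congr rfl fun x _ => Finset.sum_congr rfl fun y _ =>
          Finset.sum_congr rfl fun z _ => by ring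
    _ = 1 := by rw [ha1, hb1, hc1]; norm_num

lemma weightDensity_sum_smul {r : ℕ} (h : U × U × U → ℝ) (w : Fin r → U → ℝ) (t : ℝ) :
    (∑ z, wt3 ν z * (h z * ((t * ∑ i, w i z.1) * (t * ∑ i, w i z.2.1) * (t * ∑ i, w i z.2.2))))
      = t ^ 3 * ∑ i, ∑ j, ∑ l, weightDensity ν h (w i) (w j) (w l) := by
  have e : ∑ i, ∑ j, ∑ l, weightDensity ν h (w i) (w j) (w l)
      = ∑ z, ∑ i, ∑ j, ∑ l, wt3 ν z * (h z * (w i z.1 * w j z.2.1 * w l z.2.2)) := by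
    simp only [weightDensity]
    simp_rw [Finset.sum_comm (s := (Finset.univ : Finset (Fin r)))
      (t := (Finset.univ : Finset (U × U × U)))]
  rw [e, Finset.mul_sum]
  refine Finset.sum_congr rfl fun z _ => ?_
  simp_rw [← Finset.mul_sum, ← Finset.sum_mul, ← Finset.mul_sum, ← Finset.sum_mul]
  ring

lemma sum_weightDensity_ge [DecidableEq U] (hν : ∀ x, 0 ≤ ν x) {h : U × U × U → ℝ}
    (hdist : ∀ z, h z ≠ 0 → z.1 ≠ z.2.1 ∧ z.1 ≠ z.2.2 ∧ z.2.1 ≠ z.2.2) {d ε : ℝ} (hd : 0 ≤ d)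
    (hS : ∀ g : U → Bool, d * (∑ x, ν x * bi (g x)) ^ 3 - ε
      ≤ ∑ z, wt3 ν z * (h z * (bi (g z.1) * bi (g z.2.1) * bi (g z.2.2))))
    {r : ℕ} (hr : 0 < r) {τ : ℝ} (hτ : 0 < τ) {w : Fin r → U → ℝ} (hw0 : ∀ i x, 0 ≤ w i x)
    (hw1 : ∀ i, ∑ x, ν x * w i x = 1) (hwτ : ∀ i x, τ * w i x ≤ 1) :
    (d - ε / τ ^ 3) * r ^ 3 ≤ ∑ i, ∑ j, ∑ l, weightDensity ν h (w i) (w j) (w l) := by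
  have hr' : (0 : ℝ) < r := by exact_mod_cast hr
  have key := weighted_density hν hdist hd hS (f := fun x => τ / r * ∑ i, w i x)
    (fun x => mul_nonneg (by positivity) (Finset.sum_nonneg fun i _ => hw0 i x))
    (fun x => by
      rw [div_mul_eq_mul_div, div_le_one hr', Finset.mul_sum]
      calc _ ≤ ∑ _i : Fin r, (1 : ℝ) := Finset.sum_le_sum fun i _ => hwτ i x
        _ = r := by simp)
  rw [weightDensity_sum_smul] at key
  have e : ∑ x, ν x * (τ / r * ∑ i, w i x) = τ := by
    calc _ = τ / r * ∑ i, ∑ x, ν x * w i x := by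
          rw [Finset.sum_comm]
          simp_rw [Finset.mul_sum]
          exact Finset.sum_congr rfl fun x _ => Finset.sum_congr rfl fun i _ => by ring
      _ = τ := by simp only [hw1]; simp; field_simp
  rw [e] at key
  set s := ∑ i, ∑ j, ∑ l, weightDensity ν h (w i) (w j) (w l)
  have e2 : (d - ε / τ ^ 3) * r ^ 3 = (d * τ ^ 3 - ε) * (r / τ) ^ 3 := by field_simp
  have e3 : s = (τ / r) ^ 3 * s * (r / τ) ^ 3 := by field_simp
  rw [e2, e3]
  exact mul_le_mul_of_nonneg_right key (by positivity)

/-- Among sufficiently many weightings there are many all of whose triples are dense. -/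
theorem exists_dense_index (R : ℕ) {δ : ℝ} (hδ : 0 < δ) :
    ∃ M : ℕ, ∀ {U : Type} [Fintype U] [DecidableEq U] {ν : U → ℝ}, (∀ x, 0 ≤ ν x) →
      ∀ {h : U × U × U → ℝ}, (∀ z, h z ≤ 1) →
      (∀ z, h z ≠ 0 → z.1 ≠ z.2.1 ∧ z.1 ≠ z.2.2 ∧ z.2.1 ≠ z.2.2) →
      (∀ x y z, h (x, y, z) = h (y, x, z)) → (∀ x y z, h (x, y, z) = h (x, z, y)) →
      ∀ {d ε τ : ℝ}, δ ≤ d → 0 < τ → ε ≤ τ ^ 3 * (δ / 2) →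
      (∀ g : U → Bool, d * (∑ x, ν x * bi (g x)) ^ 3 - ε
        ≤ ∑ z, wt3 ν z * (h z * (bi (g z.1) * bi (g z.2.1) * bi (g z.2.2)))) →
      ∀ w : ℕ → U → ℝ, (∀ i x, 0 ≤ w i x) → (∀ i, ∑ x, ν x * w i x = 1) →
      (∀ i < M, ∀ x, τ * w i x ≤ 1) →
      ∃ I : Finset ℕ, R ≤ I.card ∧ (∀ i ∈ I, i < M) ∧ ∀ i ∈ I, ∀ j ∈ I, ∀ l ∈ I, i < j → j < l →
        d - δ ≤ weightDensity ν h (w i) (w j) (w l) := by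
  obtain ⟨r₀, hr₀⟩ := exists_nat_gt (6 / δ)
  set r := max (R + 1) r₀ with hr
  obtain ⟨M, hM⟩ := exists_homogeneous_triple Bool r
  refine ⟨M, ?_⟩
  intro U _ _ ν hν h h1 hdist hs1 hs2 d ε τ hd hτ hε hS w hw0 hw1 hwτ
  obtain ⟨J, hJM, hJ, a, ha⟩ := hM (Finset.range M) (by simp)
    (fun i j l => decide (d - δ ≤ weightDensity ν h (w i) (w j) (w l)))
  have hr0 : 0 < r := by omega
  have hr' : (0 : ℝ) < r := by exact_mod_cast hr0
  have hr6 : 6 / δ < r := hr₀.trans_le (by exact_mod_cast le_max_right _ _)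
  cases a with
  | true =>
    exact ⟨J, by omega, fun i hi => Finset.mem_range.1 (hJM hi),
      fun i hi j hj l hl hij hjl => by simpa using ha i hi j hj l hl hij hjl⟩
  | false =>
    exfalso
    let e := J.orderEmbOfFin hJ
    have heJ : ∀ i, e i ∈ J := fun i => J.orderEmbOfFin_mem hJ i
    let g : Fin r → Fin r → Fin r → ℝ := fun i j l =>
      weightDensity ν h (w (e i)) (w (e j)) (w (e l))
    have hinc : ∀ i j l, i < j → j < l → g i j l ≤ d - δ := by
      intro i j l hij hjl
      have := ha _ (heJ i) _ (heJ j) _ (heJ l) (e.strictMono hij) (e.strictMono hjl)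
      simp only [decide_eq_false_iff_not, not_le] at this
      exact this.le
    have g1 : ∀ i j l, g i j l = g j i l := fun i j l => weightDensity_swap_left hs1 _ _ _
    have g2 : ∀ i j l, g i j l = g i l j := fun i j l => weightDensity_swap_right hs2 _ _ _
    have hdis : ∀ i j l, i ≠ j → i ≠ l → j ≠ l → g i j l ≤ d - δ := by
      intro i j l hij hil hjl
      rcases lt_or_gt_of_ne hij with a1 | a1 <;> rcases lt_or_gt_of_ne hil with a2 | a2 <;>
        rcases lt_or_gt_of_ne hjl with a3 | a3
      · exact hinc _ _ _ a1 a3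
      · rw [g2]; exact hinc _ _ _ a2 a3
      · exact absurd (a1.trans a3) a2.le.not_gt
      · rw [g2, g1]; exact hinc _ _ _ a2 a1
      · rw [g1]; exact hinc _ _ _ a1 a2
      · exact absurd (a3.trans a1) a2.le.not_gt
      · rw [g1, g2]; exact hinc _ _ _ a3 a2
      · rw [g1, g2, g1]; exact hinc _ _ _ a3 a1
    have hle : ∀ i j l, g i j l ≤ (d - δ + 1) - if i ≠ j ∧ i ≠ l ∧ j ≠ l then 1 else 0 := by
      intro i j l
      split_ifs with hc
      · linarith [hdis i j l hc.1 hc.2.1 hc.2.2]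
      · have : g i j l ≤ 1 := weightDensity_le_one hν h1 (hw0 _) (hw0 _) (hw0 _) (hw1 _) (hw1 _)
          (hw1 _)
        linarith
    have hup : ∑ i, ∑ j, ∑ l, g i j l ≤ (d - δ) * r ^ 3 + 3 * r ^ 2 := by
      calc _ ≤ ∑ i : Fin r, ∑ j : Fin r, ∑ l : Fin r,
            ((d - δ + 1) - if i ≠ j ∧ i ≠ l ∧ j ≠ l then (1 : ℝ) else 0) :=
            Finset.sum_le_sum fun i _ => Finset.sum_le_sum fun j _ =>
              Finset.sum_le_sum fun l _ => hle i j l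
        _ = (d - δ + 1) * r ^ 3
            - ∑ i : Fin r, ∑ j : Fin r, ∑ l : Fin r,
              if i ≠ j ∧ i ≠ l ∧ j ≠ l then (1 : ℝ) else 0 := by
            simp_rw [Finset.sum_sub_distrib]
            congr 1
            simp only [Finset.sum_const, Finset.card_univ, Fintype.card_fin, nsmul_eq_mul]
            ring
        _ ≤ _ := by linarith [card_distinct_triples_ge r]
    have hlow := sum_weightDensity_ge hν hdist (hδ.le.trans hd) hS hr0 hτ
      (w := fun i => w (e i)) (fun i => hw0 _) (fun i => hw1 _)
      (fun i => hwτ _ (Finset.mem_range.1 (hJM (heJ i))))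
    have hετ : ε / τ ^ 3 ≤ δ / 2 := by
      rw [div_le_iff₀ (by positivity)]; linarith
    rw [div_lt_iff₀ hδ] at hr6
    have h3 : (d - δ / 2) * r ^ 3 ≤ (d - δ) * r ^ 3 + 3 * r ^ 2 :=
      (mul_le_mul_of_nonneg_right (by linarith) (by positivity)).trans (hlow.trans hup)
    nlinarith [mul_pos (pow_pos hr' 2) (sub_pos.2 hr6)]

end WeightedDensity

/-- If every dense ternary relation on `m` colours admits a member of `𝓕`, then every ternary
function which is dense on all vertex subsets has many copies of a member of `𝓕`. -/
theorem exists_count_of_uniformly_dense {k m : ℕ} (𝓕 : Finset (Finset (Fin k × Fin k × Fin k)))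
    (h𝓕 : ∀ s ∈ 𝓕, ∀ e ∈ s, e.1 < e.2.1 ∧ e.2.1 < e.2.2) {d δ : ℝ} (hδ : 0 < δ) (hδ1 : δ ≤ 1)
    (hd : 7 * δ ≤ d) (hm : 0 < m) (hmδ : 3 / (m : ℝ) ≤ δ)
    (hadm : ∀ Q : Fin m → Fin m → Fin m → Bool,
      (d - 7 * δ) * m ^ 3 ≤ ∑ a, ∑ b, ∑ c, bi (Q a b c) →
      ∃ s ∈ 𝓕, ∃ φ : Sym2 (Fin k) → Fin m, ∀ e ∈ s, edgeOk Q e φ = true) :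
    ∃ η > 0, ∃ ε > 0, ∀ {U : Type} [Fintype U] [DecidableEq U] (ν : U → ℝ), IsProb ν →
      (∀ x, 0 < ν x) → ∀ h : U × U × U → ℝ, (∀ z, 0 ≤ h z) → (∀ z, h z ≤ 1) →
      (∀ z, h z ≠ 0 → z.1 ≠ z.2.1 ∧ z.1 ≠ z.2.2 ∧ z.2.1 ≠ z.2.2) →
      (∀ x y z, h (x, y, z) = h (y, x, z)) → (∀ x y z, h (x, y, z) = h (x, z, y)) →
      (∀ g : U → Bool, d * (∑ x, ν x * bi (g x)) ^ 3 - ε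
        ≤ ∑ z, wt3 ν z * (h z * (bi (g z.1) * bi (g z.2.1) * bi (g z.2.2)))) →
      ∃ s ∈ 𝓕, η < pexp (fun _ : Fin k => ν) (fun x => ∏ e ∈ s, edgeVal h e x) := by
  obtain ⟨ρ, hρ, M₀, hM₀⟩ := exists_dense_in_reduced 𝓕 h𝓕 (D := d - 5 * δ) hδ hδ1
    (by linarith) hm hmδ (fun Q hQ => hadm Q (by convert hQ using 2; ring))
  obtain ⟨M, hM⟩ := exists_dense_index M₀ hδ
  set S := Fintype.card (Fin k × Fin k × Fin k)
  obtain ⟨η₀, hη₀, τ, hτ, hred⟩ := exists_reduced 𝓕 h𝓕 M (η := δ ^ S * ρ / 2) (by positivity) hδ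
  refine ⟨η₀, hη₀, τ ^ 3 * (δ / 2), by positivity, ?_⟩
  intro U _ _ ν hν hpos h h0 h1 hdist hs1 hs2 hS
  by_contra! hcon
  obtain ⟨K, μ, p, w, hμ, hp0, hp1, hw0, hw1, hwτ, hgp, hcount⟩ := hred ν hν hpos h h0 h1 hcon
  obtain ⟨I, hI, hIM, hdense⟩ := hM hν.1 h1 hdist hs1 hs2 (by linarith) hτ le_rfl hS w hw0 hw1 hwτ
  obtain ⟨F, hF, hFI, s, hs, hρs⟩ := hM₀ (fun a b c => decide (δ ≤ p a b c)) μ hμ I hI (by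
    intro i hi j hj l hl hij hjl
    have h2 := (abs_le.1 (hgp i j l hij hjl (hIM l hl))).2
    have h3 := hdense i hi j hj l hl hij hjl
    rw [weightDensity] at h3
    have h4 : triDensity (μ s(i, j)) (μ s(i, l)) (μ s(j, l)) (fun a b c => p a b c + -δ)
        ≤ triDensity (μ s(i, j)) (μ s(i, l)) (μ s(j, l))
          (fun a b c => bi (decide (δ ≤ p a b c))) :=
      triDensity_mono (hμ _) (hμ _) (hμ _) fun a b c => by
        by_cases hab : δ ≤ p a b c
        · simp only [hab, decide_true, bi]
          simpa using by linarith [hp1 a b c]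
        · simp only [hab, decide_false, bi]
          simpa using (not_le.1 hab).le
    rw [triDensity_add_const (hμ _) (hμ _) (hμ _)] at h4
    linarith)
  have h5 := hcount F hF (fun x => hIM _ (hFI x)) s hs
  have h6 : δ ^ s.card * pexp (fun a : Sym2 (Fin k) => μ (a.map F))
      (fun ω => ∏ e ∈ s, bi (edgeOk (fun a b c => decide (δ ≤ p a b c)) e ω))
      ≤ pexp (fun a : Sym2 (Fin k) => μ (a.map F)) (fun ω => ∏ e ∈ s, colVal p e ω) := by
    rw [← pexp_const_mul]
    refine pexp_mono (fun a => hμ _) fun ω => ?_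
    rw [← Finset.prod_const, ← Finset.prod_mul_distrib]
    refine Finset.prod_le_prod (fun e _ => mul_nonneg hδ.le (bi_nonneg _)) fun e _ => ?_
    simp only [edgeOk, colVal, bi]
    by_cases hc : δ ≤ p (ω s(e.1, e.2.1)) (ω s(e.1, e.2.2)) (ω s(e.2.1, e.2.2))
    · simp [hc]
    · simpa [hc] using hp0 _ _ _
  have h7 : δ ^ S ≤ δ ^ s.card := pow_le_pow_of_le_one hδ.le hδ1 (Finset.card_le_univ s)
  have h8 : δ ^ S * ρ ≤ δ ^ S * ρ / 2 := by
    calc δ ^ S * ρ ≤ δ ^ s.card * ρ := mul_le_mul_of_nonneg_right h7 hρ.le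
      _ ≤ _ := mul_le_mul_of_nonneg_left hρs (by positivity)
      _ ≤ _ := h6.trans h5
  have : 0 < δ ^ S * ρ := by positivity
  linarith

lemma exists_increasing_triple {α β : Type} [DecidableEq α] [LinearOrder β] {f : α → β}
    (hf : Function.Injective f) {e : Finset α} (he : e.card = 3) :
    ∃ u v w, f u < f v ∧ f v < f w ∧ e = {u, v, w} := by
  obtain ⟨a, b, c, hab, hac, hbc, rfl⟩ := Finset.card_eq_three.1 he
  rcases lt_or_gt_of_ne (hf.ne hab) with h1 | h1 <;>
    rcases lt_or_gt_of_ne (hf.ne hac) with h2 | h2 <;>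
    rcases lt_or_gt_of_ne (hf.ne hbc) with h3 | h3
  · exact ⟨a, b, c, h1, h3, rfl⟩
  · exact ⟨a, c, b, h2, h3, by ext; simp; tauto⟩
  · exact absurd (h1.trans h3) h2.le.not_gt
  · exact ⟨c, a, b, h2, h1, by ext; simp; tauto⟩
  · exact ⟨b, a, c, h1, h2, by ext; simp; tauto⟩
  · exact absurd (h3.trans h1) h2.le.not_gt
  · exact ⟨b, c, a, h3, h2, by ext; simp; tauto⟩
  · exact ⟨c, b, a, h3, h1, by ext; simp; tauto⟩

lemma card_permuted_triples {α : Type} [DecidableEq α] {a b c : α} (hab : a ≠ b) (hac : a ≠ c)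
    (hbc : b ≠ c) :
    ({(a, b, c), (a, c, b), (b, a, c), (b, c, a), (c, a, b), (c, b, a)} :
      Finset (α × α × α)).card = 6 := by
  repeat rw [Finset.card_insert_of_notMem (by simp [hab, hac, hbc, hab.symm, hac.symm, hbc.symm])]
  rw [Finset.card_singleton]

lemma six_le_card_ordered_triples {α : Type} [Fintype α] [DecidableEq α] {e : Finset α}
    (he : e.card = 3) :
    6 ≤ (Finset.univ.filter fun z : α × α × α => ({z.1, z.2.1, z.2.2} : Finset α) = e).card := by
  obtain ⟨a, b, c, hab, hac, hbc, h0⟩ := Finset.card_eq_three.1 he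
  rw [← card_permuted_triples hab hac hbc]
  refine Finset.card_le_card fun z hz => Finset.mem_filter.2 ⟨Finset.mem_univ _, ?_⟩
  simp only [Finset.mem_insert, Finset.mem_singleton] at hz
  rw [h0]
  rcases hz with h | h | h | h | h | h <;> rw [h] <;> ext t <;>
    simp only [Finset.mem_insert, Finset.mem_singleton] <;> tauto

lemma six_mul_choose_three_ge (s : ℕ) : (s : ℝ) ^ 3 - 3 * s ^ 2 ≤ 6 * (s.choose 3 : ℝ) := by
  have h := Nat.descFactorial_eq_factorial_mul_choose s 3
  have h2 : (6 : ℝ) * (s.choose 3 : ℝ) = (s.descFactorial 3 : ℝ) := by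
    rw [h]; push_cast; norm_num [Nat.factorial]
  rw [h2]
  rcases Nat.lt_or_ge s 2 with hs | hs
  · interval_cases s <;> norm_num [Nat.descFactorial]
  · obtain ⟨t, rfl⟩ := Nat.exists_eq_add_of_le hs
    have : (2 + t).descFactorial 3 = t * ((t + 1) * (t + 2)) := by
      simp only [Nat.descFactorial]
      have e1 : 2 + t - 2 = t := by omega
      have e2 : 2 + t - 1 = t + 1 := by omega
      rw [e1, e2, Nat.sub_zero]; ring
    rw [this]
    push_cast
    nlinarith [(Nat.cast_nonneg t : (0 : ℝ) ≤ t)]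

namespace Hypergraph3

/-- The indicator function of the edges on ordered triples of vertices. -/
noncomputable def edgeInd (H : Hypergraph3) (z : H.verts × H.verts × H.verts) : ℝ :=
  if ({z.1.1, z.2.1.1, z.2.2.1} : Finset ℕ) ∈ H.edges then 1 else 0

lemma edgeInd_nonneg (H : Hypergraph3) (z) : 0 ≤ H.edgeInd z := by
  unfold edgeInd; split_ifs <;> simp

lemma edgeInd_le_one (H : Hypergraph3) (z) : H.edgeInd z ≤ 1 := by
  unfold edgeInd; split_ifs <;> simp

lemma mem_edges_of_edgeInd_ne_zero (H : Hypergraph3) {z} (hz : H.edgeInd z ≠ 0) :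
    ({z.1.1, z.2.1.1, z.2.2.1} : Finset ℕ) ∈ H.edges := by
  by_contra h
  simp [edgeInd, h] at hz

lemma ne_of_edgeInd_ne_zero (H : Hypergraph3) {z} (hz : H.edgeInd z ≠ 0) :
    z.1 ≠ z.2.1 ∧ z.1 ≠ z.2.2 ∧ z.2.1 ≠ z.2.2 := by
  have h := H.edges_card _ (H.mem_edges_of_edgeInd_ne_zero hz)
  have h2 : ∀ a b : ℕ, ({a, b} : Finset ℕ).card ≠ 3 := fun a b =>
    ((Finset.card_le_two).trans_lt (by norm_num)).ne
  refine ⟨fun e => ?_, fun e => ?_, fun e => ?_⟩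
  · rw [e, Finset.insert_eq_of_mem (by simp)] at h
    exact h2 _ _ h
  · rw [e, Finset.insert_eq_of_mem (by simp)] at h
    exact h2 _ _ h
  · rw [e, Finset.insert_eq_of_mem (a := (z.2.2 : ℕ)) (by simp)] at h
    exact h2 _ _ h

lemma edgeInd_swap_left (H : Hypergraph3) (x y z) : H.edgeInd (x, y, z) = H.edgeInd (y, x, z) := by
  simp only [edgeInd, Finset.insert_comm (x : ℕ) (y : ℕ)]

lemma edgeInd_swap_right (H : Hypergraph3) (x y z) :
    H.edgeInd (x, y, z) = H.edgeInd (x, z, y) := by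
  simp only [edgeInd, Finset.pair_comm (y : ℕ) (z : ℕ)]

lemma six_mul_card_edges_le (H : Hypergraph3) (g : H.verts → Bool) :
    6 * ((H.edges.filter fun e => e ⊆ (Finset.univ.filter fun x => g x = true).map
        (Function.Embedding.subtype _)).card : ℝ)
      ≤ ∑ z, H.edgeInd z * (bi (g z.1) * bi (g z.2.1) * bi (g z.2.2)) := by
  classical
  set S := (Finset.univ.filter fun x => g x = true).map (Function.Embedding.subtype _) with hS
  set T := H.edges.filter fun e => e ⊆ S with hT
  let D : Finset (H.verts × H.verts × H.verts) := Finset.univ.filter fun z =>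
    ({z.1.1, z.2.1.1, z.2.2.1} : Finset ℕ) ∈ T
  have hmap : ∀ z ∈ D, ({z.1.1, z.2.1.1, z.2.2.1} : Finset ℕ) ∈ T := fun z hz =>
    (Finset.mem_filter.1 hz).2
  have hfib : ∀ e ∈ T, 6 ≤ (D.filter fun z => ({z.1.1, z.2.1.1, z.2.2.1} : Finset ℕ) = e).card := by
    intro e he
    have heH := (Finset.mem_filter.1 he).1
    obtain ⟨e', rfl⟩ : ∃ e' : Finset H.verts, e'.map (Function.Embedding.subtype _) = e :=
      ⟨e.subtype (· ∈ H.verts), Finset.subtype_map_of_mem (H.edges_sub e heH)⟩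
    have hc : e'.card = 3 := by rw [← H.edges_card _ heH, Finset.card_map]
    refine (six_le_card_ordered_triples hc).trans (Finset.card_le_card fun z hz => ?_)
    have hz' := (Finset.mem_filter.1 hz).2
    have : ({z.1.1, z.2.1.1, z.2.2.1} : Finset ℕ) = e'.map (Function.Embedding.subtype _) := by
      rw [← hz']; simp
    simp only [D, Finset.mem_filter, Finset.mem_univ, true_and]
    exact ⟨this ▸ he, this⟩
  have hcard : T.card * 6 ≤ D.card := by
    rw [Finset.card_eq_sum_card_fiberwise hmap]
    simpa using Finset.card_nsmul_le_sum T _ 6 hfib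
  calc 6 * (T.card : ℝ) ≤ D.card := by
        have : ((T.card * 6 : ℕ) : ℝ) ≤ D.card := by exact_mod_cast hcard
        push_cast at this
        linarith
    _ = ∑ z, if z ∈ D then (1 : ℝ) else 0 := by simp
    _ ≤ _ := Finset.sum_le_sum fun z _ => by
        split_ifs with hz
        · have h1 := Finset.mem_filter.1 (hmap z hz)
          have h2 : ∀ x : H.verts, (x : ℕ) ∈ S → g x = true := fun x hx => by
            simpa [hS] using hx
          have e1 := h2 z.1 (h1.2 (by simp))
          have e2 := h2 z.2.1 (h1.2 (by simp))
          have e3 := h2 z.2.2 (h1.2 (by simp))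
          simp [edgeInd, h1.1, e1, e2, e3, bi]
        · exact mul_nonneg (H.edgeInd_nonneg z)
            (mul_nonneg (mul_nonneg (bi_nonneg _) (bi_nonneg _)) (bi_nonneg _))

lemma UniformlyDense.sum_edgeInd_ge {H : Hypergraph3} {d ε : ℝ} (hH : H.UniformlyDense d ε)
    (hd0 : 0 ≤ d) (hd1 : d ≤ 1) (hn : 0 < H.verts.card) (g : H.verts → Bool) :
    d * (∑ x, ((H.verts.card : ℝ)⁻¹) * bi (g x)) ^ 3 - (6 * ε + 3 / H.verts.card)
      ≤ ∑ z, wt3 (fun _ => (H.verts.card : ℝ)⁻¹) z *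
        (H.edgeInd z * (bi (g z.1) * bi (g z.2.1) * bi (g z.2.2))) := by
  have h6 := H.six_mul_card_edges_le g
  set S := (Finset.univ.filter fun x => g x = true).map (Function.Embedding.subtype _) with hS
  have hSV : S ⊆ H.verts := fun x hx => by
    obtain ⟨y, _, rfl⟩ := Finset.mem_map.1 hx
    exact y.2
  have hD := hH S hSV
  have hsn : (S.card : ℝ) ≤ H.verts.card := by exact_mod_cast Finset.card_le_card hSV
  set n : ℝ := (H.verts.card : ℝ) with hn'
  have hn0 : 0 < n := by rw [hn']; exact_mod_cast hn
  have hsum : ∑ x, n⁻¹ * bi (g x) = n⁻¹ * S.card := by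
    rw [← Finset.mul_sum]
    congr 1
    rw [hS, Finset.card_map, Finset.card_filter]
    push_cast
    exact Finset.sum_congr rfl fun x _ => by cases g x <;> simp [bi]
  have hsum3 : ∑ z, wt3 (fun _ => n⁻¹) z *
      (H.edgeInd z * (bi (g z.1) * bi (g z.2.1) * bi (g z.2.2)))
      = n⁻¹ ^ 3 * ∑ z, H.edgeInd z * (bi (g z.1) * bi (g z.2.1) * bi (g z.2.2)) := by
    rw [Finset.mul_sum]
    exact Finset.sum_congr rfl fun z _ => by simp only [wt3]; ring
  rw [hsum, hsum3]
  set s : ℝ := (S.card : ℝ) with hs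
  have hs0 : 0 ≤ s := Nat.cast_nonneg _
  have hch := six_mul_choose_three_ge S.card
  have h7 : d * s ^ 3 - (6 * ε * n ^ 3 + 3 * n ^ 2)
      ≤ ∑ z, H.edgeInd z * (bi (g z.1) * bi (g z.2.1) * bi (g z.2.2)) := by
    have h8 : d * (s ^ 3 - 3 * s ^ 2) ≤ d * (6 * (S.card.choose 3 : ℝ)) :=
      mul_le_mul_of_nonneg_left hch hd0
    have h9 : s ^ 2 ≤ n ^ 2 := by gcongr
    have h10 : d * s ^ 2 ≤ 1 * s ^ 2 := mul_le_mul_of_nonneg_right hd1 (by positivity)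
    linarith
  calc d * (n⁻¹ * s) ^ 3 - (6 * ε + 3 / n)
      = n⁻¹ ^ 3 * (d * s ^ 3 - (6 * ε * n ^ 3 + 3 * n ^ 2)) := by field_simp
    _ ≤ _ := mul_le_mul_of_nonneg_left h7 (by positivity)

end Hypergraph3

lemma exists_injective_of_lt_pexp {k : ℕ} {U : Type} [Fintype U] [DecidableEq U] {ν : U → ℝ}
    (hν : IsProb ν) {m : ℝ} (hm : ∀ x, ν x ≤ m) {f : (Fin k → U) → ℝ} (hf : ∀ x, f x ≤ 1)
    (h : k ^ 2 * m < pexp (fun _ : Fin k => ν) f) :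
    ∃ x : Fin k → U, Function.Injective x ∧ 0 < f x := by
  have hpair : ∀ i j : Fin k, i ≠ j →
      pexp (fun _ : Fin k => ν) (fun x => if x i = x j then (1 : ℝ) else 0) ≤ m := by
    intro i j hij
    rw [← pexp_avg i hν.2]
    calc _ ≤ pexp (fun _ : Fin k => ν) (fun _ => m) := pexp_mono (fun _ => hν) fun x => by
          simpa [Function.update_of_ne hij.symm] using hm (x j)
      _ = m := pexp_const (fun _ => hν) m
  have hm0 : 0 ≤ m := by
    obtain ⟨u⟩ := hν.nonempty
    exact (hν.1 u).trans (hm u)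
  have hsum : pexp (fun _ : Fin k => ν)
      (fun x => ∑ i, ∑ j, if i ≠ j ∧ x i = x j then (1 : ℝ) else 0)
      ≤ k ^ 2 * m := by
    rw [pexp_sum]
    simp_rw [pexp_sum]
    calc _ ≤ ∑ _i : Fin k, ∑ _j : Fin k, m := by
          refine Finset.sum_le_sum fun i _ => Finset.sum_le_sum fun j _ => ?_
          by_cases hij : i = j
          · simpa [hij, pexp] using hm0
          · simpa [hij] using hpair i j hij
      _ = k ^ 2 * m := by simp; ring
  have hlt : 0 < pexp (fun _ : Fin k => ν)
      (fun x => f x - ∑ i, ∑ j, if i ≠ j ∧ x i = x j then (1 : ℝ) else 0) := by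
    rw [pexp_sub]; linarith
  obtain ⟨x, hx⟩ := exists_le_of_pexp_le (fun _ => hν) le_rfl
    (f := fun x => f x - ∑ i, ∑ j, if i ≠ j ∧ x i = x j then (1 : ℝ) else 0)
  have hx' := hlt.trans_le hx
  have hterm : ∀ i j, (0 : ℝ) ≤ if i ≠ j ∧ x i = x j then (1 : ℝ) else 0 := fun i j => by
    split_ifs <;> simp
  refine ⟨x, fun i j hij => ?_, ?_⟩
  · by_contra hne
    have h1 : (1 : ℝ) ≤ ∑ i, ∑ j, if i ≠ j ∧ x i = x j then (1 : ℝ) else 0 := by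
      calc (1 : ℝ) = if i ≠ j ∧ x i = x j then (1 : ℝ) else 0 := by simp [hne, hij]
        _ ≤ ∑ j, if i ≠ j ∧ x i = x j then (1 : ℝ) else 0 :=
          Finset.single_le_sum (f := fun j => if i ≠ j ∧ x i = x j then (1 : ℝ) else 0)
            (fun j _ => hterm i j) (Finset.mem_univ j)
        _ ≤ _ := Finset.single_le_sum
            (f := fun i => ∑ j, if i ≠ j ∧ x i = x j then (1 : ℝ) else 0)
            (fun i _ => Finset.sum_nonneg fun j _ => hterm i j) (Finset.mem_univ i)
    linarith [hf x]
  · have : 0 ≤ ∑ i, ∑ j, if i ≠ j ∧ x i = x j then (1 : ℝ) else 0 :=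
      Finset.sum_nonneg fun i _ => Finset.sum_nonneg fun j _ => hterm i j
    linarith

/-- The palette of a ternary relation on `Fin m`. -/
def paletteOfRel {m : ℕ} (hm : 0 < m) (Q : Fin m → Fin m → Fin m → Bool) : Palette ℕ where
  colors := Finset.range m
  nonempty := ⟨0, Finset.mem_range.2 hm⟩
  triples := (Finset.univ.filter fun t : Fin m × Fin m × Fin m => Q t.1 t.2.1 t.2.2 = true).image
    fun t => (t.1.1, t.2.1.1, t.2.2.1)
  triples_sub := by
    intro t ht
    obtain ⟨s, _, rfl⟩ := Finset.mem_image.1 ht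
    simp

lemma paletteOfRel_density {m : ℕ} (hm : 0 < m) (Q : Fin m → Fin m → Fin m → Bool) :
    (paletteOfRel hm Q).density = (∑ a, ∑ b, ∑ c, bi (Q a b c)) / m ^ 3 := by
  rw [Palette.density]
  congr 1
  · simp only [paletteOfRel]
    rw [Finset.card_image_of_injective, Finset.card_filter]
    · push_cast
      simp_rw [Fintype.sum_prod_type]
      refine Finset.sum_congr rfl fun a _ => Finset.sum_congr rfl fun b _ =>
        Finset.sum_congr rfl fun c _ => ?_
      cases Q a b c <;> simp [bi]
    · rintro ⟨a, b, c⟩ ⟨a', b', c'⟩ h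
      simp only [Prod.mk.injEq, Fin.val_inj] at h ⊢
      exact h
  · simp [paletteOfRel]

lemma mem_paletteOfRel_triples {m : ℕ} (hm : 0 < m) (Q : Fin m → Fin m → Fin m → Bool)
    (a b c : Fin m) : (a.1, b.1, c.1) ∈ (paletteOfRel hm Q).triples ↔ Q a b c = true := by
  simp only [paletteOfRel, Finset.mem_image, Finset.mem_filter, Finset.mem_univ, true_and]
  constructor
  · rintro ⟨⟨a', b', c'⟩, hQ, h⟩
    simp only [Prod.mk.injEq, Fin.val_inj] at h
    obtain ⟨rfl, rfl, rfl⟩ := h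
    exact hQ
  · exact fun h => ⟨(a, b, c), h, rfl⟩

lemma exists_enumeration {V : Type} [Fintype V] {r : V → V → Prop}
    (hr : IsStrictTotalOrder V r) :
    ∃ σ : V ≃ Fin (Fintype.card V), ∀ u v, r u v ↔ σ u < σ v := by
  classical
  let : LinearOrder V := linearOrderOfSTO r
  exact ⟨(Fintype.orderIsoFinOfCardEq V rfl).symm.toEquiv, fun u v =>
    ((Fintype.orderIsoFinOfCardEq V rfl).symm.lt_iff_lt (x := u) (y := v)).symm⟩

section Patterns

variable {V : Type} [Fintype V] [DecidableEq V]

open Classical in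
/-- The edges of a hypergraph as increasing triples, with respect to an enumeration of the
vertices. -/
noncomputable def orderedEdges {k : ℕ} (E : Set (Finset V)) (σ : V ≃ Fin k) :
    Finset (Fin k × Fin k × Fin k) :=
  Finset.univ.filter fun e => e.1 < e.2.1 ∧ e.2.1 < e.2.2 ∧
    ({σ.symm e.1, σ.symm e.2.1, σ.symm e.2.2} : Finset V) ∈ E

/-- A density above which every palette is admitted forces a copy of the hypergraph. -/
theorem contains_of_forall_admits {E : Set (Finset V)} (hE : ∀ e ∈ E, e.card = 3) {d δ : ℝ}
    (hδ : 0 < δ) (hd : 7 * δ ≤ d) (hd1 : d ≤ 1)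
    (hadm : ∀ P : Palette ℕ, d - 7 * δ ≤ P.density → P.Admits E) :
    ∃ ε > (0 : ℝ), ∃ N : ℕ, ∀ H : Hypergraph3, N ≤ H.verts.card → H.UniformlyDense d ε →
      H.Contains E := by
  classical
  set k := Fintype.card V with hk
  obtain ⟨m, hm⟩ := exists_nat_gt (3 / δ)
  have hm0' : (0 : ℝ) < m := lt_trans (by positivity) hm
  have hm0 : 0 < m := by exact_mod_cast hm0'
  obtain ⟨η, hη, ε, hε, hmain⟩ := exists_count_of_uniformly_dense (k := k) (m := m)
    (Finset.univ.image (orderedEdges E)) (by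
      intro s hs e he
      obtain ⟨σ, _, rfl⟩ := Finset.mem_image.1 hs
      have := (Finset.mem_filter.1 he).2
      exact ⟨this.1, this.2.1⟩)
    (d := d) hδ (by linarith) hd hm0
    (by rw [div_le_iff₀ hm0', mul_comm, ← div_le_iff₀ hδ]; exact hm.le) (by
      intro Q hQ
      obtain ⟨r, hr, φ, hφ, hrφ⟩ := hadm (paletteOfRel hm0 Q) (by
        rw [paletteOfRel_density, le_div_iff₀ (by positivity)]
        exact hQ)
      obtain ⟨σ, hσ⟩ := exists_enumeration hr
      refine ⟨orderedEdges E σ, Finset.mem_image_of_mem _ (Finset.mem_univ σ),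
        fun p => ⟨φ (p.map σ.symm), Finset.mem_range.1 (hφ _)⟩, fun e he => ?_⟩
      obtain ⟨h1, h2, h3⟩ := (Finset.mem_filter.1 he).2
      rw [edgeOk, ← mem_paletteOfRel_triples hm0]
      exact hrφ _ _ _ ((hσ _ _).2 (by simpa using h1)) ((hσ _ _).2 (by simpa using h2)) h3)
  obtain ⟨N₁, hN₁⟩ := exists_nat_gt (6 / ε)
  obtain ⟨N₂, hN₂⟩ := exists_nat_gt (k ^ 2 / η)
  refine ⟨ε / 12, by positivity, N₁ + N₂ + 1, fun H hH hHd => ?_⟩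
  set n : ℝ := (H.verts.card : ℝ) with hn
  have hnN : (N₁ + N₂ + 1 : ℝ) ≤ n := by rw [hn]; exact_mod_cast hH
  have hN₁0 : (0 : ℝ) ≤ N₁ := Nat.cast_nonneg _
  have hN₂0 : (0 : ℝ) ≤ N₂ := Nat.cast_nonneg _
  have hn0 : 0 < n := by linarith
  have hν : IsProb (fun _ : H.verts => n⁻¹) := by
    refine ⟨fun _ => by positivity, ?_⟩
    rw [Finset.sum_const, Finset.card_univ, Fintype.card_coe, nsmul_eq_mul]
    exact mul_inv_cancel₀ hn0.ne'
  have h3n : 3 / n ≤ ε / 2 := by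
    rw [div_lt_iff₀ hε] at hN₁
    rw [div_le_iff₀ hn0]
    nlinarith
  obtain ⟨s, hs, hcount⟩ := hmain (fun _ : H.verts => n⁻¹) hν (fun _ => by positivity) H.edgeInd
    H.edgeInd_nonneg H.edgeInd_le_one (fun _ => H.ne_of_edgeInd_ne_zero) H.edgeInd_swap_left
    H.edgeInd_swap_right (fun g => by
      refine le_trans ?_ (hHd.sum_edgeInd_ge (by linarith) hd1 (by omega) g)
      linarith)
  obtain ⟨σ, _, rfl⟩ := Finset.mem_image.1 hs
  obtain ⟨x, hx, hx0⟩ := exists_injective_of_lt_pexp hν (m := n⁻¹) (fun _ => le_rfl)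
    (f := fun x => ∏ e ∈ orderedEdges E σ, edgeVal H.edgeInd e x)
    (fun x => Finset.prod_le_one (fun e _ => H.edgeInd_nonneg _) fun e _ => H.edgeInd_le_one _)
    (by
      refine lt_of_le_of_lt ?_ hcount
      rw [← div_eq_mul_inv, div_le_iff₀ hn0]
      rw [div_lt_iff₀ hη] at hN₂
      nlinarith)
  refine ⟨fun v => (x (σ v)).1, Subtype.val_injective.comp (hx.comp σ.injective),
    fun v => (x (σ v)).2, fun e he => ?_⟩
  obtain ⟨u, v, w, huv, hvw, rfl⟩ := exists_increasing_triple σ.injective (hE e he)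
  have hmem : (σ u, σ v, σ w) ∈ orderedEdges E σ :=
    Finset.mem_filter.2 ⟨Finset.mem_univ _, huv, hvw, by simpa using he⟩
  have hne := Finset.prod_ne_zero_iff.1 hx0.ne' _ hmem
  have := H.mem_edges_of_edgeInd_ne_zero hne
  simpa [Finset.image_insert] using this

end Patterns

section CutNorm

variable {X : Type} [Fintype X]

lemma pow_four_bilinear_le {g : X → X → ℝ} {u v : X → ℝ} (hu : ∀ x, |u x| ≤ 1)
    (hv : ∀ x, |v x| ≤ 1) :
    (∑ x, ∑ y, g x y * (u x * v y)) ^ 4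
      ≤ (Fintype.card X : ℝ) ^ 4 * ∑ y, ∑ y', (∑ x, g x y * g x y') ^ 2 := by
  set n : ℝ := (Fintype.card X : ℝ) with hn
  have hsq : ∀ {w : X → ℝ}, (∀ x, |w x| ≤ 1) → ∑ x, w x ^ 2 ≤ n := fun hw => by
    calc _ ≤ ∑ _x : X, (1 : ℝ) := Finset.sum_le_sum fun x _ => (sq_le_one_iff_abs_le_one _).2 (hw x)
      _ = n := by simp [hn]
  have hn0 : 0 ≤ n := Nat.cast_nonneg _
  set G : X → ℝ := fun x => ∑ y, g x y * v y with hG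
  have e1 : ∑ x, ∑ y, g x y * (u x * v y) = ∑ x, u x * G x := by
    simp only [hG, Finset.mul_sum]
    exact Finset.sum_congr rfl fun x _ => Finset.sum_congr rfl fun y _ => by ring
  have h1 : (∑ x, u x * G x) ^ 2 ≤ n * ∑ x, G x ^ 2 :=
    (Finset.sum_mul_sq_le_sq_mul_sq _ _ _).trans
      (mul_le_mul_of_nonneg_right (hsq hu) (Finset.sum_nonneg fun x _ => sq_nonneg _))
  have e2 : ∑ x, G x ^ 2 = ∑ p : X × X, (v p.1 * v p.2) * ∑ x, g x p.1 * g x p.2 := by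
    simp only [hG, sq, Finset.sum_mul_sum, Fintype.sum_prod_type]
    simp only [Finset.mul_sum]
    rw [Finset.sum_comm]
    refine Finset.sum_congr rfl fun y _ => ?_
    rw [Finset.sum_comm]
    exact Finset.sum_congr rfl fun y' _ => Finset.sum_congr rfl fun x _ => by ring
  have h2 : (∑ x, G x ^ 2) ^ 2 ≤ n ^ 2 * ∑ y, ∑ y', (∑ x, g x y * g x y') ^ 2 := by
    rw [e2, ← Fintype.sum_prod_type (f := fun p : X × X => (∑ x, g x p.1 * g x p.2) ^ 2)]
    refine (Finset.sum_mul_sq_le_sq_mul_sq _ _ _).trans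
      (mul_le_mul_of_nonneg_right ?_ (Finset.sum_nonneg fun x _ => sq_nonneg _))
    calc ∑ p : X × X, (v p.1 * v p.2) ^ 2 = (∑ x, v x ^ 2) * ∑ x, v x ^ 2 := by
          simp only [Fintype.sum_prod_type, Finset.sum_mul_sum, mul_pow]
      _ ≤ n * n := mul_le_mul (hsq hv) (hsq hv) (Finset.sum_nonneg fun x _ => sq_nonneg _) hn0
      _ = n ^ 2 := by ring
  rw [e1]
  calc (∑ x, u x * G x) ^ 4 = ((∑ x, u x * G x) ^ 2) ^ 2 := by ring
    _ ≤ (n * ∑ x, G x ^ 2) ^ 2 := pow_le_pow_left₀ (sq_nonneg _) h1 2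
    _ = n ^ 2 * (∑ x, G x ^ 2) ^ 2 := by ring
    _ ≤ n ^ 2 * (n ^ 2 * ∑ y, ∑ y', (∑ x, g x y * g x y') ^ 2) :=
      mul_le_mul_of_nonneg_left h2 (by positivity)
    _ = _ := by ring

/-- Every bilinear form with kernel `g` and bounded arguments is at most `B`. -/
def CutBound (g : X → X → ℝ) (B : ℝ) : Prop :=
  ∀ u v : X → ℝ, (∀ x, |u x| ≤ 1) → (∀ x, |v x| ≤ 1) → |∑ x, ∑ y, g x y * (u x * v y)| ≤ B

lemma abs_mul_le_one {a b : ℝ} (ha : |a| ≤ 1) (hb : |b| ≤ 1) : |a * b| ≤ 1 := by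
  rw [abs_mul]; exact mul_le_one₀ ha (abs_nonneg _) hb

lemma CutBound.abs_sum_le {g : X → X → ℝ} {B : ℝ} (hg : CutBound g B) {P Q : X → X → ℝ}
    (hP : ∀ x z, |P x z| ≤ 1) (hQ : ∀ y z, |Q y z| ≤ 1) :
    |∑ z, ∑ x, ∑ y, g x y * (P x z * Q y z)| ≤ Fintype.card X * B := by
  calc _ ≤ ∑ z, |∑ x, ∑ y, g x y * (P x z * Q y z)| := Finset.abs_sum_le_sum_abs _ _
    _ ≤ ∑ _z : X, B := Finset.sum_le_sum fun z _ =>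
      hg (fun x => P x z) (fun y => Q y z) (fun x => hP x z) fun y => hQ y z
    _ = _ := by simp

/-- Replacing each factor of a triangle count by a function close to it in cut norm. -/
lemma abs_triangle_sub_le {F₁ F₂ F₃ T : X → X → ℝ} {s : X → ℝ} {B : ℝ}
    (h₂ : ∀ x y, |F₂ x y| ≤ 1) (h₃ : ∀ x y, |F₃ x y| ≤ 1)
    (hT : ∀ x y, |T x y| ≤ 1) (hs : ∀ x, |s x| ≤ 1)
    (c₁ : CutBound (fun x y => F₁ x y - T x y) B) (c₂ : CutBound (fun x y => F₂ x y - T x y) B)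
    (c₃ : CutBound (fun x y => F₃ x y - T x y) B) :
    |∑ x, ∑ y, ∑ z, s x * s y * s z * (F₁ x y * F₂ x z * F₃ y z)
      - ∑ x, ∑ y, ∑ z, s x * s y * s z * (T x y * T x z * T y z)| ≤ 3 * (Fintype.card X * B) := by
  have k₁ := c₁.abs_sum_le (P := fun x z => (s x * s z) * F₂ x z) (Q := fun y z => s y * F₃ y z)
    (fun x z => abs_mul_le_one (abs_mul_le_one (hs x) (hs z)) (h₂ x z))
    (fun y z => abs_mul_le_one (hs y) (h₃ y z))
  have k₂ := c₂.abs_sum_le (P := fun x y => (s x * s y) * T x y) (Q := fun z y => s z * F₃ y z)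
    (fun x z => abs_mul_le_one (abs_mul_le_one (hs x) (hs z)) (hT x z))
    (fun y z => abs_mul_le_one (hs y) (h₃ z y))
  have k₃ := c₃.abs_sum_le (P := fun y x => (s x * s y) * T x y) (Q := fun z x => s z * T x z)
    (fun x z => abs_mul_le_one (abs_mul_le_one (hs z) (hs x)) (hT z x))
    (fun y z => abs_mul_le_one (hs y) (hT z y))
  have e₁ : ∑ z, ∑ x, ∑ y, (F₁ x y - T x y) * (((s x * s z) * F₂ x z) * (s y * F₃ y z))
      = ∑ x, ∑ y, ∑ z, (F₁ x y - T x y) * (((s x * s z) * F₂ x z) * (s y * F₃ y z)) := by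
    rw [Finset.sum_comm]
    exact Finset.sum_congr rfl fun x _ => Finset.sum_comm
  have e₂ : ∑ y, ∑ x, ∑ z, (F₂ x z - T x z) * (((s x * s y) * T x y) * (s z * F₃ y z))
      = ∑ x, ∑ y, ∑ z, (F₂ x z - T x z) * (((s x * s y) * T x y) * (s z * F₃ y z)) :=
    Finset.sum_comm
  rw [e₁] at k₁
  rw [e₂] at k₂
  have e : ∑ x, ∑ y, ∑ z, s x * s y * s z * (F₁ x y * F₂ x z * F₃ y z)
      - ∑ x, ∑ y, ∑ z, s x * s y * s z * (T x y * T x z * T y z)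
      = ∑ x, ∑ y, ∑ z, (F₁ x y - T x y) * (((s x * s z) * F₂ x z) * (s y * F₃ y z))
      + ∑ x, ∑ y, ∑ z, (F₂ x z - T x z) * (((s x * s y) * T x y) * (s z * F₃ y z))
      + ∑ x, ∑ y, ∑ z, (F₃ y z - T y z) * (((s x * s y) * T x y) * (s z * T x z)) := by
    simp only [← Finset.sum_sub_distrib, ← Finset.sum_add_distrib]
    exact Finset.sum_congr rfl fun x _ => Finset.sum_congr rfl fun y _ =>
      Finset.sum_congr rfl fun z _ => by ring
  rw [e]
  refine (abs_add_three _ _ _).trans ?_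
  linarith

end CutNorm

section RandomColouring

lemma isProb_uniform {C : Type} [Fintype C] [Nonempty C] :
    IsProb (fun _ : C => (Fintype.card C : ℝ)⁻¹) := by
  refine ⟨fun _ => by positivity, ?_⟩
  rw [Finset.sum_const, Finset.card_univ, nsmul_eq_mul]
  exact mul_inv_cancel₀ (by exact_mod_cast Fintype.card_ne_zero)

variable {C : Type} [Fintype C] [DecidableEq C] {n : ℕ}

/-- The indicator of the increasing pairs of colour `a`. -/
def colInd (ω : Fin n × Fin n → C) (a : C) (x y : Fin n) : ℝ :=
  if x < y ∧ ω (x, y) = a then 1 else 0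

/-- The indicator of the increasing pairs. -/
def ltInd (x y : Fin n) : ℝ := if x < y then 1 else 0

/-- The deviation of the indicator of a colour from its mean. -/
noncomputable def colDev (ω : Fin n × Fin n → C) (a : C) (x y : Fin n) : ℝ :=
  colInd ω a x y - ltInd x y / Fintype.card C

lemma abs_colDev_le_one [Nonempty C] (ω : Fin n × Fin n → C) (a : C) (x y : Fin n) :
    |colDev ω a x y| ≤ 1 := by
  have h1 : (1 : ℝ) ≤ Fintype.card C := by exact_mod_cast Fintype.card_pos
  have h2 : 1 / (Fintype.card C : ℝ) ≤ 1 := (div_le_one (by linarith)).2 h1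
  have h3 : 0 ≤ 1 / (Fintype.card C : ℝ) := by positivity
  unfold colDev colInd ltInd
  by_cases hxy : x < y <;> by_cases hω : ω (x, y) = a <;> simp only [hxy, hω, and_self, and_false,
    false_and, if_true, if_false, zero_div, sub_zero, zero_sub] <;>
    rw [abs_le] <;> constructor <;> linarith

lemma sum_colDev_update [Nonempty C] (ω : Fin n × Fin n → C) (a : C) (x y : Fin n) :
    ∑ b, (Fintype.card C : ℝ)⁻¹ * colDev (Function.update ω (x, y) b) a x y = 0 := by
  have hc : (Fintype.card C : ℝ) ≠ 0 := by exact_mod_cast Fintype.card_ne_zero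
  by_cases hxy : x < y
  · simp only [colDev, colInd, ltInd, hxy, Function.update_self, true_and, if_true, mul_sub,
      Finset.sum_sub_distrib, mul_ite, mul_one, mul_zero]
    simp [hc]
  · simp [colDev, colInd, ltInd, hxy]

lemma colDev_update_of_ne (ω : Fin n × Fin n → C) (a b : C) {x y : Fin n} {p : Fin n × Fin n}
    (h : (x, y) ≠ p) : colDev (Function.update ω p b) a x y = colDev ω a x y := by
  simp only [colDev, colInd, Function.update_of_ne h]

lemma pexp_colDev_box [Nonempty C] (a : C) {x x' y y' : Fin n} (hx : x ≠ x') (hy : y ≠ y') :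
    pexp (fun _ : Fin n × Fin n => fun _ : C => (Fintype.card C : ℝ)⁻¹) (fun ω =>
      (colDev ω a x y * colDev ω a x y') * (colDev ω a x' y * colDev ω a x' y')) = 0 := by
  rw [← pexp_avg (x, y) isProb_uniform.2]
  have h1 : (x, y') ≠ (x, y) := by simp [hy.symm]
  have h2 : (x', y) ≠ (x, y) := by simp [hx.symm]
  have h3 : (x', y') ≠ (x, y) := by simp [hx.symm]
  have : ∀ ω : Fin n × Fin n → C, ∑ b, (Fintype.card C : ℝ)⁻¹ *
      ((colDev (Function.update ω (x, y) b) a x y * colDev (Function.update ω (x, y) b) a x y') *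
      (colDev (Function.update ω (x, y) b) a x' y *
        colDev (Function.update ω (x, y) b) a x' y')) = 0 := by
    intro ω
    simp only [colDev_update_of_ne ω a _ h1, colDev_update_of_ne ω a _ h2,
      colDev_update_of_ne ω a _ h3]
    calc _ = (∑ b, (Fintype.card C : ℝ)⁻¹ * colDev (Function.update ω (x, y) b) a x y) *
          (colDev ω a x y' * (colDev ω a x' y * colDev ω a x' y')) := by
          rw [Finset.sum_mul]; exact Finset.sum_congr rfl fun b _ => by ring
      _ = 0 := by rw [sum_colDev_update, zero_mul]
  simp only [this]
  simp [pexp]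

lemma pexp_sum_box_le [Nonempty C] (a : C) :
    pexp (fun _ : Fin n × Fin n => fun _ : C => (Fintype.card C : ℝ)⁻¹) (fun ω =>
      ∑ y, ∑ y', (∑ x, colDev ω a x y * colDev ω a x y') ^ 2) ≤ 2 * (n : ℝ) ^ 3 := by
  simp only [sq, Finset.sum_mul_sum]
  simp_rw [pexp_sum]
  calc _ ≤ ∑ y : Fin n, ∑ y' : Fin n, ∑ x : Fin n, ∑ x' : Fin n,
        ((if y = y' then (1 : ℝ) else 0) + if x = x' then 1 else 0) := by
        refine Finset.sum_le_sum fun y _ => Finset.sum_le_sum fun y' _ =>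
          Finset.sum_le_sum fun x _ => Finset.sum_le_sum fun x' _ => ?_
        have hle : pexp (fun _ : Fin n × Fin n => fun _ : C => (Fintype.card C : ℝ)⁻¹) (fun ω =>
            (colDev ω a x y * colDev ω a x y') * (colDev ω a x' y * colDev ω a x' y')) ≤ 1 := by
          refine (pexp_mono (g := fun _ => 1) (fun _ => isProb_uniform) fun ω => ?_).trans
            (pexp_one fun _ => isProb_uniform).le
          exact (le_abs_self _).trans (abs_mul_le_one
            (abs_mul_le_one (abs_colDev_le_one _ _ _ _) (abs_colDev_le_one _ _ _ _))
            (abs_mul_le_one (abs_colDev_le_one _ _ _ _) (abs_colDev_le_one _ _ _ _)))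
        by_cases hy : y = y'
        · refine hle.trans ?_
          split_ifs <;> norm_num
        · by_cases hx : x = x'
          · refine hle.trans ?_
            simp [hx, hy]
          · rw [pexp_colDev_box a hx hy]
            simp [hx, hy]
    _ = 2 * (n : ℝ) ^ 3 := by
        simp only [Finset.sum_add_distrib, Finset.sum_const, Finset.card_univ, Fintype.card_fin,
          nsmul_eq_mul, Finset.sum_ite_eq, Finset.mem_univ, if_true, ← Finset.mul_sum]
        ring

/-- There are colourings of pairs all of whose colours are uniformly distributed. -/
theorem exists_uniform_colouring (C : Type) [Fintype C] [DecidableEq C] [Nonempty C] {θ : ℝ}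
    (hθ : 0 < θ) (N : ℕ) :
    ∃ n, N ≤ n ∧ ∃ ω : Fin n × Fin n → C, ∀ a, CutBound (colDev ω a) (θ * n ^ 2) := by
  obtain ⟨N₁, hN₁⟩ := exists_nat_gt (2 * Fintype.card C / θ ^ 4)
  set n := N + N₁ with hn
  have h1 : -(2 * (n : ℝ) ^ 3 * Fintype.card C) ≤
      pexp (fun _ : Fin n × Fin n => fun _ : C => (Fintype.card C : ℝ)⁻¹) (fun ω =>
        (-1) * ∑ a, ∑ y, ∑ y', (∑ x, colDev ω a x y * colDev ω a x y') ^ 2) := by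
    rw [pexp_const_mul, pexp_sum]
    have := Finset.sum_le_sum fun (a : C) (_ : a ∈ Finset.univ) => pexp_sum_box_le (n := n) a
    simp only [Finset.sum_const, Finset.card_univ, nsmul_eq_mul] at this
    linarith
  obtain ⟨ω, hω⟩ := exists_le_of_pexp_le (fun _ => isProb_uniform) h1
  refine ⟨n, Nat.le_add_right _ _, ω, fun a u v hu hv => ?_⟩
  have h2 : ∑ y, ∑ y', (∑ x, colDev ω a x y * colDev ω a x y') ^ 2
      ≤ ∑ a, ∑ y, ∑ y', (∑ x, colDev ω a x y * colDev ω a x y') ^ 2 :=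
    Finset.single_le_sum
      (f := fun a => ∑ y, ∑ y', (∑ x, colDev ω a x y * colDev ω a x y') ^ 2)
      (fun a _ => Finset.sum_nonneg fun y _ => Finset.sum_nonneg fun y' _ => sq_nonneg _)
      (Finset.mem_univ a)
  have h3 := pow_four_bilinear_le (g := colDev ω a) hu hv
  rw [Fintype.card_fin] at h3
  have hn1 : (2 * Fintype.card C : ℝ) ≤ θ ^ 4 * n := by
    rw [div_lt_iff₀ (by positivity)] at hN₁
    have : (N₁ : ℝ) ≤ n := by rw [hn]; exact_mod_cast Nat.le_add_left _ _
    nlinarith [pow_pos hθ 4]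
  refine abs_le_of_sq_le_sq ?_ (by positivity)
  refine le_of_sq_le_sq ?_ (by positivity)
  calc ((∑ x, ∑ y, colDev ω a x y * (u x * v y)) ^ 2) ^ 2
      = (∑ x, ∑ y, colDev ω a x y * (u x * v y)) ^ 4 := by ring
    _ ≤ (n : ℝ) ^ 4 * (2 * (n : ℝ) ^ 3 * Fintype.card C) :=
      h3.trans (mul_le_mul_of_nonneg_left (by linarith) (by positivity))
    _ = (n : ℝ) ^ 7 * (2 * Fintype.card C) := by ring
    _ ≤ (n : ℝ) ^ 7 * (θ ^ 4 * n) := mul_le_mul_of_nonneg_left hn1 (by positivity)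
    _ = ((θ * n ^ 2) ^ 2) ^ 2 := by ring

end RandomColouring

section PaletteHypergraph

variable {C : Type} [DecidableEq C] {n : ℕ}

/-- The increasing triples whose pairs receive an admissible triple of colours. -/
def admissibleTriples (ω : Fin n × Fin n → C) (A : Finset (C × C × C)) :
    Finset (Fin n × Fin n × Fin n) :=
  Finset.univ.filter fun t => t.1 < t.2.1 ∧ t.2.1 < t.2.2 ∧
    (ω (t.1, t.2.1), ω (t.1, t.2.2), ω (t.2.1, t.2.2)) ∈ A

/-- The underlying set of a triple. -/
def tripleSet (t : Fin n × Fin n × Fin n) : Finset ℕ := {t.1.1, t.2.1.1, t.2.2.1}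

lemma tripleSet_subset_iff {t : Fin n × Fin n × Fin n} {S : Finset ℕ} :
    tripleSet t ⊆ S ↔ t.1.1 ∈ S ∧ t.2.1.1 ∈ S ∧ t.2.2.1 ∈ S := by
  simp [tripleSet, Finset.insert_subset_iff]

lemma eq_of_increasing_triple_eq {a b c x y z : ℕ} (hab : a < b) (hbc : b < c) (hxy : x < y)
    (hyz : y < z) (h : ({a, b, c} : Finset ℕ) = {x, y, z}) : a = x ∧ b = y ∧ c = z := by
  have ha : a ∈ ({x, y, z} : Finset ℕ) := h ▸ by simp
  have hb : b ∈ ({x, y, z} : Finset ℕ) := h ▸ by simp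
  have hc : c ∈ ({x, y, z} : Finset ℕ) := h ▸ by simp
  simp only [Finset.mem_insert, Finset.mem_singleton] at ha hb hc
  omega

lemma injOn_tripleSet (ω : Fin n × Fin n → C) (A : Finset (C × C × C)) :
    Set.InjOn tripleSet (admissibleTriples ω A : Set (Fin n × Fin n × Fin n)) := by
  rintro ⟨a, b, c⟩ h ⟨x, y, z⟩ h' e
  simp only [admissibleTriples, Finset.coe_filter, Finset.mem_univ, true_and,
    Set.mem_ofPred_eq] at h h'
  obtain ⟨h1, h2, h3⟩ := eq_of_increasing_triple_eq (a := a) (b := b) (c := c) (x := x) (y := y)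
    (z := z) h.1 h.2.1 h'.1 h'.2.1 e
  rw [Fin.ext h1, Fin.ext h2, Fin.ext h3]

lemma sum_colInd_mul (ω : Fin n × Fin n → C) (A : Finset (C × C × C)) (x y z : Fin n) :
    ∑ p ∈ A, colInd ω p.1 x y * colInd ω p.2.1 x z * colInd ω p.2.2 y z
      = if (x, y, z) ∈ admissibleTriples ω A then 1 else 0 := by
  by_cases h : x < y ∧ y < z
  · have hxz : x < z := h.1.trans h.2
    have : ∀ p ∈ A, colInd ω p.1 x y * colInd ω p.2.1 x z * colInd ω p.2.2 y z
        = if (ω (x, y), ω (x, z), ω (y, z)) = p then 1 else 0 := by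
      rintro ⟨a, b, c⟩ -
      simp only [colInd, h.1, h.2, hxz, true_and, Prod.mk.injEq]
      by_cases h1 : ω (x, y) = a <;> by_cases h2 : ω (x, z) = b <;>
        by_cases h3 : ω (y, z) = c <;> simp [h1, h2, h3]
    rw [Finset.sum_congr rfl this, Finset.sum_ite_eq]
    simp [admissibleTriples, h.1, h.2]
  · have h1 : (x, y, z) ∉ admissibleTriples ω A := fun hm => by
      simp only [admissibleTriples, Finset.mem_filter] at hm
      exact h ⟨hm.2.1, hm.2.2.1⟩
    rw [if_neg h1]
    refine Finset.sum_eq_zero fun p _ => ?_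
    by_cases hxy : x < y
    · have hyz : ¬ y < z := fun hyz => h ⟨hxy, hyz⟩
      simp [colInd, hyz]
    · simp [colInd, hxy]

/-- The indicator of a set of natural numbers, restricted to `Fin n`. -/
def memInd (S : Finset ℕ) (x : Fin n) : ℝ := if x.1 ∈ S then 1 else 0

lemma abs_memInd_le_one (S : Finset ℕ) (x : Fin n) : |memInd S x| ≤ 1 := by
  unfold memInd; split_ifs <;> simp

lemma card_filter_tripleSet_subset (T : Finset (Fin n × Fin n × Fin n)) (S : Finset ℕ) :
    ((T.filter fun t => tripleSet t ⊆ S).card : ℝ)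
      = ∑ x, ∑ y, ∑ z, memInd S x * memInd S y * memInd S z *
        if (x, y, z) ∈ T then (1 : ℝ) else 0 := by
  have e : (T.filter fun t => tripleSet t ⊆ S)
      = Finset.univ.filter fun t => t ∈ T ∧ tripleSet t ⊆ S := by ext; simp
  rw [e, Finset.card_filter, Nat.cast_sum, Fintype.sum_prod_type]
  refine Finset.sum_congr rfl fun x _ => ?_
  rw [Fintype.sum_prod_type]
  refine Finset.sum_congr rfl fun y _ => Finset.sum_congr rfl fun z _ => ?_
  simp only [tripleSet_subset_iff, memInd]
  by_cases h1 : x.1 ∈ S <;> by_cases h2 : y.1 ∈ S <;> by_cases h3 : z.1 ∈ S <;>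
    by_cases h4 : (x, y, z) ∈ T <;> simp [h1, h2, h3, h4]

lemma choose_three_le_sum_ltInd {S : Finset ℕ} (hS : S ⊆ Finset.range n) :
    (S.card.choose 3 : ℝ) ≤ ∑ x : Fin n, ∑ y, ∑ z, memInd S x * memInd S y * memInd S z *
      (ltInd x y * ltInd x z * ltInd y z) := by
  set T : Finset (Fin n × Fin n × Fin n) :=
    Finset.univ.filter fun t => t.1 < t.2.1 ∧ t.2.1 < t.2.2 with hT
  have e : ∀ x y z : Fin n, ltInd x y * ltInd x z * ltInd y z
      = if (x, y, z) ∈ T then (1 : ℝ) else 0 := fun x y z => by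
    simp only [hT, ltInd, Finset.mem_filter, Finset.mem_univ, true_and]
    by_cases h1 : x < y <;> by_cases h2 : y < z
    · simp [h1, h2, h1.trans h2]
    all_goals simp [h1, h2]
  simp only [e]
  rw [← card_filter_tripleSet_subset T S, ← Finset.card_powersetCard]
  refine Nat.cast_le.2 (Finset.card_le_card_of_surjOn tripleSet fun s hs => ?_)
  obtain ⟨hsS, hs3⟩ := Finset.mem_powersetCard.1 (Finset.mem_coe.1 hs)
  obtain ⟨u, v, w, huv, hvw, rfl⟩ := exists_increasing_triple Function.injective_id hs3
  have hlt : ∀ a ∈ ({u, v, w} : Finset ℕ), a < n := fun a ha => Finset.mem_range.1 (hS (hsS ha))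
  refine ⟨(⟨u, hlt u (by simp)⟩, ⟨v, hlt v (by simp)⟩, ⟨w, hlt w (by simp)⟩), ?_, rfl⟩
  simp only [hT, Finset.coe_filter, Finset.mem_filter, Finset.mem_univ, true_and,
    Set.mem_ofPred_eq, Fin.mk_lt_mk]
  exact ⟨⟨huv, hvw⟩, hsS⟩

/-- A colouring with uniformly distributed colours has the expected number of admissible triples
in every set of vertices. -/
lemma le_card_admissibleTriples [Fintype C] [Nonempty C] {ω : Fin n × Fin n → C} {B : ℝ}
    (hω : ∀ a, CutBound (colDev ω a) B) (A : Finset (C × C × C)) {S : Finset ℕ}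
    (hS : S ⊆ Finset.range n) :
    (A.card : ℝ) / (Fintype.card C : ℝ) ^ 3 * (S.card.choose 3 : ℝ) - A.card * (3 * (n * B))
      ≤ ((admissibleTriples ω A).filter fun t => tripleSet t ⊆ S).card := by
  have hc : (1 : ℝ) ≤ Fintype.card C := by exact_mod_cast Fintype.card_pos
  have hF : ∀ a (x y : Fin n), |colInd ω a x y| ≤ 1 := fun a x y => by
    unfold colInd; split_ifs <;> simp
  have hT : ∀ x y : Fin n, |ltInd x y / Fintype.card C| ≤ 1 := fun x y => by
    unfold ltInd
    split_ifs
    · rw [abs_of_nonneg (by positivity)]; exact (div_le_one (by linarith)).2 hc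
    · simp
  have e1 : (((admissibleTriples ω A).filter fun t => tripleSet t ⊆ S).card : ℝ)
      = ∑ p ∈ A, ∑ x, ∑ y, ∑ z, memInd S x * memInd S y * memInd S z *
        (colInd ω p.1 x y * colInd ω p.2.1 x z * colInd ω p.2.2 y z) := by
    rw [card_filter_tripleSet_subset]
    simp only [← sum_colInd_mul, Finset.mul_sum]
    rw [Finset.sum_comm (s := A)]
    refine Finset.sum_congr rfl fun x _ => ?_
    rw [Finset.sum_comm (s := A)]
    exact Finset.sum_congr rfl fun y _ => Finset.sum_comm
  have key : ∀ p ∈ A, (S.card.choose 3 : ℝ) / (Fintype.card C : ℝ) ^ 3 - 3 * (n * B)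
      ≤ ∑ x, ∑ y, ∑ z, memInd S x * memInd S y * memInd S z *
        (colInd ω p.1 x y * colInd ω p.2.1 x z * colInd ω p.2.2 y z) := fun p _ => by
    have h1 := abs_triangle_sub_le (hF p.2.1) (hF p.2.2) hT (abs_memInd_le_one S)
      (hω p.1) (hω p.2.1) (hω p.2.2)
    have h2 : ∑ x : Fin n, ∑ y, ∑ z, memInd S x * memInd S y * memInd S z *
        (ltInd x y / Fintype.card C * (ltInd x z / Fintype.card C) *
          (ltInd y z / Fintype.card C))
        = (∑ x : Fin n, ∑ y, ∑ z, memInd S x * memInd S y * memInd S z *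
          (ltInd x y * ltInd x z * ltInd y z)) / (Fintype.card C : ℝ) ^ 3 := by
      simp only [Finset.sum_div]
      exact Finset.sum_congr rfl fun x _ => Finset.sum_congr rfl fun y _ =>
        Finset.sum_congr rfl fun z _ => by ring
    have h3 := div_le_div_of_nonneg_right (choose_three_le_sum_ltInd hS)
      (by positivity : 0 ≤ (Fintype.card C : ℝ) ^ 3)
    rw [h2, Fintype.card_fin] at h1
    linarith [(abs_le.1 h1).1]
  rw [e1]
  have := Finset.sum_le_sum key
  rw [Finset.sum_const, nsmul_eq_mul] at this
  refine le_trans (le_of_eq ?_) this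
  ring

/-- The hypergraph of admissible triples. -/
def paletteHypergraph (ω : Fin n × Fin n → C) (A : Finset (C × C × C)) : Hypergraph3 where
  verts := Finset.range n
  edges := (admissibleTriples ω A).image tripleSet
  edges_sub := by
    intro e he
    obtain ⟨t, -, rfl⟩ := Finset.mem_image.1 he
    simp [tripleSet_subset_iff]
  edges_card := by
    intro e he
    obtain ⟨t, ht, rfl⟩ := Finset.mem_image.1 he
    simp only [admissibleTriples, Finset.mem_filter] at ht
    have h1 : t.1.1 < t.2.1.1 := ht.2.1
    have h2 : t.2.1.1 < t.2.2.1 := ht.2.2.1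
    exact Finset.card_eq_three.2 ⟨_, _, _, h1.ne, (h1.trans h2).ne, h2.ne, rfl⟩

lemma uniformlyDense_paletteHypergraph [Fintype C] [Nonempty C] {ω : Fin n × Fin n → C} {B ε : ℝ}
    (hω : ∀ a, CutBound (colDev ω a) B) (A : Finset (C × C × C))
    (hB : A.card * (3 * (n * B)) ≤ ε * (n : ℝ) ^ 3) :
    (paletteHypergraph ω A).UniformlyDense ((A.card : ℝ) / (Fintype.card C : ℝ) ^ 3) ε := by
  intro S hS
  have h1 := le_card_admissibleTriples hω A hS
  have h2 : ((admissibleTriples ω A).filter fun t => tripleSet t ⊆ S).card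
      ≤ ((paletteHypergraph ω A).edges.filter fun e => e ⊆ S).card := by
    refine Finset.card_le_card_of_injOn tripleSet (fun t ht => ?_)
      ((injOn_tripleSet ω A).mono (Finset.coe_subset.2 (Finset.filter_subset _ _)))
    rw [Finset.mem_coe, Finset.mem_filter] at ht ⊢
    exact ⟨Finset.mem_image_of_mem _ ht.1, ht.2⟩
  have h3 : ((paletteHypergraph ω A).verts.card : ℝ) = n := by simp [paletteHypergraph]
  rw [h3]
  have h4 : (((admissibleTriples ω A).filter fun t => tripleSet t ⊆ S).card : ℝ)
      ≤ ((paletteHypergraph ω A).edges.filter fun e => e ⊆ S).card := by exact_mod_cast h2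
  linarith

end PaletteHypergraph

namespace Palette

/-- The admissible triples of a palette, as triples of elements of its set of colours. -/
def subtypeTriples (P : Palette ℕ) : Finset (P.colors × P.colors × P.colors) :=
  Finset.univ.filter fun t => (t.1.1, t.2.1.1, t.2.2.1) ∈ P.triples

lemma card_subtypeTriples (P : Palette ℕ) : P.subtypeTriples.card = P.triples.card := by
  refine Finset.card_bij' (fun t _ => (t.1.1, t.2.1.1, t.2.2.1))
    (fun t ht => (⟨t.1, (Finset.mem_product.1 (P.triples_sub ht)).1⟩,
      ⟨t.2.1, (Finset.mem_product.1 (Finset.mem_product.1 (P.triples_sub ht)).2).1⟩,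
      ⟨t.2.2, (Finset.mem_product.1 (Finset.mem_product.1 (P.triples_sub ht)).2).2⟩))
    (fun t ht => (Finset.mem_filter.1 ht).2)
    (fun t ht => Finset.mem_filter.2 ⟨Finset.mem_univ _, ht⟩) (fun _ _ => rfl) fun _ _ => rfl

lemma density_eq (P : Palette ℕ) :
    P.density = (P.subtypeTriples.card : ℝ) / (Fintype.card P.colors : ℝ) ^ 3 := by
  rw [card_subtypeTriples, Fintype.card_coe, density]

instance (P : Palette ℕ) : Nonempty P.colors := P.nonempty.to_subtype

lemma admits_of_contains {V : Type} [DecidableEq V] {E : Set (Finset V)} (P : Palette ℕ) {n : ℕ}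
    {ω : Fin n × Fin n → P.colors} (h : (paletteHypergraph ω P.subtypeTriples).Contains E) :
    P.Admits E := by
  obtain ⟨f, hf, hv, he⟩ := h
  have hn : ∀ v, f v < n := fun v => Finset.mem_range.1 (hv v)
  have hinf : ∀ p : Sym2 V, (p.map f).inf < n := fun p => by
    induction p with
    | _ a b => simp [hn]
  have hsup : ∀ p : Sym2 V, (p.map f).sup < n := fun p => by
    induction p with
    | _ a b => simp [hn]
  refine ⟨fun u v => f u < f v, ?_, fun p => (ω (⟨_, hinf p⟩, ⟨_, hsup p⟩)).1,
    fun p => (ω _).2, fun u v w huv hvw hE => ?_⟩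
  · exact
      { irrefl := fun a => lt_irrefl _
        trans := fun a b c h1 h2 => lt_trans h1 h2
        trichotomous := fun a b h1 h2 => hf (le_antisymm (not_lt.1 h2) (not_lt.1 h1)) }
  · have h1 := he _ hE
    obtain ⟨⟨x, y, z⟩, ht, e⟩ := Finset.mem_image.1 h1
    have ht' := (Finset.mem_filter.1 ht).2
    rw [Finset.image_insert, Finset.image_insert, Finset.image_singleton] at e
    obtain ⟨h2, h3, h4⟩ := eq_of_increasing_triple_eq (x := f u) (y := f v) (z := f w)
      (a := x) (b := y) (c := z) ht'.1 ht'.2.1 huv hvw e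
    have h5 := (Finset.mem_filter.1 ht'.2.2).2
    have i1 : x.1 ≤ y.1 := ht'.1.le
    have i2 : y.1 ≤ z.1 := ht'.2.1.le
    have i3 : x.1 ≤ z.1 := i1.trans i2
    simp only [Sym2.map_mk, Sym2.inf_mk, Sym2.sup_mk, ← h2, ← h3, ← h4, min_eq_left i1,
      min_eq_left i2, min_eq_left i3, max_eq_right i1, max_eq_right i2, max_eq_right i3]
    exact h5

end Palette

/-- A palette that is not admitted bounds every forcing density from below. -/
lemma density_le_of_not_admits {V : Type} [DecidableEq V] {E : Set (Finset V)} {P : Palette ℕ}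
    (hP : ¬ P.Admits E) {d ε : ℝ} (hε : 0 < ε) {N : ℕ}
    (hd : ∀ H : Hypergraph3, N ≤ H.verts.card → H.UniformlyDense d ε → H.Contains E) :
    P.density ≤ d := by
  by_contra! hlt
  set a : ℝ := (P.subtypeTriples.card : ℝ) with ha
  have ha0 : 0 ≤ a := Nat.cast_nonneg _
  obtain ⟨n, hn, ω, hω⟩ := exists_uniform_colouring P.colors
    (θ := ε / (3 * a + 1)) (by positivity) N
  refine hP (P.admits_of_contains (hd (paletteHypergraph ω P.subtypeTriples) ?_ ?_))
  · simpa [paletteHypergraph] using hn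
  · have h1 := uniformlyDense_paletteHypergraph (ε := ε) hω P.subtypeTriples (by
      rw [← ha]
      have h2 : 3 * a * (ε / (3 * a + 1)) ≤ ε := by
        rw [mul_div_assoc', div_le_iff₀ (by positivity)]
        nlinarith
      calc _ = 3 * a * (ε / (3 * a + 1)) * (n : ℝ) ^ 3 := by ring
        _ ≤ _ := mul_le_mul_of_nonneg_right h2 (by positivity))
    rw [← P.density_eq] at h1
    intro S hS
    refine le_trans ?_ (h1 S hS)
    have := mul_le_mul_of_nonneg_right hlt.le (Nat.cast_nonneg (α := ℝ) (S.card.choose 3))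
    linarith

namespace Palette

lemma density_le_one (P : Palette ℕ) : P.density ≤ 1 := by
  rw [density]
  refine div_le_one_of_le₀ ?_ (by positivity)
  have := Finset.card_le_card P.triples_sub
  rw [Finset.card_product, Finset.card_product] at this
  calc (P.triples.card : ℝ) ≤ (P.colors.card * (P.colors.card * P.colors.card) : ℕ) := by
        exact_mod_cast this
    _ = (P.colors.card : ℝ) ^ 3 := by push_cast; ring

lemma density_nonneg (P : Palette ℕ) : 0 ≤ P.density := by
  rw [density]; positivity

lemma triDensity_not_mem (P : Palette ℕ) :
    triDensity (fun _ : P.colors => (Fintype.card P.colors : ℝ)⁻¹)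
      (fun _ => (Fintype.card P.colors : ℝ)⁻¹) (fun _ => (Fintype.card P.colors : ℝ)⁻¹)
      (fun a b c => if (a, b, c) ∈ P.subtypeTriples then 0 else 1) = 1 - P.density := by
  have hc : (Fintype.card P.colors : ℝ) ≠ 0 := by exact_mod_cast Fintype.card_ne_zero
  have h1 : ∑ a : P.colors, ∑ b : P.colors, ∑ c : P.colors,
      (if (a, b, c) ∈ P.subtypeTriples then (1 : ℝ) else 0) = P.subtypeTriples.card := by
    simp only [← Fintype.sum_prod_type'
      (f := fun b c : P.colors => if (_, b, c) ∈ P.subtypeTriples then (1 : ℝ) else 0)]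
    rw [← Fintype.sum_prod_type
      (f := fun t : P.colors × P.colors × P.colors =>
        if t ∈ P.subtypeTriples then (1 : ℝ) else 0)]
    simp
  have h2 : ∀ a b c : P.colors, (if (a, b, c) ∈ P.subtypeTriples then (0 : ℝ) else 1)
      = 1 - if (a, b, c) ∈ P.subtypeTriples then 1 else 0 := fun a b c => by split_ifs <;> norm_num
  simp only [triDensity, ← Finset.mul_sum, h2, Finset.sum_sub_distrib, h1, P.density_eq]
  simp only [Finset.sum_const, Finset.card_univ, nsmul_eq_mul, mul_one]
  field_simp

/-- Every hypergraph admits the palettes of density close to one. -/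
lemma admits_of_density_close_to_one {V : Type} [Fintype V] [DecidableEq V] (E : Set (Finset V))
    (P : Palette ℕ) (hP : (Fintype.card V : ℝ) ^ 3 * (1 - P.density) < 1) : P.Admits E := by
  set k := Fintype.card V with hk
  set σ : V ≃ Fin k := Fintype.equivFin V
  let f : Fin k × Fin k × Fin k → (Sym2 (Fin k) → P.colors) → ℝ := fun t ω =>
    if t.1 < t.2.1 ∧ t.2.1 < t.2.2 then
      (if (ω s(t.1, t.2.1), ω s(t.1, t.2.2), ω s(t.2.1, t.2.2)) ∈ P.subtypeTriples then 0 else 1)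
    else 0
  have hf0 : ∀ t ω, 0 ≤ f t ω := fun t ω => by
    simp only [f]; split_ifs <;> norm_num
  have hfc : ∀ t, pexp (fun _ : Sym2 (Fin k) => fun _ : P.colors =>
      (Fintype.card P.colors : ℝ)⁻¹) (f t) ≤ 1 - P.density := fun t => by
    by_cases h : t.1 < t.2.1 ∧ t.2.1 < t.2.2
    · have h1 := h.1.ne
      have h2 := h.2.ne
      have h3 := (h.1.trans h.2).ne
      simp only [f, h, and_self, if_true]
      refine le_of_eq ((pexp_triple (fun _ => isProb_uniform) ?_ ?_ ?_ (fun a b c : P.colors =>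
        if (a, b, c) ∈ P.subtypeTriples then (0 : ℝ) else 1)).trans P.triDensity_not_mem)
      all_goals
        simp only [ne_eq, Sym2.eq_iff]
        tauto
    · simp only [f, h, if_false]
      rw [pexp_const fun _ => isProb_uniform]
      linarith [P.density_le_one]
  obtain ⟨ω, hω⟩ := exists_forall_lt_one_of_pexp_le (fun _ => isProb_uniform) hf0 hfc (by
    simp only [Fintype.card_prod, Fintype.card_fin]
    push_cast
    calc _ = (k : ℝ) ^ 3 * (1 - P.density) := by ring
      _ < 1 := hP)
  refine ⟨fun u v => σ u < σ v, ?_, fun p => (ω (p.map σ)).1, fun p => (ω _).2,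
    fun u v w huv hvw _ => ?_⟩
  · exact
      { irrefl := fun a => lt_irrefl _
        trans := fun a b c h1 h2 => lt_trans h1 h2
        trichotomous := fun a b h1 h2 => σ.injective (le_antisymm (not_lt.1 h2) (not_lt.1 h1)) }
  · have h1 := hω (σ u, σ v, σ w)
    simp only [f, huv, hvw, and_self, if_true] at h1
    split_ifs at h1 with h2
    · exact (Finset.mem_filter.1 h2).2
    · exact absurd h1 (lt_irrefl _)

end Palette

/-- For every 3-graph `F`, the uniform Turán density equals the palette Turán
density, i.e. the supremum of densities of palettes that `F` does not admit. -/
theorem uniformTuranDensity_eq_paletteTuranDensity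
    {V : Type} [Fintype V] [DecidableEq V]
    (E : Set (Finset V)) (hE : ∀ e ∈ E, e.card = 3) :
    uniformTuranDensity E =
      sSup {d : ℝ | ∃ P : Palette ℕ, ¬ P.Admits E ∧ d = P.density} := by
  set D : Set ℝ := {d : ℝ | ∃ P : Palette ℕ, ¬ P.Admits E ∧ d = P.density} with hD
  have hk : (0 : ℝ) < (Fintype.card V : ℝ) ^ 3 + 1 := by positivity
  have hle : ∀ d ∈ D, d ≤ 1 - 1 / ((Fintype.card V : ℝ) ^ 3 + 1) := by
    rintro d ⟨P, hP, rfl⟩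
    by_contra! hlt
    refine hP (P.admits_of_density_close_to_one E ?_)
    have h1 : (1 - P.density) * ((Fintype.card V : ℝ) ^ 3 + 1) < 1 := by
      rw [← lt_div_iff₀ hk]; linarith
    nlinarith [P.density_le_one]
  have hbdd : BddAbove D := ⟨_, hle⟩
  have hs0 : 0 ≤ sSup D := Real.sSup_nonneg fun d ⟨P, _, h⟩ => h ▸ P.density_nonneg
  have hs1 : sSup D < 1 := by
    refine (Real.sSup_le hle ?_).trans_lt (by linarith [one_div_pos.2 hk])
    rw [sub_nonneg, div_le_one hk]
    linarith [pow_nonneg (Nat.cast_nonneg (α := ℝ) (Fintype.card V)) 3]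
  have hmem : ∀ d, sSup D < d → d ≤ 1 → d ∈ {d : ℝ | d ∈ Set.Icc (0 : ℝ) 1 ∧
      ∃ ε > (0 : ℝ), ∃ N : ℕ, ∀ H : Hypergraph3,
        N ≤ H.verts.card → H.UniformlyDense d ε → H.Contains E} := fun d hd hd1 => by
    refine ⟨⟨hs0.trans hd.le, hd1⟩, contains_of_forall_admits hE (δ := (d - sSup D) / 14)
      (by linarith) (by linarith) hd1 fun P hP => ?_⟩
    by_contra hn
    have := le_csSup hbdd (⟨P, hn, rfl⟩ : P.density ∈ D)
    linarith
  refine le_antisymm ?_ ?_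
  · refine le_of_forall_gt_imp_ge_of_dense fun d hd => ?_
    refine (csInf_le ⟨0, fun x hx => hx.1.1⟩
      (hmem (min d 1) (lt_min hd hs1) (min_le_right _ _))).trans (min_le_left _ _)
  · refine le_csInf ⟨1, hmem 1 hs1 le_rfl⟩ fun d hd => Real.sSup_le ?_ hd.1.1
    obtain ⟨-, ε, hε, N, hN⟩ := hd
    rintro _ ⟨P, hP, rfl⟩
    exact density_le_of_not_admits hP hε hN
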